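/- Characterization of shielded indecomposable continua: A shielded continuum X in a closed surface S is indecomposable if and only if there exists a sequence (Uₙ) of complementary domains of X satisfying the double-pass condition. -/

import Mathlib

open Set Metric Filter Topology

/-- A space is locally homeomorphic to ℝ²: every point has an open
neighborhood homeomorphic to the Euclidean plane. -/
def LocallyEuclidean2 (S : Type*) [TopologicalSpace S] : Prop :=
  ∀ x : S, ∃ U : Set S, IsOpen U ∧ x ∈ U ∧
    Nonempty (U ≃ₜ EuclideanSpace ℝ (Fin 2))

section Defs

variable {S : Type*} [TopologicalSpace S]

/-- A continuum: a nonempty compact connected subset. -/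
def IsContinuum (X : Set S) : Prop := IsCompact X ∧ IsConnected X

/-- A complementary domain of `X`: a connected component of the complement of `X`. -/
def IsComplementaryDomain (X U : Set S) : Prop :=
  ∃ x, x ∉ X ∧ U = connectedComponentIn Xᶜ x

/-- A proper subcontinuum of `X`. -/
def IsProperSubcontinuum (X A : Set S) : Prop :=
  A.Nonempty ∧ IsClosed A ∧ IsConnected A ∧ A ⊆ X ∧ A ≠ X

/-- `X` is decomposable: the union of two proper subcontinua. -/
def IsDecomposable (X : Set S) : Prop :=
  ∃ A B, IsProperSubcontinuum X A ∧ IsProperSubcontinuum X B ∧ A ∪ B = X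

/-- `X` is the essential union of three proper subcontinua. -/
def IsEssentialUnionOfThree (X : Set S) : Prop :=
  ∃ X₁ X₂ X₃, IsProperSubcontinuum X X₁ ∧ IsProperSubcontinuum X X₂ ∧
    IsProperSubcontinuum X X₃ ∧ X₁ ∪ X₂ ∪ X₃ = X ∧
    ¬ X₁ ⊆ X₂ ∪ X₃ ∧ ¬ X₂ ⊆ X₁ ∪ X₃ ∧ ¬ X₃ ⊆ X₁ ∪ X₂

/-- `X` is 2-indecomposable: decomposable but not the essential union of
three proper subcontinua. -/
def Is2Indecomposable (X : Set S) : Prop :=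
  IsDecomposable X ∧ ¬ IsEssentialUnionOfThree X

/-- `X` is shielded: no complementary domain has frontier equal to `X`. -/
def IsShielded (X : Set S) : Prop :=
  ∀ U, IsComplementaryDomain X U → frontier U ≠ X

/-- A generalized crosscut of `U`. -/
def IsGenCrosscut (U A : Set S) : Prop :=
  A ⊆ U ∧ Nonempty (A ≃ₜ Set.Ioo (0:ℝ) 1) ∧ closure A \ A ⊆ frontier U

/-- `T` is a shadow of the (generalized) crosscut `A` of `U`. -/
def IsShadowOf (U A T : Set S) : Prop :=
  ∃ x ∈ U \ A, T = closure (connectedComponentIn (U \ A) x) ∩ frontier U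

/-- An arc with endpoints `a` and `b`. -/
def IsArcFrom (A : Set S) (a b : S) : Prop :=
  ∃ f : Set.Icc (0:ℝ) 1 → S, Continuous f ∧ Function.Injective f ∧
    Set.range f = A ∧ f ⟨0, by norm_num⟩ = a ∧ f ⟨1, by norm_num⟩ = b

/-- A crosscut of `U`: a copy of `(0,1)` in `U` whose closure is an arc
meeting the frontier of `U` exactly at the endpoints of the arc. -/
def IsCrosscut (U K : Set S) : Prop :=
  K ⊆ U ∧ Nonempty (K ≃ₜ Set.Ioo (0:ℝ) 1) ∧
    ∃ a b, IsArcFrom (closure K) a b ∧ closure K ∩ frontier U = {a, b}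

/-- A closed disk: a set homeomorphic to the closed unit disk in ℝ². -/
def IsClosedDisk (D : Set S) : Prop :=
  Nonempty (D ≃ₜ Metric.closedBall (0 : EuclideanSpace ℝ (Fin 2)) 1)

/-- A cat's cradle between `d₁` and `d₃`: a family of arcs from `d₁` to `d₃`
whose interiors are pairwise disjoint. -/
def IsCatsCradle {ι : Type*} (d₁ d₃ : S) (A : ι → Set S) : Prop :=
  (∀ i, IsArcFrom (A i) d₁ d₃) ∧
    Pairwise fun i j => (A i \ {d₁, d₃}) ∩ (A j \ {d₁, d₃}) = ∅

/-- A cat's cradle between `d₁` and `d₃` through `D₂`. -/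
def IsCatsCradleThrough {ι : Type*} (d₁ d₃ : S) (D₂ : Set S) (A : ι → Set S) : Prop :=
  IsCatsCradle d₁ d₃ A ∧ D₂ ∩ {d₁, d₃} = ∅ ∧ ∀ i, (A i ∩ D₂).Nonempty

/-- A chord of the closed disk `D`: an arc in `D` meeting the frontier of `D`
exactly at its two endpoints. -/
def IsChord (D A : Set S) : Prop :=
  ∃ a b, IsArcFrom A a b ∧ A ⊆ D ∧ A ∩ frontier D = {a, b}

/-- A sequence of pairwise disjoint chords of `D` is linearly ordered if each
middle chord separates the earlier ones from the later ones in `D`. -/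
def LinearlyOrderedChords (D : Set S) (A : ℕ → Set S) : Prop :=
  (Pairwise fun i j => Disjoint (A i) (A j)) ∧
    ∀ i j k, i < j → j < k → ∀ x ∈ A i, ∀ y ∈ A k,
      connectedComponentIn (D \ A j) x ≠ connectedComponentIn (D \ A j) y

end Defs

section MetricDefs

variable {S : Type*} [MetricSpace S]

/-- Convergence of a sequence of sets to `X` in the Hausdorff metric. -/
def HausdorffConvergesTo (A : ℕ → Set S) (X : Set S) : Prop :=
  Tendsto (fun n => hausdorffDist (A n) X) atTop (𝓝 0)

/-- The double-pass condition for a sequence of domains. -/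
def DoublePassCondition (X : Set S) (U : ℕ → Set S) : Prop :=
  ∀ K : ℕ → Set S, (∀ n, IsGenCrosscut (U n) (K n)) →
    ∃ Sh : ℕ → Set S, (∀ n, IsShadowOf (U n) (K n) (Sh n)) ∧ HausdorffConvergesTo Sh X

/-- The double-pass condition with (genuine) crosscuts. -/
def DoublePassConditionCrosscuts (X : Set S) (U : ℕ → Set S) : Prop :=
  ∀ K : ℕ → Set S, (∀ n, IsCrosscut (U n) (K n)) →
    ∃ Sh : ℕ → Set S, (∀ n, IsShadowOf (U n) (K n) (Sh n)) ∧ HausdorffConvergesTo Sh X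

end MetricDefs

set_option linter.unusedSectionVars false


namespace DP

section Basics
variable {E F : Type*} [TopologicalSpace E] [TopologicalSpace F]

/-- `h` is a section of the cochain `f` near `x`. -/
def Sec (f : E → E → ZMod 2) (h : E → ZMod 2) (x : E) : Prop :=
  ∀ᶠ p : E × E in 𝓝 (x, x), f p.1 p.2 = h p.1 + h p.2

/-- `f` is locally trivial at `x`. -/
def LC (f : E → E → ZMod 2) (x : E) : Prop := ∃ h, Sec f h x

/-- `h` is locally constant at `x`. -/
def LCst (h : E → ZMod 2) (x : E) : Prop := ∀ᶠ y in 𝓝 x, h y = h x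

theorem z2 (a : ZMod 2) : a = 0 ∨ a = 1 := by
  revert a; decide

theorem Sec.add {f g : E → E → ZMod 2} {h k : E → ZMod 2} {x : E}
    (h1 : Sec f h x) (h2 : Sec g k x) : Sec (f + g) (h + k) x := by
  filter_upwards [h1, h2] with p hp hq
  simp only [Pi.add_apply, hp, hq]
  ring

theorem Sec.lcst {h : E → ZMod 2} {x : E} (h1 : Sec 0 h x) : LCst h x := by
  have := (h1 : ∀ᶠ p : E × E in 𝓝 (x, x), _)
  have h2 : Tendsto (fun y : E => (y, x)) (𝓝 x) (𝓝 (x, x)) :=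
    (by fun_prop : Continuous fun y : E => (y, x)).tendsto x
  filter_upwards [h2.eventually this] with y hy
  simp only [Pi.zero_apply] at hy
  grind

theorem LCst.sec {h : E → ZMod 2} {x : E} (h1 : LCst h x) : Sec 0 h x := by
  have := (h1 : ∀ᶠ p in 𝓝 x, _)
  have := this.prod_mk this
  rw [← nhds_prod_eq] at this
  filter_upwards [this] with p hp
  simp only [hp.1, hp.2, Pi.zero_apply]
  grind

theorem sec_zero_iff {h : E → ZMod 2} {x : E} : Sec 0 h x ↔ LCst h x := ⟨Sec.lcst, LCst.sec⟩

theorem add_self_fun {α : Type*} (f : α → ZMod 2) : f + f = 0 := by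
  funext a; simp only [Pi.add_apply, Pi.zero_apply]; grind

theorem add_self_fun2 {α β : Type*} (f : α → β → ZMod 2) : f + f = 0 := by
  funext a b; simp only [Pi.add_apply, Pi.zero_apply]; grind

theorem sec_iff {f : E → E → ZMod 2} {h : E → ZMod 2} {x : E} :
    Sec f h x ↔ ∃ N : Set E, IsOpen N ∧ x ∈ N ∧ ∀ y ∈ N, ∀ z ∈ N, f y z = h y + h z := by
  unfold Sec
  rw [nhds_prod_eq, Filter.Eventually, Filter.mem_prod_self_iff]
  constructor
  · rintro ⟨t, ht, hsub⟩
    obtain ⟨N, hN, hNo, hx⟩ := mem_nhds_iff.1 ht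
    exact ⟨N, hNo, hx, fun y hy z hz => hsub (Set.mk_mem_prod (hN hy) (hN hz))⟩
  · rintro ⟨N, hNo, hx, H⟩
    exact ⟨N, hNo.mem_nhds hx, fun p hp => H _ hp.1 _ hp.2⟩

theorem Sec.eventually {f : E → E → ZMod 2} {h : E → ZMod 2} {x : E} (h1 : Sec f h x) :
    ∀ᶠ y in 𝓝 x, Sec f h y := by
  obtain ⟨N, hNo, hx, H⟩ := sec_iff.1 h1
  filter_upwards [hNo.mem_nhds hx] with y hy
  exact sec_iff.2 ⟨N, hNo, hy, H⟩

theorem LC.eventually {f : E → E → ZMod 2} {x : E} (h1 : LC f x) :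
    ∀ᶠ y in 𝓝 x, LC f y := by
  obtain ⟨h, hh⟩ := h1
  filter_upwards [hh.eventually] with y hy
  exact ⟨h, hy⟩

theorem LCst.eventually {h : E → ZMod 2} {x : E} (h1 : LCst h x) :
    ∀ᶠ y in 𝓝 x, LCst h y := by
  filter_upwards [h1.sec.eventually] with y hy using hy.lcst

theorem Sec.lc {f : E → E → ZMod 2} {h : E → ZMod 2} {x : E} (h1 : Sec f h x) : LC f x := ⟨h, h1⟩

theorem LC.add {f g : E → E → ZMod 2} {x : E} (h1 : LC f x) (h2 : LC g x) : LC (f + g) x := by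
  obtain ⟨h, hh⟩ := h1
  obtain ⟨k, hk⟩ := h2
  exact ⟨_, hh.add hk⟩

theorem Sec.lcst_add {f : E → E → ZMod 2} {h k : E → ZMod 2} {x : E}
    (h1 : Sec f h x) (h2 : Sec f k x) : LCst (h + k) x := by
  have := h1.add h2
  rw [add_self_fun2] at this
  exact this.lcst

theorem Sec.add_lcst {f : E → E → ZMod 2} {h k : E → ZMod 2} {x : E}
    (h1 : Sec f h x) (h2 : LCst k x) : Sec f (h + k) x := by
  have := h1.add h2.sec
  rwa [add_zero] at this

theorem LCst.add {h k : E → ZMod 2} {x : E} (h1 : LCst h x) (h2 : LCst k x) :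
    LCst (h + k) x := by
  filter_upwards [h1, h2] with y a b
  simp only [Pi.add_apply, a, b]

theorem lcst_const (c : ZMod 2) (x : E) : LCst (fun _ : E => c) x :=
  Eventually.of_forall fun _ => rfl

theorem sec_zero_zero (x : E) : Sec (0 : E → E → ZMod 2) 0 x :=
  Eventually.of_forall fun _ => by simp

theorem LCst.congr {h k : E → ZMod 2} {x : E} (h1 : LCst h x) (h2 : ∀ᶠ y in 𝓝 x, h y = k y) :
    LCst k x := by
  filter_upwards [h1, h2] with y a b
  rw [← b, a, h2.self_of_nhds]

theorem Sec.congr {f : E → E → ZMod 2} {h k : E → ZMod 2} {x : E} (h1 : Sec f h x)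
    (h2 : ∀ᶠ y in 𝓝 x, h y = k y) : Sec f k x := by
  have := h2.prod_mk h2
  rw [← nhds_prod_eq] at this
  filter_upwards [h1, this] with p hp hq
  rw [hp, hq.1, hq.2]

/-- `f` and `g` coincide near `x`. -/
def Eqv (f g : E → E → ZMod 2) (x : E) : Prop :=
  ∀ᶠ p : E × E in 𝓝 (x, x), f p.1 p.2 = g p.1 p.2

theorem Eqv.symm {f g : E → E → ZMod 2} {x : E} (h : Eqv f g x) : Eqv g f x := by
  filter_upwards [h] with p hp using hp.symm

theorem Eqv.rfl' {f : E → E → ZMod 2} {x : E} : Eqv f f x := Eventually.of_forall fun _ => rfl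

theorem Eqv.trans {f g k : E → E → ZMod 2} {x : E} (h : Eqv f g x) (h' : Eqv g k x) :
    Eqv f k x := by
  filter_upwards [h, h'] with p hp hq using hp.trans hq

theorem Eqv.add {f g f' g' : E → E → ZMod 2} {x : E} (h : Eqv f g x) (h' : Eqv f' g' x) :
    Eqv (f + f') (g + g') x := by
  filter_upwards [h, h'] with p hp hq
  simp only [Pi.add_apply, hp, hq]

theorem Eqv.sec {f g : E → E → ZMod 2} {k : E → ZMod 2} {x : E} (h : Eqv f g x)
    (h' : Sec f k x) : Sec g k x := by
  filter_upwards [h, h'] with p hp hq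
  rw [← hp, hq]

theorem Eqv.lc {f g : E → E → ZMod 2} {x : E} (h : Eqv f g x)
    (h' : LC f x) : LC g x := by
  obtain ⟨k, hk⟩ := h'
  exact ⟨k, h.sec hk⟩

theorem Sec.eqv {f g : E → E → ZMod 2} {x : E} (h : Sec (f + g) 0 x) : Eqv f g x := by
  filter_upwards [h] with p hp
  simp only [Pi.add_apply, Pi.zero_apply] at hp
  grind

theorem Eqv.sec0 {f g : E → E → ZMod 2} {x : E} (h : Eqv f g x) : Sec (f + g) 0 x := by
  filter_upwards [h] with p hp
  simp only [Pi.add_apply, Pi.zero_apply]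
  grind

theorem LCst.lc_iff {h : E → ZMod 2} {s : Set E} (hs : IsPreconnected s)
    (H : ∀ x ∈ s, ∀ᶠ y in 𝓝[s] x, h y = h x) {x y : E} (hx : x ∈ s) (hy : y ∈ s) :
    h x = h y := by
  refine hs.induction₂ (fun a b => h a = h b) (fun a ha => ?_) ?_ ?_ hx hy
  rotate_left
  · intro a b c _ _ _ h1 h2
    exact Eq.trans h1 h2
  · intro a b _ _ h1
    exact Eq.symm h1
  filter_upwards [H a ha] with b hb using hb.symm

theorem lcst_pre {h : E → ZMod 2} {s : Set E} (hs : IsPreconnected s)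
    (H : ∀ x ∈ s, LCst h x) {x y : E} (hx : x ∈ s) (hy : y ∈ s) :
    h x = h y :=
  LCst.lc_iff hs (fun a ha => (H a ha).filter_mono nhdsWithin_le_nhds) hx hy

/-- pullback of a cochain -/
def pb (φ : F → E) (f : E → E → ZMod 2) : F → F → ZMod 2 := fun y z => f (φ y) (φ z)

theorem Sec.pb {f : E → E → ZMod 2} {h : E → ZMod 2} {φ : F → E} {x : F}
    (h1 : Sec f h (φ x)) (hφ : ContinuousAt φ x) : Sec (pb φ f) (h ∘ φ) x := by
  have : Tendsto (Prod.map φ φ) (𝓝 (x, x)) (𝓝 (φ x, φ x)) := by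
    rw [nhds_prod_eq, nhds_prod_eq]
    exact Tendsto.prodMap hφ hφ
  exact this.eventually h1

theorem LC.pb {f : E → E → ZMod 2} {φ : F → E} {x : F}
    (h1 : LC f (φ x)) (hφ : ContinuousAt φ x) : LC (pb φ f) x := by
  obtain ⟨h, hh⟩ := h1
  exact ⟨_, hh.pb hφ⟩

theorem LCst.pb {h : E → ZMod 2} {φ : F → E} {x : F}
    (h1 : LCst h (φ x)) (hφ : ContinuousAt φ x) : LCst (h ∘ φ) x :=
  hφ.eventually h1

theorem Sec.push {f : E → E → ZMod 2} {h : E → ZMod 2} {φ : F → E} {x : F}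
    (hφ : IsOpenEmbedding φ) (h1 : Sec (DP.pb φ f) (h ∘ φ) x) : Sec f h (φ x) := by
  obtain ⟨N, hNo, hx, H⟩ := sec_iff.1 h1
  refine sec_iff.2 ⟨φ '' N, hφ.isOpenMap N hNo, mem_image_of_mem _ hx, ?_⟩
  rintro _ ⟨y, hy, rfl⟩ _ ⟨z, hz, rfl⟩
  exact H y hy z hz

theorem LCst.push {h : E → ZMod 2} {φ : F → E} {x : F}
    (hφ : IsOpenEmbedding φ) (h1 : LCst (h ∘ φ) x) : LCst h (φ x) := by
  have : ∀ᶠ y in map φ (𝓝 x), h y = h (φ x) := h1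
  rwa [hφ.map_nhds_eq] at this

/-- a section of the pullback descends to the image of an open embedding -/
theorem descend [Nonempty F] {f : E → E → ZMod 2} {φ : F → E} (hφ : IsOpenEmbedding φ)
    (k : F → ZMod 2) : ∃ h : E → ZMod 2, h ∘ φ = k ∧ ∀ x, Sec (DP.pb φ f) k x → Sec f h (φ x) := by
  refine ⟨k ∘ Function.invFun φ, ?_, ?_⟩
  · funext x
    simp [Function.leftInverse_invFun hφ.injective x]
  · intro x hx
    apply Sec.push hφ
    convert hx using 1
    funext x
    simp [Function.leftInverse_invFun hφ.injective x]

end Basics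

section Glue
variable {E : Type*} [MetricSpace E]

open Classical in
/-- Gluing two torsors along a section of the sum on the overlap. -/
theorem glue {O1 O2 : Set E} (h1 : IsOpen O1) (h2 : IsOpen O2) (f1 f2 : E → E → ZMod 2)
    (h : E → ZMod 2) (H : ∀ x ∈ O1 ∩ O2, Sec (f1 + f2) h x) :
    ∃ F : E → E → ZMod 2, (∀ x ∈ O1, Eqv F f1 x) ∧
      ∀ x ∈ O2, Sec (F + f2) (fun y => if y ∈ O1 then h y else 0) x := by
  have hd1 : Disjoint (closure (O1 \ O2)) (O2 \ O1) := by
    rw [disjoint_left]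
    intro x hx hx2
    rw [mem_closure_iff_nhds] at hx
    obtain ⟨y, hy, hy'⟩ := hx O2 (h2.mem_nhds hx2.1)
    exact hy'.2 hy
  have hd2 : Disjoint (O1 \ O2) (closure (O2 \ O1)) := by
    rw [disjoint_right]
    intro x hx hx2
    rw [mem_closure_iff_nhds] at hx
    obtain ⟨y, hy, hy'⟩ := hx O1 (h1.mem_nhds hx2.1)
    exact hy'.2 hy
  have := CompletelyNormalSpace.completely_normal hd1 hd2
  obtain ⟨E1, E2, hE1, hE2, hs1, hs2, hdis⟩ := separatedNhds_iff_disjoint.2 this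
  set k : E → ZMod 2 := fun y => if y ∈ O1 then h y else 0 with hk
  refine ⟨fun y z => if y ∈ E1 then f1 y z else f2 y z + k y + k z, ?_, ?_⟩
  · intro x hx
    by_cases hx2 : x ∈ O2
    · have a := H x ⟨hx, hx2⟩
      have b : ∀ᶠ y in 𝓝 x, h y = k y := by
        filter_upwards [h1.mem_nhds hx] with y hy
        simp [hk, hy]
      have c := a.congr b
      filter_upwards [c] with p hp
      simp only [Pi.add_apply] at hp
      split_ifs
      · rfl
      · grind
    · have hxE : x ∈ E1 := hs1 ⟨hx, hx2⟩
      have : Prod.fst ⁻¹' E1 ∈ 𝓝 (x, x) := (hE1.preimage continuous_fst).mem_nhds hxE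
      filter_upwards [this] with p hp
      rw [if_pos (show p.1 ∈ E1 from hp)]
  · intro x hx
    by_cases hx1 : x ∈ O1
    · have a := H x ⟨hx1, hx⟩
      have b : ∀ᶠ y in 𝓝 x, h y = k y := by
        filter_upwards [h1.mem_nhds hx1] with y hy
        simp [hk, hy]
      have c := a.congr b
      filter_upwards [c] with p hp
      simp only [Pi.add_apply] at hp ⊢
      split_ifs
      · grind
      · grind
    · have hxE : x ∈ E2 := hs2 ⟨hx, hx1⟩
      have : Prod.fst ⁻¹' E2 ∈ 𝓝 (x, x) := (hE2.preimage continuous_fst).mem_nhds hxE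
      filter_upwards [this] with p hp
      have : p.1 ∉ E1 := fun h' => disjoint_left.1 hdis h' hp
      simp only [Pi.add_apply, if_neg this]
      grind

open Classical in
/-- Mayer-Vietoris: connecting map. -/
theorem mv {O1 O2 : Set E} (h1 : IsOpen O1) (h2 : IsOpen O2)
    (g : E → ZMod 2) (H : ∀ x ∈ O1 ∩ O2, LCst g x) :
    ∃ F : E → E → ZMod 2, (∀ x ∈ O1, Sec F 0 x) ∧
      (∀ x ∈ O2, Sec F (fun y => if y ∈ O1 then g y else 0) x) ∧
      ∀ r : E → ZMod 2, ∃ r1 r2 : E → ZMod 2, (∀ x ∈ O1, Sec F r x → LCst r1 x) ∧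
        (∀ x ∈ O2, Sec F r x → LCst r2 x) ∧ ∀ x ∈ O1, g x = r1 x + r2 x := by
  obtain ⟨F, hF1, hF2⟩ := glue h1 h2 0 0 g (fun x hx => by
    simpa using (H x hx).sec)
  have a1 : ∀ x ∈ O1, Sec F 0 x := fun x hx => (hF1 x hx).symm.sec (sec_zero_zero x)
  have a2 : ∀ x ∈ O2, Sec F (fun y => if y ∈ O1 then g y else 0) x := by
    intro x hx
    simpa using hF2 x hx
  refine ⟨F, a1, a2, fun r => ⟨r + 0, r + fun y => if y ∈ O1 then g y else 0, ?_, ?_, ?_⟩⟩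
  · intro x hx hr
    exact hr.lcst_add (a1 x hx)
  · intro x hx hr
    exact hr.lcst_add (a2 x hx)
  · intro x hx
    simp only [Pi.add_apply, Pi.zero_apply, if_pos hx]
    grind

end Glue
end DP


namespace DP

section Line

theorem line_icc {f : ℝ → ℝ → ZMod 2} (hf : ∀ x, LC f x) (a b : ℝ) :
    ∃ h, ∀ x ∈ Icc a b, Sec f h x := by
  rcases lt_or_ge b a with hab | hab
  · exact ⟨0, fun x hx => absurd (hx.1.trans hx.2) (not_le.2 hab)⟩
  have key : (∃ h, ∀ x ∈ Icc a a, Sec f h x) ↔ ∃ h, ∀ x ∈ Icc a b, Sec f h x := by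
    refine isPreconnected_Icc.induction₂
      (fun y z : ℝ => ((∃ h, ∀ x ∈ Icc a y, Sec f h x) ↔ ∃ h, ∀ x ∈ Icc a z, Sec f h x))
      ?_ (fun x y z _ _ _ h1 h2 => h1.trans h2) (fun x y _ _ h1 => h1.symm)
      (⟨le_rfl, hab⟩ : a ∈ Icc a b) (⟨hab, le_rfl⟩ : b ∈ Icc a b)
    intro x hx
    obtain ⟨k, hk⟩ := hf x
    obtain ⟨ε, hε, hball⟩ := Metric.eventually_nhds_iff_ball.1 hk.eventually
    have step : ∀ y z, a ≤ y → y ∈ ball x ε → z ∈ ball x ε →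
        (∃ h, ∀ x ∈ Icc a y, Sec f h x) → ∃ h, ∀ x ∈ Icc a z, Sec f h x := by
      rintro y z hay hy hz ⟨h, hh⟩
      have hy' := hh y ⟨hay, le_rfl⟩
      have hc := (hball y hy).lcst_add hy'
      let h2 : ℝ → ZMod 2 := fun w => if w ≤ y then h w else k w + (k y + h y)
      refine ⟨h2, fun w hw => ?_⟩
      rcases lt_trichotomy w y with hwy | hwy | hwy
      · refine (hh w ⟨hw.1, hwy.le⟩).congr ?_
        filter_upwards [Iio_mem_nhds hwy] with u hu
        simp only [h2]
        rw [if_pos (le_of_lt hu)]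
      · subst hwy
        refine hy'.congr ?_
        filter_upwards [hc] with u hu
        simp only [h2]
        simp only [Pi.add_apply] at hu
        split_ifs
        · rfl
        · grind
      · have hwb : w ∈ ball x ε := by
          rw [Real.ball_eq_Ioo] at hy hz ⊢
          exact ⟨hy.1.trans hwy, lt_of_le_of_lt hw.2 hz.2⟩
        refine ((hball w hwb).add_lcst (lcst_const (k y + h y) w)).congr ?_
        filter_upwards [Ioi_mem_nhds hwy] with u hu
        simp only [h2, Pi.add_apply]
        rw [if_neg (not_le.2 hu)]
    filter_upwards [inter_mem_nhdsWithin _ (ball_mem_nhds x hε)] with y hy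
    exact ⟨step x y hx.1 (mem_ball_self hε) hy.2, step y x hy.1.1 hy.2 (mem_ball_self hε)⟩
  apply key.1
  obtain ⟨k, hk⟩ := hf a
  refine ⟨k, fun x hx => ?_⟩
  have : x = a := le_antisymm hx.2 hx.1
  rwa [this]

theorem line {f : ℝ → ℝ → ZMod 2} (hf : ∀ x, LC f x) : ∃ h, ∀ x, Sec f h x := by
  choose s hs using fun n : ℕ => line_icc hf (-(n : ℝ)) n
  have hmem : ∀ x : ℝ, x ∈ Icc (-((⌈|x|⌉₊ : ℕ) : ℝ)) (⌈|x|⌉₊ : ℕ) := by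
    intro x
    have := Nat.le_ceil |x|
    have := abs_le.1 this
    exact this
  let h : ℝ → ZMod 2 := fun x => s ⌈|x|⌉₊ x + s ⌈|x|⌉₊ 0
  refine ⟨h, fun x => ?_⟩
  obtain ⟨n, hn⟩ := exists_nat_gt |x|
  have hx := abs_lt.1 hn
  have base := (hs n x ⟨hx.1.le, hx.2.le⟩).add_lcst (lcst_const (s n 0) x)
  refine base.congr ?_
  filter_upwards [Ioo_mem_nhds hx.1 hx.2] with y hy
  simp only [Pi.add_apply, h]
  set m := ⌈|y|⌉₊ with hm
  have hmn : (m : ℝ) ≤ n := by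
    have : m ≤ n := Nat.ceil_le.2 (abs_le.2 ⟨hy.1.le, hy.2.le⟩)
    exact_mod_cast this
  have := lcst_pre (h := s n + s m) (isPreconnected_Icc (a := -(m : ℝ)) (b := m))
    (fun z hz => (hs n z ⟨by linarith [hz.1], by linarith [hz.2]⟩).lcst_add (hs m z hz))
    (hmem y) (show (0 : ℝ) ∈ Icc (-(m : ℝ)) m from ⟨by simp, by simp⟩)
  simp only [Pi.add_apply] at this
  grind

theorem plane0 {f : ℝ × ℝ → ℝ × ℝ → ZMod 2} (hf : ∀ x, LC f x) : ∃ h, ∀ x, Sec f h x := by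
  choose v hv using fun x : ℝ => line (f := pb (fun y : ℝ => (x, y)) f) (fun y =>
    (hf (x, y)).pb (by fun_prop : Continuous fun y : ℝ => (x, y)).continuousAt)
  obtain ⟨a, ha⟩ := line (f := pb (fun y : ℝ => (y, (0 : ℝ))) f) (fun y =>
    LC.pb (φ := fun y : ℝ => (y, (0 : ℝ))) (hf (y, 0)) (by fun_prop))
  let h : ℝ × ℝ → ZMod 2 := fun p => v p.1 p.2 + v p.1 0 + a p.1
  have step : ∀ (x y y1 ε : ℝ) (k : ℝ × ℝ → ZMod 2),
      (∀ p ∈ ball x ε ×ˢ ball y ε, Sec f k p) → x ∈ ball x ε → y1 ∈ ball y ε →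
      (∀ᶠ x' in 𝓝 x, h (x', y1) + k (x', y1) = h (x, y1) + k (x, y1)) →
      ∀ y' ∈ ball y ε, Sec f h (x, y') := by
    intro x y y1 ε k hk hx hy1 hc y' hy'
    have b := (hk (x, y') ⟨hx, hy'⟩).add_lcst (lcst_const (h (x, y1) + k (x, y1)) _)
    refine b.congr ?_
    have c1 : Tendsto (Prod.fst : ℝ × ℝ → ℝ) (𝓝 (x, y')) (𝓝 x) := continuous_fst.tendsto _
    have c2 : Tendsto (Prod.snd : ℝ × ℝ → ℝ) (𝓝 (x, y')) (𝓝 y') := continuous_snd.tendsto _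
    filter_upwards [c1.eventually hc, c1.eventually (isOpen_ball.mem_nhds hx),
      c2.eventually (isOpen_ball.mem_nhds hy')] with p h1 h2 h3
    have := lcst_pre (h := v p.1 + (k ∘ fun y => (p.1, y))) (isPreconnected_ball (x := y) (r := ε))
      (fun z hz => (hv p.1 z).lcst_add ((hk (p.1, z) ⟨h2, hz⟩).pb (by fun_prop))) h3 hy1
    simp only [Pi.add_apply, Function.comp] at this ⊢
    simp only [h] at h1 ⊢
    grind
  have loc : ∀ p : ℝ × ℝ, ∃ (k : ℝ × ℝ → ZMod 2) (ε : ℝ), 0 < ε ∧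
      ∀ q ∈ ball p.1 ε ×ˢ ball p.2 ε, Sec f k q := by
    intro p
    obtain ⟨k, hk⟩ := hf p
    obtain ⟨ε, hε, hball⟩ := Metric.eventually_nhds_iff_ball.1 hk.eventually
    exact ⟨k, ε, hε, fun q hq => hball q (by rwa [← ball_prod_same])⟩
  refine ⟨h, ?_⟩
  rintro ⟨x, y⟩
  have h0 : Sec f h (x, 0) := by
    obtain ⟨k, ε, hε, hk⟩ := loc (x, 0)
    refine step x 0 0 ε k hk (mem_ball_self hε) (mem_ball_self hε) ?_ 0 (mem_ball_self hε)
    have := (ha x).lcst_add ((hk (x, 0) ⟨mem_ball_self hε, mem_ball_self hε⟩).pb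
      (φ := fun y : ℝ => (y, (0 : ℝ))) (by fun_prop))
    filter_upwards [this] with x' hx'
    simp only [Pi.add_apply, Function.comp, h] at hx' ⊢
    grind
  have key : Sec f h (x, 0) ↔ Sec f h (x, y) := by
    refine isPreconnected_univ.induction₂ (fun y z : ℝ => (Sec f h (x, y) ↔ Sec f h (x, z)))
      ?_ (fun x y z _ _ _ h1 h2 => h1.trans h2) (fun x y _ _ h1 => h1.symm)
      (mem_univ _) (mem_univ _)
    intro y1 _
    rw [nhdsWithin_univ]
    obtain ⟨k, ε, hε, hk⟩ := loc (x, y1)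
    have st : ∀ y2 ∈ ball y1 ε, ∀ y3 ∈ ball y1 ε, Sec f h (x, y2) → Sec f h (x, y3) := by
      intro y2 hy2 y3 hy3 hs
      refine step x y1 y2 ε k hk (mem_ball_self hε) hy2 ?_ y3 hy3
      exact (hs.lcst_add (hk (x, y2) ⟨mem_ball_self hε, hy2⟩)).pb (φ := fun x' : ℝ => (x', y2))
        (by fun_prop)
    filter_upwards [ball_mem_nhds y1 hε] with y2 hy2
    exact ⟨st _ (mem_ball_self hε) _ hy2, st _ hy2 _ (mem_ball_self hε)⟩
  exact key.1 h0

theorem plane {f : ℂ → ℂ → ZMod 2} (hf : ∀ x, LC f x) : ∃ h, ∀ x, Sec f h x := by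
  let φ : ℂ ≃ₜ ℝ × ℝ := Complex.equivRealProdCLM.toHomeomorph
  obtain ⟨h, hh⟩ := plane0 (f := pb φ.symm f) (fun x =>
    (hf (φ.symm x)).pb φ.symm.continuous.continuousAt)
  refine ⟨h ∘ φ, fun x => ?_⟩
  have := (hh (φ x)).pb φ.continuous.continuousAt
  convert this using 1
  funext y z
  simp [pb]

end Line

section Charts
variable {S : Type*} [TopologicalSpace S]

/-- Small charts exist everywhere. -/
def HasCharts (S : Type*) [TopologicalSpace S] : Prop :=
  ∀ (x : S) (O : Set S), IsOpen O → x ∈ O →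
    ∃ e : ℂ → S, IsOpenEmbedding e ∧ e 0 = x ∧ range e ⊆ O

theorem univ_ball (c : ℂ) (r : ℝ) (hr : 0 < r) :
    ∃ e : ℂ → ℂ, IsOpenEmbedding e ∧ e 0 = c ∧ range e = ball c r := by
  refine ⟨OpenPartialHomeomorph.univBall c r, ?_, ?_, ?_⟩
  · exact OpenPartialHomeomorph.isOpenEmbedding _ (OpenPartialHomeomorph.univBall_source c r)
  · exact OpenPartialHomeomorph.univBall_apply_zero c r
  · rw [← image_univ, ← OpenPartialHomeomorph.univBall_source c r,
      OpenPartialHomeomorph.image_source_eq_target, OpenPartialHomeomorph.univBall_target c hr]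

theorem hasCharts_plane : HasCharts ℂ := by
  intro x O hO hx
  obtain ⟨r, hr, hb⟩ := Metric.isOpen_iff.1 hO x hx
  obtain ⟨e, he, h0, hR⟩ := univ_ball x r hr
  exact ⟨e, he, h0, hR ▸ hb⟩

theorem hasCharts_of (hS : LocallyEuclidean2 S) : HasCharts S := by
  intro x O hO hx
  obtain ⟨U, hU, hxU, ⟨φ⟩⟩ := hS x
  let ψ : U ≃ₜ ℂ := φ.trans Complex.orthonormalBasisOneI.repr.symm.toHomeomorph
  have e1 : IsOpenEmbedding (fun z : ℂ => (ψ.symm z : S)) :=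
    hU.isOpenEmbedding_subtypeVal.comp ψ.symm.isOpenEmbedding
  obtain ⟨r, hr, hb⟩ := Metric.isOpen_iff.1 (hO.preimage e1.continuous) (ψ ⟨x, hxU⟩) (by simpa)
  obtain ⟨e, he, h0, hR⟩ := univ_ball (ψ ⟨x, hxU⟩) r hr
  refine ⟨_, e1.comp he, by simp [h0], ?_⟩
  rintro _ ⟨z, rfl⟩
  exact hb (hR ▸ mem_range_self z)

/-- sections exist on charts -/
theorem chart_sec {f : S → S → ZMod 2} {e : ℂ → S} (he : IsOpenEmbedding e)
    (hf : ∀ x ∈ range e, LC f x) : ∃ h, ∀ x ∈ range e, Sec f h x := by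
  obtain ⟨k, hk⟩ := plane (f := pb e f) (fun x =>
    (hf (e x) (mem_range_self x)).pb he.continuous.continuousAt)
  obtain ⟨h, -, hh⟩ := descend (f := f) he k
  refine ⟨h, ?_⟩
  rintro _ ⟨x, rfl⟩
  exact hh x (hk x)

theorem HasCharts.sec_nhds (hc : HasCharts S) {f : S → S → ZMod 2} {x : S} (O : Set S)
    (hO : IsOpen O) (hx : x ∈ O) : ∃ B : Set S, IsOpen B ∧ x ∈ B ∧ B ⊆ O ∧ IsPreconnected B ∧
      ((∀ y ∈ B, LC f y) → ∃ h, ∀ y ∈ B, Sec f h y) := by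
  obtain ⟨e, he, h0, hr⟩ := hc x O hO hx
  exact ⟨range e, he.isOpen_range, ⟨0, h0⟩, hr, isPreconnected_range he.continuous,
    fun h => chart_sec he h⟩

end Charts
end DP


namespace DP

section Punct

/-- `m` is the monodromy of `f` around the puncture `0`. -/
def Mono (f : ℂ → ℂ → ZMod 2) (m : ZMod 2) : Prop :=
  ∃ H : ℂ → ZMod 2, (∀ w, Sec (pb Complex.exp f) H w) ∧
    ∀ w, H (w + 2 * Real.pi * Complex.I) = H w + m

theorem mono_exists {f : ℂ → ℂ → ZMod 2} (hf : ∀ z, z ≠ 0 → LC f z) : ∃ m, Mono f m := by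
  obtain ⟨H, hH⟩ := plane (f := pb Complex.exp f) (fun x =>
    (hf _ (Complex.exp_ne_zero x)).pb Complex.continuous_exp.continuousAt)
  refine ⟨H (0 + 2 * Real.pi * Complex.I) + H 0, H, hH, fun w => ?_⟩
  have h2 : ∀ w, LCst ((H ∘ fun w => w + 2 * Real.pi * Complex.I) + H) w := by
    intro w
    have a := (hH (w + 2 * Real.pi * Complex.I)).pb (φ := fun w => w + 2 * Real.pi * Complex.I)
      (by fun_prop)
    have : pb (fun w => w + 2 * Real.pi * Complex.I) (pb Complex.exp f) = pb Complex.exp f := by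
      funext y z
      simp only [pb]
      rw [Complex.exp_periodic y, Complex.exp_periodic z]
    rw [this] at a
    exact a.lcst_add (hH w)
  have := lcst_pre isPreconnected_univ (fun w _ => h2 w) (mem_univ w) (mem_univ 0)
  simp only [Pi.add_apply, Function.comp] at this
  grind

theorem Mono.add {f g : ℂ → ℂ → ZMod 2} {m n : ZMod 2} (h1 : Mono f m) (h2 : Mono g n) :
    Mono (f + g) (m + n) := by
  obtain ⟨H, hH, hm⟩ := h1
  obtain ⟨K, hK, hn⟩ := h2
  refine ⟨H + K, fun w => (hH w).add (hK w), fun w => ?_⟩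
  simp only [Pi.add_apply, hm, hn]
  ring

theorem Mono.sec {f : ℂ → ℂ → ZMod 2} (h1 : Mono f 0) : ∃ h, ∀ z, z ≠ 0 → Sec f h z := by
  obtain ⟨H, hH, hm⟩ := h1
  have hper : ∀ u v, Complex.exp u = Complex.exp v → H u = H v := by
    intro u v huv
    obtain ⟨n, hn⟩ := Complex.exp_eq_exp_iff_exists_int.1 huv
    have hp : Function.Periodic H (2 * Real.pi * Complex.I) := fun w => by rw [hm, add_zero]
    rw [hn]
    exact hp.int_mul n v
  refine ⟨H ∘ Complex.log, fun z hz => ?_⟩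
  obtain ⟨N, hNo, hx, HN⟩ := sec_iff.1 (hH (Complex.log z))
  refine sec_iff.2 ⟨Complex.exp '' N, Complex.isOpenMap_exp N hNo, ⟨_, hx, Complex.exp_log hz⟩, ?_⟩
  rintro _ ⟨u, hu, rfl⟩ _ ⟨v, hv, rfl⟩
  have := HN u hu v hv
  simp only [pb] at this
  rw [this, Function.comp, Function.comp, hper u _ (Complex.exp_log (Complex.exp_ne_zero u)).symm,
    hper v _ (Complex.exp_log (Complex.exp_ne_zero v)).symm]

theorem Mono.zero_of {f : ℂ → ℂ → ZMod 2} {m : ZMod 2} (h1 : Mono f m) {h : ℂ → ZMod 2}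
    {s : Set ℝ} (hs : Convex ℝ s) (hne : s.Nonempty)
    (hh : ∀ w : ℂ, w.re ∈ s → Sec f h (Complex.exp w)) : m = 0 := by
  obtain ⟨H, hH, hm⟩ := h1
  obtain ⟨x, hx⟩ := hne
  have hc : Convex ℝ {w : ℂ | w.re ∈ s} := hs.linear_preimage Complex.reLm
  have := lcst_pre (h := H + h ∘ Complex.exp) hc.isPreconnected
    (fun w hw => (hH w).lcst_add ((hh w hw).pb Complex.continuous_exp.continuousAt))
    (x := x) (y := x + 2 * Real.pi * Complex.I) (by simpa) (by simpa)
  simp only [Pi.add_apply, Function.comp, Complex.exp_periodic _, hm] at this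
  grind

theorem Mono.zero_of_inf {f : ℂ → ℂ → ZMod 2} {m : ZMod 2} (h1 : Mono f m) {h : ℂ → ZMod 2}
    {R : ℝ} (hh : ∀ w : ℂ, R < ‖w‖ → Sec f h w) : m = 0 := by
  refine h1.zero_of (convex_Ioi R) nonempty_Ioi (h := h) (fun w hw => hh _ ?_)
  rw [Complex.norm_exp]
  have := Real.add_one_le_exp w.re
  simp only [mem_Ioi] at hw
  linarith

theorem Mono.zero_of_small {f : ℂ → ℂ → ZMod 2} {m : ZMod 2} (h1 : Mono f m) {h : ℂ → ZMod 2}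
    (hh : ∀ᶠ w in 𝓝[≠] 0, Sec f h w) : m = 0 := by
  rw [eventually_nhdsWithin_iff, Metric.eventually_nhds_iff_ball] at hh
  obtain ⟨ε, hε, hb⟩ := hh
  refine h1.zero_of (convex_Iio (Real.log ε)) nonempty_Iio (h := h)
    (fun w hw => hb _ ?_ (Complex.exp_ne_zero w))
  rw [mem_ball_zero_iff, Complex.norm_exp]
  exact (Real.lt_log_iff_exp_lt hε).1 hw

end Punct

section Br
variable {S : Type*} [MetricSpace S]

/-- `f` is branched at `p`. -/
def Br (f : S → S → ZMod 2) (p : S) : Prop := ¬ ∃ h, ∀ᶠ x in 𝓝[≠] p, Sec f h x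

theorem LC.not_br {f : S → S → ZMod 2} {p : S} (h : LC f p) : ¬ Br f p := by
  obtain ⟨k, hk⟩ := h
  exact not_not.2 ⟨k, hk.eventually.filter_mono nhdsWithin_le_nhds⟩

theorem br_congr' {f g : S → S → ZMod 2} {p : S} (h : ∀ᶠ x in 𝓝[≠] p, Eqv f g x)
    (hb : Br f p) : Br g p := by
  rintro ⟨k, hk⟩
  apply hb
  refine ⟨k, ?_⟩
  filter_upwards [h, hk] with x h1 h2 using h1.symm.sec h2

theorem eqv_punct {f g : S → S → ZMod 2} {p q : S} (h : ∀ x, x ≠ p → Eqv f g x) :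
    ∀ᶠ x in 𝓝[≠] q, Eqv f g x := by
  by_cases hpq : q = p
  · subst hpq
    filter_upwards [self_mem_nhdsWithin] with x hx using h x hx
  · have : {p}ᶜ ∈ 𝓝[≠] q := mem_nhdsWithin_of_mem_nhds (isOpen_compl_singleton.mem_nhds hpq)
    filter_upwards [this] with x hx using h x hx

theorem not_br_add {f g : S → S → ZMod 2} {p : S} (hf : ¬ Br f p) (hg : ¬ Br g p) :
    ¬ Br (f + g) p := by
  obtain ⟨h, hh⟩ := not_not.1 hf
  obtain ⟨k, hk⟩ := not_not.1 hg
  refine not_not.2 ⟨h + k, ?_⟩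
  filter_upwards [hh, hk] with x h1 h2 using h1.add h2

theorem add_add_cancel2 (f g : S → S → ZMod 2) : f + g + g = f := by
  rw [add_assoc, add_self_fun2, add_zero]

theorem br_add_left {f g : S → S → ZMod 2} {p : S} (hf : Br f p) (hg : ¬ Br g p) :
    Br (f + g) p := by
  by_contra h
  have := not_br_add h hg
  rw [add_add_cancel2] at this
  exact this hf

theorem br_mono {f : S → S → ZMod 2} {e : ℂ → S} (he : IsOpenEmbedding e) {m : ZMod 2}
    (hm : Mono (pb e f) m) : Br f (e 0) ↔ m = 1 := by
  constructor
  · intro hb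
    rcases z2 m with h | h
    · exfalso
      subst h
      apply hb
      obtain ⟨k, hk⟩ := hm.sec
      obtain ⟨h, -, hh⟩ := descend (f := f) he k
      refine ⟨h, ?_⟩
      rw [eventually_nhdsWithin_iff]
      filter_upwards [he.isOpen_range.mem_nhds (mem_range_self 0)] with x hx hx0
      obtain ⟨z, rfl⟩ := hx
      apply hh z (hk z _)
      rintro rfl
      exact hx0 rfl
    · exact h
  · rintro rfl ⟨h, hh⟩
    have : (1 : ZMod 2) = 0 := by
      refine hm.zero_of_small (h := h ∘ e) ?_
      have ht : Tendsto e (𝓝[≠] 0) (𝓝[≠] (e 0)) := by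
        apply tendsto_nhdsWithin_of_tendsto_nhds_of_eventually_within
        · exact he.continuous.continuousAt.mono_left nhdsWithin_le_nhds
        · filter_upwards [self_mem_nhdsWithin] with z hz hz'
          exact hz (he.injective hz')
      filter_upwards [ht.eventually hh] with z hz
      exact hz.pb he.continuous.continuousAt
    exact one_ne_zero this

theorem HasCharts.punct (hc : HasCharts S) {f : S → S → ZMod 2} {p : S}
    (hf : ∀ᶠ x in 𝓝[≠] p, LC f x) {O : Set S} (hO : IsOpen O) (hp : p ∈ O) :
    ∃ e : ℂ → S, IsOpenEmbedding e ∧ e 0 = p ∧ range e ⊆ O ∧ ∀ z, z ≠ 0 → LC f (e z) := by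
  rw [eventually_nhdsWithin_iff] at hf
  obtain ⟨N, hN, hNo, hpN⟩ := _root_.mem_nhds_iff.1 hf
  obtain ⟨e, he, h0, hr⟩ := hc p (N ∩ O) (hNo.inter hO) ⟨hpN, hp⟩
  refine ⟨e, he, h0, hr.trans inter_subset_right, fun z hz => ?_⟩
  refine hN (hr (mem_range_self z)).1 (fun h => hz (he.injective ?_))
  rw [h0]; exact h

theorem br_br (hc : HasCharts S) {f g : S → S → ZMod 2} {p : S}
    (hf : ∀ᶠ x in 𝓝[≠] p, LC f x) (hg : ∀ᶠ x in 𝓝[≠] p, LC g x)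
    (h1 : Br f p) (h2 : Br g p) : ¬ Br (f + g) p := by
  have hfg : ∀ᶠ x in 𝓝[≠] p, LC f x ∧ LC g x := hf.and hg
  rw [eventually_nhdsWithin_iff] at hfg
  obtain ⟨N, hN, hNo, hpN⟩ := _root_.mem_nhds_iff.1 hfg
  obtain ⟨e, he, h0, hr⟩ := hc p N hNo hpN
  have hz : ∀ z, z ≠ 0 → LC f (e z) ∧ LC g (e z) := by
    intro z hz
    refine hN (hr (mem_range_self z)) (fun h => hz (he.injective ?_))
    rw [h0]; exact h
  obtain ⟨m, hm⟩ := mono_exists (f := pb e f) (fun z h => (hz z h).1.pb he.continuous.continuousAt)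
  obtain ⟨n, hn⟩ := mono_exists (f := pb e g) (fun z h => (hz z h).2.pb he.continuous.continuousAt)
  subst h0
  have a := (br_mono he hm).1 h1
  have b := (br_mono he hn).1 h2
  have c : Mono (pb e (f + g)) (m + n) := hm.add hn
  rw [br_mono he c, a, b]
  decide

/-- Removing an unbranched point. -/
theorem extend {f : S → S → ZMod 2} {p : S} (hb : ¬ Br f p) :
    ∃ f', (∀ x, x ≠ p → Eqv f' f x) ∧ LC f' p := by
  obtain ⟨h, hh⟩ := not_not.1 hb
  rw [eventually_nhdsWithin_iff] at hh
  obtain ⟨N, hN, hNo, hpN⟩ := _root_.mem_nhds_iff.1 hh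
  obtain ⟨F, h1, h2⟩ := glue (isOpen_compl_singleton (x := p)) hNo f 0 h (fun x hx => by
    rw [add_zero]; exact hN hx.2 hx.1)
  exact ⟨F, h1, by have := h2 p hpN; rw [add_zero] at this; exact this.lc⟩

theorem extend_finset {f : S → S → ZMod 2} (P : Finset S) (hb : ∀ p ∈ P, ¬ Br f p) :
    ∃ f', (∀ x, x ∉ P → Eqv f' f x) ∧ ∀ p ∈ P, LC f' p := by
  classical
  induction P using Finset.induction_on with
  | empty => exact ⟨f, fun x _ => Eqv.rfl', by simp⟩
  | insert p P hp ih =>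
    obtain ⟨g, hg1, hg2⟩ := ih (fun q hq => hb q (Finset.mem_insert_of_mem hq))
    have : ¬ Br g p := by
      intro h
      refine hb p (Finset.mem_insert_self _ _) (br_congr' ?_ h)
      have : (P : Set S)ᶜ ∈ 𝓝[≠] p :=
        mem_nhdsWithin_of_mem_nhds (P.finite_toSet.isClosed.isOpen_compl.mem_nhds hp)
      filter_upwards [this] with x hx using hg1 x hx
    obtain ⟨g', h1, h2⟩ := extend this
    refine ⟨g', fun x hx => ?_, fun q hq => ?_⟩
    · rw [Finset.mem_insert, not_or] at hx
      exact (h1 x hx.1).trans (hg1 x hx.2)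
    · by_cases hqp : q = p
      · rwa [hqp]
      · rw [Finset.mem_insert] at hq
        exact (h1 q hqp).symm.lc (hg2 q (hq.resolve_left hqp))

end Br
end DP


namespace DP

section Eta

theorem half_const {ε : ℝ} (hε : 0 < ε) {r : ℂ → ZMod 2}
    (hr : ∀ z : ℂ, ‖z‖ < ε → ¬ (0 ≤ z.re ∧ z.im = 0) → LCst r z)
    {u v : ℂ} (hu : ‖u‖ < ε) (hv : ‖v‖ < ε) (hu' : 0 < u.im) (hv' : v.im < 0) : r u = r v := by
  have c0 : Convex ℝ {z : ℂ | ‖z‖ < ε} := by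
    have : {z : ℂ | ‖z‖ < ε} = ball 0 ε := by ext z; simp
    rw [this]; exact convex_ball _ _
  have cA : Convex ℝ ({z : ℂ | ‖z‖ < ε} ∩ {z : ℂ | z.re < 0}) :=
    c0.inter (convex_halfSpace_re_lt 0)
  have cB : Convex ℝ ({z : ℂ | ‖z‖ < ε} ∩ {z : ℂ | 0 < z.im}) :=
    c0.inter (convex_halfSpace_im_gt 0)
  have cC : Convex ℝ ({z : ℂ | ‖z‖ < ε} ∩ {z : ℂ | z.im < 0}) :=
    c0.inter (convex_halfSpace_im_lt 0)
  have nrm : ∀ a b : ℝ, |a| ≤ ε / 4 → |b| ≤ ε / 4 → ‖(⟨a, b⟩ : ℂ)‖ < ε := by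
    intro a b ha hb
    have := Complex.norm_le_abs_re_add_abs_im (⟨a, b⟩ : ℂ)
    simp only at this
    linarith
  have h4 : |ε / 4| ≤ ε / 4 := by rw [abs_of_pos (by linarith)]
  have h4' : |-(ε / 4)| ≤ ε / 4 := by rw [abs_neg, abs_of_pos (by linarith)]
  let p : ℂ := ⟨-(ε / 4), ε / 4⟩
  let q : ℂ := ⟨-(ε / 4), -(ε / 4)⟩
  have hp : ‖p‖ < ε := nrm _ _ h4' h4
  have hq : ‖q‖ < ε := nrm _ _ h4' h4'
  have e1 : r u = r p := lcst_pre cB.isPreconnected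
    (fun z hz => hr z hz.1 (fun h => hz.2.ne' h.2)) ⟨hu, hu'⟩ ⟨hp, by simp [p]; linarith⟩
  have e2 : r p = r q := lcst_pre cA.isPreconnected
    (fun z hz => hr z hz.1 (fun h => not_lt.2 h.1 hz.2)) ⟨hp, by simp [p]; linarith⟩
    ⟨hq, by simp [q]; linarith⟩
  have e3 : r q = r v := lcst_pre cC.isPreconnected
    (fun z hz => hr z hz.1 (fun h => hz.2.ne h.2)) ⟨hq, by simp [q]; linarith⟩ ⟨hv, hv'⟩
  rw [e1, e2, e3]

variable {S : Type*} [MetricSpace S]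

theorem br_end {e : ℂ → S} (he : IsOpenEmbedding e) {F : S → S → ZMod 2} {k : ℂ → ZMod 2}
    (h0 : ∀ z : ℂ, ‖z‖ < 1 → ¬ (0 ≤ z.re ∧ z.im = 0) → Sec F 0 (e z))
    (h1 : ∀ z : ℂ, 0 < z.re → z.re < 1 → Sec (pb e F) k z)
    (hk : ∀ z : ℂ, 0 < z.im → k z + k (starRingEnd ℂ z) = 1) : Br F (e 0) := by
  rintro ⟨r, hr⟩
  have ht : Tendsto e (𝓝[≠] 0) (𝓝[≠] (e 0)) := by
    apply tendsto_nhdsWithin_of_tendsto_nhds_of_eventually_within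
    · exact he.continuous.continuousAt.mono_left nhdsWithin_le_nhds
    · filter_upwards [self_mem_nhdsWithin] with z hz hz'
      exact hz (he.injective hz')
  have hr' := ht.eventually hr
  rw [eventually_nhdsWithin_iff, Metric.eventually_nhds_iff_ball] at hr'
  obtain ⟨ε', hε', hb'⟩ := hr'
  obtain ⟨ε, hε, hε1, hεle⟩ : ∃ ε, 0 < ε ∧ ε ≤ 1 ∧ ε ≤ ε' :=
    ⟨min 1 ε', lt_min one_pos hε', min_le_left _ _, min_le_right _ _⟩
  have hb : ∀ z : ℂ, ‖z‖ < ε → z ≠ 0 → Sec (pb e F) (r ∘ e) z := fun z hz hz0 =>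
    (hb' z (by rw [mem_ball_zero_iff]; linarith) hz0).pb he.continuous.continuousAt
  have hc : ∀ z : ℂ, ‖z‖ < ε → ¬ (0 ≤ z.re ∧ z.im = 0) → LCst (r ∘ e) z := by
    intro z hz hz2
    have := (hb z hz (by rintro rfl; exact hz2 (by simp))).lcst_add
      ((h0 z (by linarith) hz2).pb he.continuous.continuousAt)
    have h00 : (r ∘ e) + (0 : S → ZMod 2) ∘ e = r ∘ e := by funext x; simp
    rwa [h00] at this
  have htn : ‖((ε / 2 : ℝ) : ℂ)‖ < ε := by
    rw [Complex.norm_real, Real.norm_of_nonneg (by linarith)]; linarith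
  have hL := (hb _ htn (by
    intro h; rw [Complex.ofReal_eq_zero] at h; linarith)).lcst_add
    (h1 ((ε / 2 : ℝ) : ℂ) (by simp; linarith) (by simp; linarith))
  have cont : Tendsto (fun s : ℝ => (⟨ε / 2, s⟩ : ℂ)) (𝓝 0) (𝓝 ((ε / 2 : ℝ) : ℂ)) := by
    have : Continuous (fun s : ℝ => (((ε / 2 : ℝ) : ℂ) + s * Complex.I)) := by fun_prop
    have h3 := this.tendsto 0
    simp only [Complex.ofReal_zero, zero_mul, add_zero] at h3
    refine h3.congr (fun s => ?_)
    apply Complex.ext <;> simp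
  have cont2 : Tendsto (fun s : ℝ => (⟨ε / 2, -s⟩ : ℂ)) (𝓝 0) (𝓝 ((ε / 2 : ℝ) : ℂ)) := by
    have := cont.comp ((continuous_neg (G := ℝ)).tendsto 0 |>.trans (by simp))
    exact this
  have hnorm : ∀ᶠ z in 𝓝 ((ε / 2 : ℝ) : ℂ), ‖z‖ < ε :=
    (isOpen_lt continuous_norm continuous_const).mem_nhds htn
  have ev : ∀ᶠ s in 𝓝[>] (0 : ℝ), (r ∘ e + k) ⟨ε / 2, s⟩ = (r ∘ e + k) ⟨ε / 2, -s⟩ ∧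
      ‖(⟨ε / 2, s⟩ : ℂ)‖ < ε ∧ ‖(⟨ε / 2, -s⟩ : ℂ)‖ < ε := by
    apply Eventually.filter_mono nhdsWithin_le_nhds
    filter_upwards [cont.eventually hL, cont2.eventually hL, cont.eventually hnorm,
      cont2.eventually hnorm] with s a b c d
    exact ⟨a.trans b.symm, c, d⟩
  obtain ⟨s, ⟨a, b, c⟩, hs⟩ := (ev.and self_mem_nhdsWithin).exists
  have hs' : 0 < s := hs
  have d := half_const hε hc (u := ⟨ε / 2, s⟩) (v := ⟨ε / 2, -s⟩) b c hs' (by simpa using hs')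
  have g := hk ⟨ε / 2, s⟩ hs'
  have : (starRingEnd ℂ) (⟨ε / 2, s⟩ : ℂ) = ⟨ε / 2, -s⟩ := by apply Complex.ext <;> simp
  rw [this] at g
  simp only [Pi.add_apply] at a
  rw [d] at a
  have : (0 : ZMod 2) = 1 := by grind
  exact zero_ne_one this

open Classical in
theorem eta_seg {e : ℂ → S} (he : IsOpenEmbedding e) :
    ∃ f : S → S → ZMod 2, ∃ C : Set S, IsCompact C ∧ C ⊆ range e ∧ (∀ x, x ∉ C → Sec f 0 x) ∧
      (∀ x, x ≠ e 0 → x ≠ e 1 → LC f x) ∧ Br f (e 0) ∧ Br f (e 1) := by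
  let sg : Set ℂ := (fun t : ℝ => (t : ℂ)) '' Icc 0 1
  have hsg : ∀ z : ℂ, z ∈ sg ↔ (0 ≤ z.re ∧ z.re ≤ 1 ∧ z.im = 0) := by
    intro z
    constructor
    · rintro ⟨t, ht, rfl⟩
      simpa using ht
    · rintro ⟨a, b, c⟩
      exact ⟨z.re, ⟨a, b⟩, by apply Complex.ext <;> simp [c]⟩
  have hsgc : IsCompact sg := isCompact_Icc.image Complex.continuous_ofReal
  have hC : IsCompact (e '' sg) := hsgc.image he.continuous
  let O2 : Set S := e '' {z : ℂ | 0 < z.re ∧ z.re < 1}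
  have hO2 : IsOpen O2 := he.isOpenMap _ ((isOpen_lt continuous_const Complex.continuous_re).inter
    (isOpen_lt Complex.continuous_re continuous_const))
  let k : ℂ → ZMod 2 := fun z => if 0 < z.im then 1 else 0
  obtain ⟨h, hhk, -⟩ := descend (f := (0 : S → S → ZMod 2)) he k
  have hk0 : ∀ z : ℂ, z.im ≠ 0 → LCst k z := by
    intro z hz
    rcases lt_or_gt_of_ne hz with h | h
    · filter_upwards [(isOpen_lt Complex.continuous_im continuous_const).mem_nhds h] with w hw
      have hw' : w.im < 0 := hw
      simp [k, hw'.not_gt, h.not_gt]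
    · filter_upwards [(isOpen_lt continuous_const Complex.continuous_im).mem_nhds h] with w hw
      have hw' : 0 < w.im := hw
      simp [k, hw', h]
  obtain ⟨F, hF1, hF2, -⟩ := mv hC.isClosed.isOpen_compl hO2 h (by
    rintro _ ⟨hx, z, hz, rfl⟩
    apply LCst.push he
    rw [hhk]
    apply hk0
    intro hz0
    exact hx ⟨z, (hsg z).2 ⟨hz.1.le, hz.2.le, hz0⟩, rfl⟩)
  have hF2' : ∀ z : ℂ, 0 < z.re → z.re < 1 → Sec (pb e F) k z := by
    intro z h1 h2
    have := (hF2 (e z) ⟨z, ⟨h1, h2⟩, rfl⟩).pb (he.continuous.continuousAt (x := z))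
    convert this using 1
    funext w
    simp only [Function.comp]
    have hw : h (e w) = k w := congrFun hhk w
    rw [hw]
    split_ifs with hc
    · rfl
    · have : e w ∈ e '' sg := not_not.1 hc
      obtain ⟨w', hw', hww⟩ := this
      have := he.injective hww
      subst this
      have := ((hsg w').1 hw').2.2
      simp [k, this]
  refine ⟨F, e '' sg, hC, image_subset_range _ _, hF1, ?_, ?_, ?_⟩
  · intro x h0 h1
    by_cases hx : x ∈ e '' sg
    · obtain ⟨z, hz, rfl⟩ := hx
      obtain ⟨a, b, c⟩ := (hsg z).1 hz
      refine (hF2 (e z) ⟨z, ⟨lt_of_le_of_ne a ?_, lt_of_le_of_ne b ?_⟩, rfl⟩).lc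
      · intro h; apply h0; congr 1; apply Complex.ext <;> simp [c, ← h]
      · intro h; apply h1; congr 1; apply Complex.ext <;> simp [c, h]
    · exact (hF1 x hx).lc
  · refine br_end he (k := k) ?_ hF2' ?_
    · intro z hz hz2
      apply hF1
      rintro ⟨w, hw, hww⟩
      have := he.injective hww
      subst this
      exact hz2 ⟨((hsg w).1 hw).1, ((hsg w).1 hw).2.2⟩
    · intro z hz
      simp [k, hz, hz.not_gt, hz.le]
  · let φ : ℂ → ℂ := fun z => 1 - z
    have hφ : IsOpenEmbedding φ := (Homeomorph.subLeft (1 : ℂ)).isOpenEmbedding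
    have := br_end (he.comp hφ) (F := F) (k := k ∘ φ) ?_ ?_ ?_
    · simpa [φ] using this
    · intro z hz hz2
      apply hF1
      rintro ⟨w, hw, hww⟩
      have := he.injective hww
      subst this
      have a := (hsg _).1 hw
      simp only [φ, Complex.sub_re, Complex.one_re, Complex.sub_im, Complex.one_im] at a
      exact hz2 ⟨by linarith, by linarith⟩
    · intro z h1 h2
      exact (hF2' (φ z) (by simp [φ]; linarith) (by simp [φ]; linarith)).pb
        hφ.continuous.continuousAt
    · intro z hz
      simp [k, φ, hz, hz.not_gt, hz.le]

theorem eta_chart {e : ℂ → S} (he : IsOpenEmbedding e) {z w : ℂ} (hzw : z ≠ w) :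
    ∃ f : S → S → ZMod 2, ∃ C : Set S, IsCompact C ∧ C ⊆ range e ∧ (∀ x, x ∉ C → Sec f 0 x) ∧
      (∀ x, x ≠ e z → x ≠ e w → LC f x) ∧ Br f (e z) ∧ Br f (e w) := by
  let φ : ℂ ≃ₜ ℂ := (Homeomorph.mulRight₀ (w - z) (sub_ne_zero.2 hzw.symm)).trans
    (Homeomorph.addRight z)
  obtain ⟨f, C, hC, hCs, h1, h2, h3, h4⟩ := eta_seg (he.comp φ.isOpenEmbedding)
  have e0 : φ 0 = z := by simp [φ]
  have e1 : φ 1 = w := by simp [φ]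
  simp only [Function.comp, e0, e1] at h2 h3 h4
  exact ⟨f, C, hC, hCs.trans (range_comp_subset_range _ _), h1, h2, h3, h4⟩

theorem eta (hc : HasCharts S) {O : Set S} (hO : IsOpen O) (hconn : IsPreconnected O) {p q : S}
    (hp : p ∈ O) (hq : q ∈ O) (hpq : p ≠ q) :
    ∃ f : S → S → ZMod 2, ∃ C : Set S, IsCompact C ∧ C ⊆ O ∧ (∀ x, x ∉ C → Sec f 0 x) ∧
      (∀ x, x ≠ p → x ≠ q → LC f x) ∧ Br f p ∧ Br f q := by
  let R : S → S → Prop := fun p q => p = q ∨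
    ∃ f : S → S → ZMod 2, ∃ C : Set S, IsCompact C ∧ C ⊆ O ∧ (∀ x, x ∉ C → Sec f 0 x) ∧
      (∀ x, x ≠ p → x ≠ q → LC f x) ∧ Br f p ∧ Br f q
  suffices h : R p q from h.resolve_left hpq
  refine hconn.induction₂ R ?_ ?_ ?_ hp hq
  · intro x hx
    apply Eventually.filter_mono nhdsWithin_le_nhds
    obtain ⟨e, he, h0, hr⟩ := hc x O hO hx
    filter_upwards [he.isOpen_range.mem_nhds ⟨0, h0⟩] with y hy
    obtain ⟨w, rfl⟩ := hy
    by_cases hw : 0 = w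
    · left; rw [← h0, hw]
    · right
      obtain ⟨f, C, hC, hCs, h1, h2, h3, h4⟩ := eta_chart he hw
      rw [h0] at h2 h3
      exact ⟨f, C, hC, hCs.trans hr, h1, h2, h3, h4⟩
  · intro a b c _ _ _ hab hbc
    rcases hab with rfl | ⟨f, C, hC, hCs, h1, h2, h3, h4⟩
    · exact hbc
    rcases hbc with rfl | ⟨g, D, hD, hDs, g1, g2, g3, g4⟩
    · exact Or.inr ⟨f, C, hC, hCs, h1, h2, h3, h4⟩
    by_cases hac : a = c
    · exact Or.inl hac
    have hab : a ≠ b ∨ a = b := ne_or_eq a b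
    rcases hab with hab | rfl
    swap
    · exact Or.inr ⟨g, D, hD, hDs, g1, g2, g3, g4⟩
    by_cases hbc : b = c
    · subst hbc
      exact Or.inr ⟨f, C, hC, hCs, h1, h2, h3, h4⟩
    right
    have hnb : ¬ Br (f + g) b := by
      refine br_br hc ?_ ?_ h4 g3
      · have : {a}ᶜ ∈ 𝓝[≠] b :=
          mem_nhdsWithin_of_mem_nhds (isOpen_compl_singleton.mem_nhds (Ne.symm hab))
        filter_upwards [this, self_mem_nhdsWithin] with x hx hx' using h2 x hx hx'
      · have : {c}ᶜ ∈ 𝓝[≠] b :=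
          mem_nhdsWithin_of_mem_nhds (isOpen_compl_singleton.mem_nhds hbc)
        filter_upwards [this, self_mem_nhdsWithin] with x hx hx' using g2 x hx' hx
    obtain ⟨f', k1, k2⟩ := extend hnb
    have hbC : b ∈ C := by
      by_contra h
      exact (h1 b h).lc.not_br h4
    refine ⟨f', C ∪ D, hC.union hD, union_subset hCs hDs, ?_, ?_, ?_, ?_⟩
    · intro x hx
      rw [mem_union, not_or] at hx
      have hxb : x ≠ b := fun h => hx.1 (h ▸ hbC)
      have := (h1 x hx.1).add (g1 x hx.2)
      rw [add_zero] at this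
      exact (k1 x hxb).symm.sec this
    · intro x hxa hxc
      by_cases hxb : x = b
      · rwa [hxb]
      · exact (k1 x hxb).symm.lc ((h2 x hxa hxb).add (g2 x hxb hxc))
    · refine br_congr' (f := f + g) (eqv_punct (p := b) fun x hx => (k1 x hx).symm) ?_
      exact br_add_left h3 (g2 a hab hac).not_br
    · refine br_congr' (f := f + g) (eqv_punct (p := b) fun x hx => (k1 x hx).symm) ?_
      rw [add_comm]
      exact br_add_left g4 (h2 c (Ne.symm hac) (Ne.symm hbc)).not_br
  · intro a b _ _ hab
    rcases hab with rfl | ⟨f, C, hC, hCs, h1, h2, h3, h4⟩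
    · exact Or.inl rfl
    · exact Or.inr ⟨f, C, hC, hCs, h1, fun x a b => h2 x b a, h4, h3⟩

end Eta
end DP


namespace DP

section Circle

theorem sphere_inter_finite {ρ r : ℝ} (hρ : 0 < ρ) {c : ℂ} (hc : ‖c‖ = ρ) :
    (sphere (0 : ℂ) ρ ∩ sphere c r).Finite := by
  set d : ℝ := (2 * ρ ^ 2 - r ^ 2) / 2 with hd
  set t : ℝ := Real.sqrt (ρ ^ 4 - d ^ 2) with ht
  have hc0 : (starRingEnd ℂ) c ≠ 0 := by
    intro h
    have : c = 0 := by simpa using h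
    rw [this, norm_zero] at hc
    linarith
  have hfin : ({(⟨d, t⟩ : ℂ) / (starRingEnd ℂ) c, (⟨d, -t⟩ : ℂ) / (starRingEnd ℂ) c} : Set ℂ).Finite :=
    Set.toFinite _
  refine hfin.subset ?_
  rintro z ⟨hz1, hz2⟩
  rw [mem_sphere_zero_iff_norm] at hz1
  rw [mem_sphere_iff_norm] at hz2
  have n1 : z.re ^ 2 + z.im ^ 2 = ρ ^ 2 := by
    rw [← hz1, Complex.sq_norm, Complex.normSq_apply]; ring
  have n2 : c.re ^ 2 + c.im ^ 2 = ρ ^ 2 := by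
    rw [← hc, Complex.sq_norm, Complex.normSq_apply]; ring
  have n3 : (z.re - c.re) ^ 2 + (z.im - c.im) ^ 2 = r ^ 2 := by
    rw [← hz2, Complex.sq_norm, Complex.normSq_apply, Complex.sub_re, Complex.sub_im]; ring
  set w := z * (starRingEnd ℂ) c with hw
  have wre : w.re = d := by
    simp only [hw, Complex.mul_re, Complex.conj_re, Complex.conj_im, hd]
    nlinarith
  have wim : w.im ^ 2 = ρ ^ 4 - d ^ 2 := by
    have : w.re ^ 2 + w.im ^ 2 = ρ ^ 4 := by
      simp only [hw, Complex.mul_re, Complex.mul_im, Complex.conj_re, Complex.conj_im]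
      calc _ = (z.re ^ 2 + z.im ^ 2) * (c.re ^ 2 + c.im ^ 2) := by ring
        _ = _ := by rw [n1, n2]; ring
    rw [wre] at this
    linarith
  have habs : |w.im| = t := by rw [ht, ← wim, Real.sqrt_sq_eq_abs]
  have hz : z = w / (starRingEnd ℂ) c := by rw [hw, mul_div_cancel_right₀ _ hc0]
  rcases abs_choice w.im with h | h
  · left
    rw [hz]; congr 1
    apply Complex.ext
    · exact wre
    · simp only; rw [← habs, h]
  · right
    rw [mem_singleton_iff, hz]; congr 1
    apply Complex.ext
    · exact wre
    · simp only; rw [← habs, h]; ring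

open Classical in
theorem circle_cut {f : ℂ → ℂ → ZMod 2} {h : ℂ → ZMod 2} {G : Set ℂ} (hG : IsOpen G) {ρ : ℝ}
    (hρ : 0 < ρ) (hf : ∀ z ∈ sphere (0 : ℂ) ρ, LC f z)
    (hh : ∀ z ∈ sphere (0 : ℂ) ρ, z ∉ G → Sec f h z) :
    ∃ (s : ℂ → ZMod 2) (T : Finset ℂ), (∀ z ∈ T, z ∈ sphere (0 : ℂ) ρ ∧ z ∈ G) ∧
      (∀ z ∈ sphere (0 : ℂ) ρ, z ∉ T → Sec f s z) ∧
      ∀ z ∈ sphere (0 : ℂ) ρ, z ∉ G → ∀ᶠ y in 𝓝 z, s y = h y := by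
  have loc : ∀ z ∈ sphere (0 : ℂ) ρ, ∃ (k : ℂ → ZMod 2) (r : ℝ), 0 < r ∧
      (∀ y ∈ ball z r, Sec f k y) ∧ (k = h ∨ closedBall z r ⊆ G) := by
    intro z hz
    by_cases hzG : z ∈ G
    · obtain ⟨k, hk⟩ := hf z hz
      obtain ⟨ε, hε, hb⟩ := Metric.eventually_nhds_iff_ball.1 (hk.eventually.and (hG.mem_nhds hzG))
      refine ⟨k, ε / 2, by linarith, fun y hy => (hb y (ball_subset_ball (by linarith) hy)).1,
        Or.inr fun y hy => (hb y (closedBall_subset_ball (by linarith) hy)).2⟩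
    · obtain ⟨ε, hε, hb⟩ := Metric.eventually_nhds_iff_ball.1 (hh z hz hzG).eventually
      exact ⟨h, ε, hε, hb, Or.inl rfl⟩
  choose! k r hr hk hor using loc
  obtain ⟨t, hts, htc⟩ := (isCompact_sphere (0 : ℂ) ρ).elim_nhds_subcover (fun z => ball z (r z))
    (fun z hz => ball_mem_nhds z (hr z hz))
  let A : ℂ → Finset ℂ := fun y => t.filter fun i => y ∈ ball i (r i)
  let pick : Finset ℂ → ℂ := fun a => if H : a.Nonempty then H.choose else 0
  have hpick : ∀ a : Finset ℂ, a.Nonempty → pick a ∈ a := by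
    intro a ha
    simp only [pick, dif_pos ha]
    exact ha.choose_spec
  let s : ℂ → ZMod 2 := fun y => k (pick (A y)) y
  have hfin : (⋃ i ∈ t, sphere (0 : ℂ) ρ ∩ sphere i (r i)).Finite :=
    t.finite_toSet.biUnion fun i hi =>
      sphere_inter_finite hρ (mem_sphere_zero_iff_norm.1 (hts i hi))
  have hAne : ∀ z ∈ sphere (0 : ℂ) ρ, ∀ᶠ y in 𝓝 z, (A y).Nonempty := by
    intro z hz
    have ho : IsOpen (⋃ x ∈ t, ball x (r x)) := isOpen_biUnion fun _ _ => isOpen_ball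
    filter_upwards [ho.mem_nhds (htc hz)] with y hy
    simp only [mem_iUnion] at hy
    obtain ⟨i, hi, hy⟩ := hy
    exact ⟨i, Finset.mem_filter.2 ⟨hi, hy⟩⟩
  have hsG : ∀ z ∈ sphere (0 : ℂ) ρ, z ∉ G → ∀ᶠ y in 𝓝 z, s y = h y := by
    intro z hz hzG
    have h1 : ∀ i ∈ t, ∀ᶠ y in 𝓝 z, y ∈ ball i (r i) → k i = h := by
      intro i hi
      rcases hor i (hts i hi) with H | H
      · exact Eventually.of_forall fun _ _ => H
      · have : z ∉ closedBall i (r i) := fun hh => hzG (H hh)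
        filter_upwards [isClosed_closedBall.isOpen_compl.mem_nhds this] with y hy hy'
        exact absurd (ball_subset_closedBall hy') hy
    have h2 := (eventually_all_finset t).2 h1
    filter_upwards [h2, hAne z hz] with y hy hne
    have := hpick _ hne
    have h3 := Finset.mem_filter.1 this
    simp only [s]
    rw [hy _ h3.1 h3.2]
  refine ⟨s, hfin.toFinset.filter (· ∈ G), ?_, ?_, hsG⟩
  · intro z hz
    rw [Finset.mem_filter, Set.Finite.mem_toFinset] at hz
    simp only [mem_iUnion] at hz
    obtain ⟨⟨i, hi, hz⟩, hzG⟩ := hz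
    exact ⟨hz.1, hzG⟩
  · intro z hz hzT
    by_cases hzG : z ∈ G
    · have hA : ∀ᶠ y in 𝓝 z, A y = A z := by
        have h1 : ∀ i ∈ t, ∀ᶠ y in 𝓝 z, (y ∈ ball i (r i) ↔ z ∈ ball i (r i)) := by
          intro i hi
          have hns : z ∉ sphere i (r i) := by
            intro hs
            apply hzT
            rw [Finset.mem_filter, Set.Finite.mem_toFinset]
            refine ⟨?_, hzG⟩
            simp only [mem_iUnion]
            exact ⟨i, hi, hz, hs⟩
          by_cases hb : z ∈ ball i (r i)
          · filter_upwards [isOpen_ball.mem_nhds hb] with y hy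
            exact iff_of_true hy hb
          · have : z ∉ closedBall i (r i) := by
              rw [mem_sphere] at hns
              rw [mem_ball, not_lt] at hb
              rw [mem_closedBall, not_le]
              exact lt_of_le_of_ne hb (Ne.symm hns)
            filter_upwards [isClosed_closedBall.isOpen_compl.mem_nhds this] with y hy
            exact iff_of_false (fun h' => hy (ball_subset_closedBall h')) hb
        filter_upwards [(eventually_all_finset t).2 h1] with y hy
        exact Finset.filter_congr hy
      have hm := Finset.mem_filter.1 (hpick _ (hAne z hz).self_of_nhds)
      refine (hk _ (hts _ hm.1) z hm.2).congr ?_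
      filter_upwards [hA] with y hy
      simp only [s, hy]
      rfl
    · refine (hh z hz hzG).congr ?_
      filter_upwards [hsG z hz hzG] with y hy using hy.symm

end Circle

section Parity
variable {S : Type*} [MetricSpace S]

open Classical in
/-- branching number -/
noncomputable def bz (f : S → S → ZMod 2) (p : S) : ZMod 2 := if Br f p then 1 else 0

theorem punct_of_finset {f : S → S → ZMod 2} {P : Finset S} (hf : ∀ x, x ∉ P → LC f x) (p : S) :
    ∀ᶠ x in 𝓝[≠] p, LC f x := by
  classical
  have h : ((P.erase p : Finset S) : Set S)ᶜ ∈ 𝓝 p :=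
    (P.erase p).finite_toSet.isClosed.isOpen_compl.mem_nhds (by simp)
  rw [eventually_nhdsWithin_iff]
  filter_upwards [h] with x hx hxp
  apply hf
  intro hxP
  apply hx
  simp only [Finset.coe_erase, Set.mem_sdiff, Finset.mem_coe, mem_singleton_iff]
  exact ⟨hxP, hxp⟩

theorem bz_add (hc : HasCharts S) {f g : S → S → ZMod 2} {p : S} (hf : ∀ᶠ x in 𝓝[≠] p, LC f x)
    (hg : ∀ᶠ x in 𝓝[≠] p, LC g x) : bz (f + g) p = bz f p + bz g p := by
  unfold bz
  by_cases h1 : Br f p <;> by_cases h2 : Br g p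
  · rw [if_pos h1, if_pos h2, if_neg (br_br hc hf hg h1 h2)]; decide
  · rw [if_pos h1, if_neg h2, if_pos (br_add_left h1 h2)]; decide
  · rw [if_neg h1, if_pos h2, if_pos (by rw [add_comm]; exact br_add_left h2 h1)]; decide
  · rw [if_neg h1, if_neg h2, if_neg (not_br_add h1 h2)]; decide

theorem LC.bz {f : S → S → ZMod 2} {p : S} (h : LC f p) : bz f p = 0 := if_neg h.not_br

/-- The parity statement for torsors trivial off `Y`. -/
def ParOK (Y : Set S) : Prop :=
  ∀ (f : S → S → ZMod 2) (P : Finset S) (h : S → ZMod 2), (∀ x, x ∉ P → LC f x) →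
    (∀ x, x ∉ Y → x ∉ P → Sec f h x) → ∑ p ∈ P, bz f p = 0

theorem exists_radius {e : ℂ → S} (he : IsOpenEmbedding e) {K : Set S} (hK : IsCompact K)
    (hKs : K ⊆ range e) (P : Finset S) : ∃ ρ : ℝ, 0 < ρ ∧ K ⊆ e '' ball 0 ρ ∧
      ∀ z ∈ sphere (0 : ℂ) ρ, e z ∉ P := by
  have hK' : IsCompact (e ⁻¹' K) := he.isInducing.isCompact_preimage_iff hKs |>.2 hK
  obtain ⟨R, hR⟩ := hK'.isBounded.subset_ball 0
  have hfin : ((fun z : ℂ => ‖z‖) '' (e ⁻¹' (P : Set S))).Finite :=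
    (P.finite_toSet.preimage he.injective.injOn).image _
  obtain ⟨ρ, hρ, hρ'⟩ := ((Ioi_infinite (max R 0)).diff hfin).nonempty
  have h1 : max R 0 < ρ := hρ
  refine ⟨ρ, lt_of_le_of_lt (le_max_right _ _) h1, ?_, ?_⟩
  · intro x hx
    obtain ⟨z, rfl⟩ := hKs hx
    exact ⟨z, ball_subset_ball ((le_max_left _ _).trans h1.le) (hR hx), rfl⟩
  · intro z hz hzP
    exact hρ' ⟨z, hzP, mem_sphere_zero_iff_norm.1 hz⟩

theorem parOK_base (hc : HasCharts S) {e : ℂ → S} (he : IsOpenEmbedding e) {Y : Set S}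
    (hY : IsCompact Y) (hYs : Y ⊆ range e) : ParOK Y := by
  classical
  suffices H : ∀ (n : ℕ) (Y : Set S), IsCompact Y → Y ⊆ range e →
      ∀ (f : S → S → ZMod 2) (P : Finset S) (h : S → ZMod 2), (∀ x, x ∉ P → LC f x) →
      (∀ x, x ∉ Y → x ∉ P → Sec f h x) → (P.filter (Br f)).card = n → ∑ p ∈ P, bz f p = 0 from
    fun f P h h1 h2 => H _ Y hY hYs f P h h1 h2 rfl
  clear hY hYs Y
  intro n
  induction n using Nat.strong_induction_on with
  | _ n ih =>
  intro Y hY hYs f P h h1 h2 hn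
  have hBY : ∀ p, Br f p → p ∈ Y := by
    intro p hp
    by_contra hpY
    apply hp
    refine ⟨h, ?_⟩
    have h3 : ((P.erase p : Finset S) : Set S)ᶜ ∈ 𝓝 p :=
      (P.erase p).finite_toSet.isClosed.isOpen_compl.mem_nhds (by simp)
    rw [eventually_nhdsWithin_iff]
    filter_upwards [h3, hY.isClosed.isOpen_compl.mem_nhds hpY] with x hx hxY hxp
    apply h2 x hxY
    intro hxP
    apply hx
    simp only [Finset.coe_erase, Set.mem_sdiff, Finset.mem_coe, mem_singleton_iff]
    exact ⟨hxP, hxp⟩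
  by_cases hz : ∀ p ∈ P, ¬ Br f p
  · exact Finset.sum_eq_zero fun p hp => if_neg (hz p hp)
  push Not at hz
  obtain ⟨p, hpP, hp⟩ := hz
  by_cases hz2 : ∃ q, Br f q ∧ q ≠ p
  · obtain ⟨q, hq, hqp⟩ := hz2
    have hqP : q ∈ P := by
      by_contra hqP
      exact (h1 q hqP).not_br hq
    obtain ⟨zp, rfl⟩ := hYs (hBY p hp)
    obtain ⟨zq, rfl⟩ := hYs (hBY q hq)
    obtain ⟨g, C, hC, hCs, g1, g2, g3, g4⟩ := eta_chart he (z := zp) (w := zq)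
      (fun h => hqp (by rw [h]))
    have hgP : ∀ x, x ∉ P → LC g x := fun x hx => g2 x (fun h => hx (h ▸ hpP)) (fun h => hx (h ▸ hqP))
    have hsub : (P.filter (Br (f + g))) ⊆ ((P.filter (Br f)).erase (e zp)) := by
      intro x hx
      rw [Finset.mem_filter] at hx
      have hxp : x ≠ e zp := by
        rintro rfl
        exact br_br hc (punct_of_finset h1 _) (punct_of_finset hgP _) hp g3 hx.2
      have hxq : x ≠ e zq := by
        rintro rfl
        exact br_br hc (punct_of_finset h1 _) (punct_of_finset hgP _) hq g4 hx.2
      rw [Finset.mem_erase, Finset.mem_filter]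
      refine ⟨hxp, hx.1, ?_⟩
      by_contra hb
      exact not_br_add hb (g2 x hxp hxq).not_br hx.2
    have hlt : (P.filter (Br (f + g))).card < n := by
      rw [← hn]
      exact lt_of_le_of_lt (Finset.card_le_card hsub)
        (Finset.card_erase_lt_of_mem (Finset.mem_filter.2 ⟨hpP, hp⟩))
    have key := ih _ hlt (Y ∪ C) (hY.union hC) (union_subset hYs hCs) (f + g) P h
      (fun x hx => (h1 x hx).add (hgP x hx)) (fun x hx hxP => by
        rw [mem_union, not_or] at hx
        have := (h2 x hx.1 hxP).add (g1 x hx.2)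
        rwa [add_zero] at this) rfl
    have e1 : ∑ x ∈ P, bz (f + g) x = ∑ x ∈ P, bz f x + ∑ x ∈ P, bz g x := by
      rw [← Finset.sum_add_distrib]
      exact Finset.sum_congr rfl fun x _ => bz_add hc (punct_of_finset h1 _) (punct_of_finset hgP _)
    have e2 : ∑ x ∈ P, bz g x = bz g (e zp) + bz g (e zq) := by
      rw [← Finset.sum_pair (Ne.symm hqp)]
      symm
      apply Finset.sum_subset
      · intro x hx
        rw [Finset.mem_insert, Finset.mem_singleton] at hx
        rcases hx with rfl | rfl <;> assumption
      · intro x _ hx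
        rw [Finset.mem_insert, Finset.mem_singleton, not_or] at hx
        exact (g2 x hx.1 hx.2).bz
    have e3 : bz g (e zp) + bz g (e zq) = 0 := by
      simp only [bz, if_pos g3, if_pos g4]; decide
    rw [key, e2, e3, add_zero] at e1
    exact e1.symm
  · exfalso
    push Not at hz2
    obtain ⟨f', k1, k2⟩ := extend_finset (f := f) (P.erase p) (fun q hq hb =>
      (Finset.mem_erase.1 hq).1 (hz2 q hb))
    have hf' : ∀ x, x ≠ p → LC f' x := by
      intro x hx
      by_cases hxP : x ∈ P
      · exact k2 x (Finset.mem_erase.2 ⟨hx, hxP⟩)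
      · exact (k1 x (fun h => hxP (Finset.mem_erase.1 h).2)).symm.lc (h1 x hxP)
    have hb' : Br f' p := by
      refine br_congr' ?_ hp
      have h3 : ((P.erase p : Finset S) : Set S)ᶜ ∈ 𝓝 p :=
        (P.erase p).finite_toSet.isClosed.isOpen_compl.mem_nhds (by simp)
      filter_upwards [mem_nhdsWithin_of_mem_nhds h3] with x hx using (k1 x hx).symm
    obtain ⟨zp, hzp⟩ := hYs (hBY p hp)
    let φ : ℂ ≃ₜ ℂ := Homeomorph.addRight zp
    have he' := he.comp φ.isOpenEmbedding
    have h0 : (e ∘ φ) 0 = p := by simp [φ, hzp]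
    have hK' : IsCompact ((e ∘ φ) ⁻¹' Y) := he'.isInducing.isCompact_preimage_iff (by
      rw [EquivLike.range_comp]; exact hYs) |>.2 hY
    have hfin : ((e ∘ φ) ⁻¹' (P : Set S)).Finite := P.finite_toSet.preimage he'.injective.injOn
    obtain ⟨R, hR⟩ := (hK'.isBounded.union hfin.isBounded).subset_closedBall 0
    obtain ⟨m, hm⟩ := mono_exists (f := pb (e ∘ φ) f') (fun z hz =>
      (hf' _ (fun h => hz (he'.injective (by rw [h0]; exact h)))).pb he'.continuous.continuousAt)
    have hm1 := (br_mono he' hm).1 (by rw [h0]; exact hb')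
    have hm0 := hm.zero_of_inf (h := h ∘ (e ∘ φ)) (R := R) (fun w hw => by
      refine Sec.pb ?_ he'.continuous.continuousAt
      have hnot : w ∉ closedBall (0 : ℂ) R := by
        rw [mem_closedBall_zero_iff]; exact not_le.2 hw
      have hwY : (e ∘ φ) w ∉ Y := fun h => hnot (hR (Or.inl h))
      have hwP : (e ∘ φ) w ∉ P := fun h => hnot (hR (Or.inr h))
      exact (k1 _ (fun h => hwP (Finset.mem_erase.1 h).2)).symm.sec (h2 _ hwY hwP))
    rw [hm1] at hm0
    exact one_ne_zero hm0

theorem parOK_step (hc : HasCharts S) {e : ℂ → S} (he : IsOpenEmbedding e) {G : Set S}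
    (hG : IsOpen G) (ih : ∀ Y, IsCompact Y → Y ⊆ G → ParOK Y) {Y : Set S}
    (hY : IsCompact Y) (hYs : Y ⊆ G ∪ range e) : ParOK Y := by
  classical
  intro f P h h1 h2
  obtain ⟨Y', K, hY', hK, hY'G, hKe, hYeq⟩ := hY.binary_compact_cover hG he.isOpen_range hYs
  obtain ⟨ρ, hρ, hKb, hPρ⟩ := exists_radius he hK hKe P
  have hcl : IsCompact (e '' closedBall 0 ρ) := (isCompact_closedBall 0 ρ).image he.continuous
  have hbo : IsOpen (e '' ball 0 ρ) := he.isOpenMap _ isOpen_ball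
  obtain ⟨s₀, T₀, hT, hs, hsG⟩ := circle_cut (f := pb e f) (h := h ∘ e)
    (hG.preimage he.continuous) hρ
    (fun z hz => (h1 _ (hPρ z hz)).pb he.continuous.continuousAt)
    (fun z hz hzG => by
      refine (h2 _ ?_ (hPρ z hz)).pb he.continuous.continuousAt
      rw [hYeq]
      rintro (h | h)
      · exact hzG (hY'G h)
      · obtain ⟨w, hw, hwz⟩ := hKb h
        have := he.injective hwz
        subst this
        exact (ne_of_lt (mem_ball.1 hw)) (mem_sphere.1 hz))
  obtain ⟨s, hse, hsd⟩ := descend (f := f) he s₀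
  let T : Finset S := T₀.image e
  have hcirc : ∀ x ∈ e '' sphere 0 ρ, x ∉ T → Sec f s x := by
    rintro _ ⟨z, hz, rfl⟩ hzT
    exact hsd z (hs z hz (fun h => hzT (Finset.mem_image_of_mem e h)))
  have hcircG : ∀ x ∈ e '' sphere 0 ρ, x ∉ G → (∀ᶠ y in 𝓝 x, s y = h y) := by
    rintro _ ⟨z, hz, rfl⟩ hzG
    rw [← he.map_nhds_eq, eventually_map]
    filter_upwards [hsG z hz hzG] with y hy
    have := congrFun hse y
    simp only [Function.comp] at this hy
    rw [this, hy]
  have hTsph : ∀ x ∈ T, x ∈ e '' sphere 0 ρ := by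
    intro x hx
    obtain ⟨z, hz, rfl⟩ := Finset.mem_image.1 hx
    exact ⟨z, (hT z hz).1, rfl⟩
  have hTP : ∀ x ∈ T, x ∉ P := by
    intro x hx
    obtain ⟨z, hz, rfl⟩ := hTsph x hx
    exact hPρ z hz
  let A : Set S := {x | Sec f s x}
  have hA : IsOpen A := isOpen_iff_mem_nhds.2 fun x hx => Sec.eventually hx
  let O1 : Set S := e '' ball 0 ρ ∪ A
  let O2 : Set S := (e '' closedBall 0 ρ)ᶜ ∪ A
  have hO1 : IsOpen O1 := hbo.union hA
  have hO2 : IsOpen O2 := hcl.isClosed.isOpen_compl.union hA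
  have hsubb : e '' ball 0 ρ ⊆ e '' closedBall 0 ρ := image_mono ball_subset_closedBall
  obtain ⟨F, hF1, hF2⟩ := glue hO1 hO2 f 0 s (by
    rintro x ⟨ha | ha, hb | hb⟩
    · exact absurd (hsubb ha) hb
    all_goals rw [add_zero]; assumption)
  simp only [add_zero] at hF2
  have hsplit : ∀ x, x ∈ e '' ball 0 ρ ∨ x ∈ e '' sphere 0 ρ ∨ x ∈ (e '' closedBall 0 ρ)ᶜ := by
    intro x
    by_cases hx : x ∈ e '' closedBall 0 ρ
    · obtain ⟨z, hz, rfl⟩ := hx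
      rcases lt_or_eq_of_le (mem_closedBall.1 hz) with h | h
      · exact Or.inl ⟨z, h, rfl⟩
      · exact Or.inr (Or.inl ⟨z, h, rfl⟩)
    · exact Or.inr (Or.inr hx)
  have hFLC : ∀ x, x ∉ P ∪ T → LC F x := by
    intro x hx
    rw [Finset.mem_union, not_or] at hx
    rcases hsplit x with h | h | h
    · exact (hF1 x (Or.inl h)).symm.lc (h1 x hx.1)
    · exact (hF2 x (Or.inr (hcirc x h hx.2))).lc
    · exact (hF2 x (Or.inl h)).lc
  have hfLC : ∀ x, x ∉ P ∪ T → LC f x := fun x hx => h1 x fun h => hx (Finset.mem_union_left _ h)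
  have par2 := parOK_base hc he hcl (image_subset_range _ _) F (P ∪ T) _ hFLC
    (fun x hx _ => hF2 x (Or.inl hx))
  -- second piece
  let Good : Set S := {x | x ∈ A ∧ ∀ᶠ y in 𝓝 x, s y = h y}
  have hGood : IsOpen Good := by
    rw [isOpen_iff_mem_nhds]
    rintro x ⟨hxA, hx⟩
    filter_upwards [hA.mem_nhds hxA, hx.eventually_nhds] with y a b using ⟨a, b⟩
  let Bd : Set S := e '' sphere 0 ρ \ Good
  have hBd : IsCompact Bd := ((isCompact_sphere 0 ρ).image he.continuous).diff hGood
  have hBdG : Bd ⊆ G := by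
    rintro x ⟨hx, hxg⟩
    by_contra hxG
    have hxx := hcircG x hx hxG
    refine hxg ⟨?_, hxx⟩
    refine hcirc x hx fun hxT => hxG ?_
    obtain ⟨z, hz, rfl⟩ := Finset.mem_image.1 hxT
    exact (hT z hz).2
  let k : S → ZMod 2 := fun y => if y ∈ e '' closedBall 0 ρ then 0 else
    h y + if y ∈ O1 then s y else 0
  have par1 := ih (Y' ∪ Bd) (hY'.union hBd) (union_subset hY'G hBdG) (f + F) (P ∪ T) k
    (fun x hx => (hfLC x hx).add (hFLC x hx)) (by
      intro x hx hxPT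
      rw [mem_union, not_or] at hx
      rw [Finset.mem_union, not_or] at hxPT
      rcases hsplit x with hb | hb | hb
      · have : Sec (f + F) 0 x := (hF1 x (Or.inl hb)).symm.sec0
        refine this.congr ?_
        filter_upwards [hbo.mem_nhds hb] with y hy
        simp only [k, if_pos (hsubb hy), Pi.zero_apply]
      · have hg : x ∈ Good := by
          by_contra hg
          exact hx.2 ⟨hb, hg⟩
        have : Sec (f + F) 0 x := (hF1 x (Or.inr hg.1)).symm.sec0
        refine this.congr ?_
        filter_upwards [hg.2, hA.mem_nhds hg.1] with y hy hyA
        simp only [k, Pi.zero_apply]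
        split_ifs with c1 c2
        · rfl
        · rw [hy]; grind
        · exact absurd (Or.inr hyA) c2
      · have hxY : x ∉ Y := by
          rw [hYeq]
          rintro (h' | h')
          · exact hx.1 h'
          · exact hb (hsubb (hKb h'))
        have := (h2 x hxY hxPT.1).add (hF2 x (Or.inl hb))
        refine this.congr ?_
        filter_upwards [hcl.isClosed.isOpen_compl.mem_nhds hb] with y hy
        simp only [k, Pi.add_apply, if_neg (show y ∉ e '' closedBall 0 ρ from hy)]
        congr)
  have e1 : ∑ x ∈ P ∪ T, bz (f + F) x = ∑ x ∈ P ∪ T, bz f x + ∑ x ∈ P ∪ T, bz F x := by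
    rw [← Finset.sum_add_distrib]
    exact Finset.sum_congr rfl fun x _ => bz_add hc (punct_of_finset hfLC _) (punct_of_finset hFLC _)
  rw [par1, par2, add_zero] at e1
  rw [e1]
  apply Finset.sum_subset Finset.subset_union_left
  intro x _ hx
  exact (h1 x hx).bz

/-- The number of branch points on a compact surface is even. -/
theorem parity [CompactSpace S] (hc : HasCharts S) {f : S → S → ZMod 2} {P : Finset S}
    (hf : ∀ x, x ∉ P → LC f x) : ∑ p ∈ P, bz f p = 0 := by
  classical
  choose e he h0 hr using fun x : S => hc x univ isOpen_univ (mem_univ x)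
  obtain ⟨t, ht⟩ := isCompact_univ.elim_nhds_subcover (fun x => range (e x))
    (fun x _ => (he x).isOpen_range.mem_nhds ⟨0, h0 x⟩)
  have key : ∀ t : Finset S, ∀ Y, IsCompact Y → Y ⊆ ⋃ x ∈ t, range (e x) → ParOK Y := by
    intro t
    induction t using Finset.induction_on with
    | empty =>
      intro Y hY hYs f P h h1 h2
      apply Finset.sum_eq_zero
      intro p hp
      refine if_neg (not_not.2 ⟨h, ?_⟩)
      have h3 : ((P.erase p : Finset S) : Set S)ᶜ ∈ 𝓝 p :=
        (P.erase p).finite_toSet.isClosed.isOpen_compl.mem_nhds (by simp)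
      rw [eventually_nhdsWithin_iff]
      filter_upwards [h3] with x hx hxp
      apply h2 x (fun h => by simpa using hYs h)
      intro hxP
      apply hx
      simp only [Finset.coe_erase, Set.mem_sdiff, Finset.mem_coe, mem_singleton_iff]
      exact ⟨hxP, hxp⟩
    | insert a t ha ih =>
      intro Y hY hYs
      refine parOK_step hc (he a) (G := ⋃ x ∈ t, range (e x))
        (isOpen_biUnion fun x _ => (he x).isOpen_range) ih hY ?_
      rw [Finset.set_biUnion_insert, union_comm] at hYs
      exact hYs
  exact key t univ isCompact_univ ht.2 f P 0 hf (fun x hx => absurd (mem_univ x) hx)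

end Parity
end DP

namespace DP

universe u

section Fin
variable {S : Type u} [MetricSpace S]

theorem HasCharts.conn_nhds (hc : HasCharts S) {x : S} {O : Set S}
    (hO : IsOpen O) (hx : x ∈ O) : ∃ B : Set S, IsOpen B ∧ x ∈ B ∧ B ⊆ O ∧ IsPreconnected B := by
  obtain ⟨e, he, h0, hr⟩ := hc x O hO hx
  exact ⟨range e, he.isOpen_range, ⟨0, h0⟩, hr, isPreconnected_range he.continuous⟩

theorem HasCharts.locConn (hc : HasCharts S) : LocallyConnectedSpace S := by
  rw [locallyConnectedSpace_iff_subsets_isOpen_isConnected]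
  intro x U hU
  obtain ⟨O, hO, hOo, hx⟩ := _root_.mem_nhds_iff.1 hU
  obtain ⟨B, h1, h2, h3, h4⟩ := hc.conn_nhds hOo hx
  exact ⟨B, h3.trans hO, h1, h2, ⟨x, h2⟩, h4⟩

/-- Finiteness of first cohomology. -/
theorem fin_inv (hc : HasCharts S) {M M' : Set S} (hM : IsCompact M) (hM' : IsOpen M')
    (hMM : M ⊆ M') : ∃ (T : Type u) (_ : Finite T) (Inv : (S → S → ZMod 2) → T),
      ∀ f f', (∀ x ∈ M', LC f x) → (∀ x ∈ M', LC f' x) → Inv f = Inv f' →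
        ∃ r, ∀ x ∈ M, Sec (f + f') r x := by
  classical
  choose! e he h0 hr using fun (x : S) (hx : x ∈ M) => hc x M' hM' (hMM hx)
  obtain ⟨t, htM, htc⟩ := hM.elim_nhds_subcover (fun x => e x '' ball 0 1) (fun x hx =>
    ((he x hx).isOpenMap _ isOpen_ball).mem_nhds ⟨0, by simp, h0 x hx⟩)
  have hsec : ∀ (f : S → S → ZMod 2) (i : S), ∃ h : S → ZMod 2, (∀ x ∈ M', LC f x) → i ∈ t →
      ∀ x ∈ range (e i), Sec f h x := by
    intro f i
    by_cases H : (∀ x ∈ M', LC f x) ∧ i ∈ t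
    · obtain ⟨h, hh⟩ := chart_sec (he i (htM i H.2)) (f := f)
        (fun x hx => H.1 x (hr i (htM i H.2) hx))
      exact ⟨h, fun _ _ => hh⟩
    · exact ⟨0, fun h1 h2 => absurd ⟨h1, h2⟩ H⟩
  choose h hh using hsec
  have hF : ∀ i j : S, ∃ F : Finset S, i ∈ t → j ∈ t →
      ∀ y ∈ e i '' closedBall 0 1 ∩ e j '' closedBall 0 1, ∃ c ∈ F, ∃ B : Set S,
        IsPreconnected B ∧ y ∈ B ∧ c ∈ B ∧ B ⊆ range (e i) ∩ range (e j) := by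
    intro i j
    by_cases H : i ∈ t ∧ j ∈ t
    · have hi := he i (htM i H.1)
      have hj := he j (htM j H.2)
      have hcpt : IsCompact (e i '' closedBall 0 1 ∩ e j '' closedBall 0 1) :=
        ((isCompact_closedBall 0 1).image hi.continuous).inter
          ((isCompact_closedBall 0 1).image hj.continuous)
      choose! B hB1 hB2 hB3 hB4 using fun (x : S) (hx : x ∈ e i '' closedBall 0 1 ∩ e j '' closedBall 0 1) =>
        hc.conn_nhds (hi.isOpen_range.inter hj.isOpen_range)
          (show x ∈ range (e i) ∩ range (e j) from
            ⟨image_subset_range _ _ hx.1, image_subset_range _ _ hx.2⟩)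
      obtain ⟨F, hF1, hF2⟩ := hcpt.elim_nhds_subcover B (fun x hx => (hB1 x hx).mem_nhds (hB2 x hx))
      refine ⟨F, fun _ _ y hy => ?_⟩
      have := hF2 hy
      simp only [mem_iUnion] at this
      obtain ⟨c, hcF, hyc⟩ := this
      exact ⟨c, hcF, B c, hB4 c (hF1 c hcF), hyc, hB2 c (hF1 c hcF), hB3 c (hF1 c hcF)⟩
    · exact ⟨∅, fun h1 h2 => absurd ⟨h1, h2⟩ H⟩
  choose F hF using hF
  let F' : Finset S := t.biUnion fun i => t.biUnion fun j => F i j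
  refine ⟨{x // x ∈ t} → {x // x ∈ t} → {x // x ∈ F'} → ZMod 2, inferInstance,
    fun f i j x => h f i x + h f j x, ?_⟩
  intro f f' hf hf' hI
  have hk : ∀ i ∈ t, ∀ x ∈ range (e i), Sec (f + f') (h f i + h f' i) x := fun i hi x hx =>
    (hh f i hf hi x hx).add (hh f' i hf' hi x hx)
  have hag : ∀ i ∈ t, ∀ j ∈ t, ∀ y ∈ e i '' closedBall 0 1 ∩ e j '' closedBall 0 1,
      (h f i + h f' i) y = (h f j + h f' j) y := by
    intro i hi j hj y hy
    obtain ⟨c, hcF, B, hB, hyB, hcB, hBs⟩ := hF i j hi hj y hy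
    have h1 := lcst_pre hB (h := (h f i + h f' i) + (h f j + h f' j)) (fun x hx =>
      (hk i hi x (hBs hx).1).lcst_add (hk j hj x (hBs hx).2)) hyB hcB
    have h2 := congr_fun (congr_fun (congr_fun hI ⟨i, hi⟩) ⟨j, hj⟩) ⟨c, by
      simp only [F', Finset.mem_biUnion]; exact ⟨i, hi, j, hj, hcF⟩⟩
    simp only [Pi.add_apply] at h1 h2 ⊢
    grind
  have hpick : ∀ y : S, ∃ j, (∃ i ∈ t, y ∈ e i '' ball 0 1) → j ∈ t ∧ y ∈ e j '' ball 0 1 := by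
    intro y
    by_cases H : ∃ i ∈ t, y ∈ e i '' ball 0 1
    · obtain ⟨i, hi⟩ := H
      exact ⟨i, fun _ => hi⟩
    · exact ⟨y, fun h => absurd h H⟩
  choose p hp using hpick
  refine ⟨fun y => (h f (p y) + h f' (p y)) y, fun x hx => ?_⟩
  have := htc hx
  simp only [mem_iUnion] at this
  obtain ⟨i, hi, hxi⟩ := this
  refine (hk i hi x (image_subset_range _ _ hxi)).congr ?_
  filter_upwards [((he i (htM i hi)).isOpenMap _ isOpen_ball).mem_nhds hxi] with y hy
  have hpy := hp y ⟨i, hi, hy⟩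
  exact hag i hi (p y) hpy.1 y ⟨image_mono ball_subset_closedBall hy,
    image_mono ball_subset_closedBall hpy.2⟩

end Fin

section Domains
variable {S : Type u} [MetricSpace S] {X U V : Set S}

theorem dom_sub (hU : IsComplementaryDomain X U) : U ⊆ Xᶜ := by
  obtain ⟨x, hx, rfl⟩ := hU
  exact connectedComponentIn_subset _ _

theorem dom_conn (hU : IsComplementaryDomain X U) : IsConnected U := by
  obtain ⟨x, hx, rfl⟩ := hU
  exact isConnected_connectedComponentIn_iff.2 hx

theorem dom_open (hc : HasCharts S) (hX : IsClosed X) (hU : IsComplementaryDomain X U) :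
    IsOpen U := by
  haveI := hc.locConn
  obtain ⟨x, hx, rfl⟩ := hU
  exact hX.isOpen_compl.connectedComponentIn

theorem dom_of_mem {x : S} (hU : IsComplementaryDomain X U) (hx : x ∈ U) :
    U = connectedComponentIn Xᶜ x := by
  obtain ⟨y, hy, rfl⟩ := hU
  exact connectedComponentIn_eq hx

theorem dom_disj (hU : IsComplementaryDomain X U) (hV : IsComplementaryDomain X V) (h : U ≠ V) :
    Disjoint U V := by
  rw [disjoint_left]
  intro x hx hxV
  exact h ((dom_of_mem hU hx).trans (dom_of_mem hV hxV).symm)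

theorem dom_self {x : S} (hx : x ∉ X) : x ∈ connectedComponentIn Xᶜ x :=
  mem_connectedComponentIn hx

theorem dom_frontier (hc : HasCharts S) (hX : IsClosed X) (hU : IsComplementaryDomain X U) :
    frontier U ⊆ X := by
  intro x hx
  by_contra hxX
  have hUo := dom_open hc hX hU
  have hV : IsComplementaryDomain X (connectedComponentIn Xᶜ x) := ⟨x, hxX, rfl⟩
  rw [hUo.frontier_eq] at hx
  obtain ⟨y, hy1, hy2⟩ := _root_.mem_closure_iff.1 hx.1 _ (dom_open hc hX hV) (dom_self hxX)
  by_cases h : U = connectedComponentIn Xᶜ x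
  · exact hx.2 (h ▸ dom_self hxX)
  · exact disjoint_left.1 (dom_disj hU hV h) hy2 hy1

theorem dom_frontier_ne [ConnectedSpace S] (hXne : X.Nonempty) (hU : IsComplementaryDomain X U) :
    (frontier U).Nonempty := by
  rw [nonempty_iff_ne_empty]
  intro h
  have h1 : IsClopen U := by rwa [isClopen_iff_frontier_eq_empty]
  rcases isClopen_iff.1 h1 with h2 | h2
  · exact (dom_conn hU).nonempty.ne_empty h2
  · obtain ⟨x, hx⟩ := hXne
    exact dom_sub hU (h2 ▸ mem_univ x) hx

theorem sat_conn [ConnectedSpace S] (hc : HasCharts S) (hX : IsClosed X) (hXc : IsConnected X)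
    {Z : Set S} (hXZ : X ⊆ Z) (hZ : ∀ y ∈ Z, y ∉ X → connectedComponentIn Xᶜ y ⊆ Z) :
    IsConnected Z := by
  obtain ⟨x, hx⟩ := hXc.nonempty
  refine ⟨⟨x, hXZ hx⟩, isPreconnected_of_forall x (fun y hy => ?_)⟩
  by_cases hyX : y ∈ X
  · exact ⟨X, hXZ, hx, hyX, hXc.isPreconnected⟩
  · have hV : IsComplementaryDomain X (connectedComponentIn Xᶜ y) := ⟨y, hyX, rfl⟩
    refine ⟨closure (connectedComponentIn Xᶜ y) ∪ X, ?_, Or.inr hx,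
      Or.inl (subset_closure (dom_self hyX)), ?_⟩
    · rw [closure_eq_self_union_frontier]
      exact union_subset (union_subset (hZ y hy hyX) ((dom_frontier hc hX hV).trans hXZ)) hXZ
    · obtain ⟨z, hz⟩ := dom_frontier_ne hXc.nonempty hV
      exact (dom_conn hV).isPreconnected.closure.union z hz.1 (dom_frontier hc hX hV hz)
        hXc.isPreconnected

theorem dom_compl_conn [ConnectedSpace S] (hc : HasCharts S) (hX : IsClosed X)
    (hXc : IsConnected X) (hU : IsComplementaryDomain X U) : IsConnected Uᶜ := by
  refine sat_conn hc hX hXc (fun x hx h => dom_sub hU h hx) (fun y hy hyX z hz hzU => hy ?_)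
  rw [dom_of_mem hU hzU, ← connectedComponentIn_eq hz]
  exact dom_self hyX

theorem dom_compl_conn2 [ConnectedSpace S] (hc : HasCharts S) (hX : IsClosed X)
    (hXc : IsConnected X) (hU : IsComplementaryDomain X U) (hV : IsComplementaryDomain X V) :
    IsConnected (Uᶜ ∩ Vᶜ) := by
  refine sat_conn hc hX hXc (fun x hx => ⟨fun h => dom_sub hU h hx, fun h => dom_sub hV h hx⟩)
    (fun y hy hyX z hz => ⟨fun hzU => hy.1 ?_, fun hzU => hy.2 ?_⟩)
  · rw [dom_of_mem hU hzU, ← connectedComponentIn_eq hz]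
    exact dom_self hyX
  · rw [dom_of_mem hV hzU, ← connectedComponentIn_eq hz]
    exact dom_self hyX

/-- Torsors trivial near the complement of `U` are trivial. -/
def Simp (U : Set S) : Prop :=
  ∀ f : S → S → ZMod 2, (∀ x, LC f x) → (∃ h, ∀ x, x ∉ U → Sec f h x) → ∃ r, ∀ x, Sec f r x

theorem simp_fin [CompactSpace S] [ConnectedSpace S] (hc : HasCharts S) (hX : IsClosed X)
    (hXc : IsConnected X) : {U | IsComplementaryDomain X U ∧ ¬ Simp U}.Finite := by
  classical
  by_contra hinf
  let Un := Set.Infinite.natEmbedding _ hinf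
  have h1 : ∀ n, ∃ f : S → S → ZMod 2, (∀ x, LC f x) ∧ (∃ h, ∀ x, x ∉ (Un n).1 → Sec f h x) ∧
      ¬ ∃ r, ∀ x, Sec f r x := by
    intro n
    have := (Un n).2.2
    unfold Simp at this
    push Not at this
    obtain ⟨f, a, b, c⟩ := this
    exact ⟨f, a, b, by push Not; exact c⟩
  choose f hf1 hf2 hf3 using h1
  choose h hh using hf2
  obtain ⟨T, hT, Inv, hInv⟩ := fin_inv hc (isCompact_univ (X := S)) isOpen_univ (subset_univ _)
  obtain ⟨n, m, hnm, hI⟩ := Finite.exists_ne_map_eq_of_infinite (fun n => Inv (f n))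
  obtain ⟨r, hr⟩ := hInv _ _ (fun x _ => hf1 n x) (fun x _ => hf1 m x) hI
  have hne : (Un n).1 ≠ (Un m).1 := fun h => hnm (Un.injective (Subtype.ext h))
  have hUn := (Un n).2.1
  have hUm := (Un m).2.1
  have hdis := dom_disj hUn hUm hne
  have hs : ∀ x, x ∉ (Un m).1 → Sec (f n) (r + h m) x := by
    intro x hx
    have := (hr x (mem_univ x)).add (hh m x hx)
    rwa [add_add_cancel2] at this
  obtain ⟨x0, hx0⟩ := hXc.nonempty
  have hd : ∀ x, x ∉ (Un n).1 → x ∉ (Un m).1 → LCst (r + h m + h n) x := fun x a b =>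
    (hs x b).lcst_add (hh n x a)
  have hcon : ∀ x, x ∉ (Un n).1 → x ∉ (Un m).1 → (r + h m + h n) x = (r + h m + h n) x0 := by
    intro x a b
    exact lcst_pre (dom_compl_conn2 hc hX hXc hUn hUm).isPreconnected
      (fun x hx => hd x hx.1 hx.2) ⟨a, b⟩ ⟨fun h => dom_sub hUn h hx0, fun h => dom_sub hUm h hx0⟩
  apply hf3 n
  refine ⟨fun y => if y ∈ (Un n).1 then (r + h m) y + (r + h m + h n) x0 else h n y, fun x => ?_⟩
  by_cases hx : x ∈ (Un n).1
  · have := (hs x (disjoint_left.1 hdis hx)).add_lcst (lcst_const ((r + h m + h n) x0) x)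
    refine this.congr ?_
    filter_upwards [(dom_open hc hX hUn).mem_nhds hx] with y hy
    simp only [if_pos hy, Pi.add_apply]
  · refine (hh n x hx).congr ?_
    by_cases hxm : x ∈ (Un m).1
    · filter_upwards [(dom_open hc hX hUm).mem_nhds hxm] with y hy
      rw [if_neg (disjoint_right.1 hdis hy)]
    · filter_upwards [hd x hx hxm] with y hy
      rw [hcon x hx hxm] at hy
      split_ifs
      · rw [← hy]; simp only [Pi.add_apply]; grind
      · rfl

theorem one_ended (hU : IsOpen U) (hUc : IsConnected U)
    (hUc' : IsConnected Uᶜ) (hs : Simp U) {C : Set S} (hC : IsCompact C)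
    (hCU : C ⊆ U) {g : S → ZMod 2} (hg : ∀ x ∈ U, x ∉ C → LCst g x) :
    ∃ c, ∀ x, x ∉ U → ∀ᶠ y in 𝓝 x, y ∈ U → g y = c := by
  obtain ⟨F, h1, h2, h3⟩ := mv hU hC.isClosed.isOpen_compl g (fun x hx => hg x hx.1 hx.2)
  obtain ⟨r, hr⟩ := hs F (fun x => by
    by_cases hx : x ∈ C
    · exact (h1 x (hCU hx)).lc
    · exact (h2 x hx).lc) ⟨_, fun x hx => h2 x (fun h => hx (hCU h))⟩
  obtain ⟨r1, r2, hr1, hr2, hgr⟩ := h3 r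
  obtain ⟨x1, hx1⟩ := hUc.nonempty
  obtain ⟨x2, hx2⟩ := hUc'.nonempty
  refine ⟨r1 x1 + r2 x2, fun x hx => ?_⟩
  have h4 := hr2 x (fun h => hx (hCU h)) (hr x)
  filter_upwards [h4] with y hy hyU
  rw [hgr y hyU, hy, lcst_pre hUc.isPreconnected (fun z hz => hr1 z hz (hr z)) hyU hx1,
    lcst_pre hUc'.isPreconnected (fun z hz => hr2 z (fun h => hz (hCU h)) (hr z)) hx hx2]

end Domains
end DP

namespace DP

section Plane

theorem compl_closedBall_pre (c : ℂ) {r : ℝ} (hr : 0 ≤ r) : IsPreconnected (closedBall c r)ᶜ := by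
  have h : (closedBall c r)ᶜ = (fun q : ℝ × ℝ => c + q.1 * Complex.exp (q.2 * Complex.I)) ''
      (Ioi r ×ˢ univ) := by
    ext z
    simp only [mem_compl_iff, mem_closedBall, not_le, mem_image, mem_prod, mem_Ioi, mem_univ,
      and_true, Prod.exists]
    constructor
    · intro hz
      refine ⟨‖z - c‖, Complex.arg (z - c), by rwa [← dist_eq_norm], ?_⟩
      rw [Complex.norm_mul_exp_arg_mul_I]
      ring
    · rintro ⟨a, b, hab, rfl⟩
      rw [dist_eq_norm, add_sub_cancel_left, norm_mul, Complex.norm_exp_ofReal_mul_I, mul_one,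
        Complex.norm_real, Real.norm_eq_abs]
      exact lt_of_lt_of_le hab (le_abs_self a)
  rw [h]
  refine IsPreconnected.image (isPreconnected_Ioi.prod isPreconnected_univ) _ ?_
  exact Continuous.continuousOn (by fun_prop)

theorem strip_core {A1 A2 : Set ℂ} (P : Finset ℂ) (hP : A1 ∩ A2 ⊆ P) (hP' : (P : Set ℂ) ⊆ A1 ∩ A2)
    {F : ℂ → ℂ → ZMod 2} {k : ℂ → ZMod 2} (hF1 : ∀ x, x ∉ A1 → Sec F 0 x)
    (hF2 : ∀ x, x ∉ A2 → Sec F k x) (hb : ∀ p ∈ P, ¬ Br F p) :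
    ∃ r : ℂ → ZMod 2, (∀ x, x ∉ A1 → LCst r x) ∧ ∀ x, x ∉ A2 → LCst (r + k) x := by
  obtain ⟨f', h1, h2⟩ := extend_finset P hb
  obtain ⟨r, hr⟩ := plane (f := f') (fun x => by
    by_cases hx : x ∈ P
    · exact h2 x hx
    · refine (h1 x hx).symm.lc ?_
      by_cases hx1 : x ∈ A1
      · exact (hF2 x (fun hx2 => hx (hP ⟨hx1, hx2⟩))).lc
      · exact (hF1 x hx1).lc)
  refine ⟨r, fun x hx => ?_, fun x hx => ?_⟩
  · have := ((h1 x (fun h => hx (hP' h).1)).sec (hr x)).lcst_add (hF1 x hx)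
    rwa [add_zero] at this
  · exact ((h1 x (fun h => hx (hP' h).2)).sec (hr x)).lcst_add (hF2 x hx)

theorem strip_par {A1 A2 : Set ℂ} (hA2 : IsCompact A2) (P : Finset ℂ) (hP : A1 ∩ A2 ⊆ P)
    {F : ℂ → ℂ → ZMod 2} {k : ℂ → ZMod 2} (hF1 : ∀ x, x ∉ A1 → Sec F 0 x)
    (hF2 : ∀ x, x ∉ A2 → Sec F k x) : (∀ x, x ∉ P → LC F x) ∧ ∑ p ∈ P, bz F p = 0 := by
  have hLC : ∀ x, x ∉ P → LC F x := by
    intro x hx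
    by_cases hx1 : x ∈ A1
    · exact (hF2 x (fun hx2 => hx (hP ⟨hx1, hx2⟩))).lc
    · exact (hF1 x hx1).lc
  exact ⟨hLC, parOK_base hasCharts_plane (e := id) IsOpenEmbedding.id hA2 (by simp) F P k hLC
    (fun x hx _ => hF2 x hx)⟩

theorem not_br_of_bz {S : Type*} [MetricSpace S] {F : S → S → ZMod 2} {p : S} (h : bz F p = 0) :
    ¬ Br F p := by
  intro hb
  unfold bz at h
  rw [if_pos hb] at h
  exact one_ne_zero h

open Classical in
theorem strip_mv {A1 A2 : Set ℂ} (hA1 : IsClosed A1) (hA2 : IsClosed A2) {g : ℂ → ZMod 2}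
    (hg : ∀ x, x ∉ A1 → x ∉ A2 → LCst g x) : ∃ (F : ℂ → ℂ → ZMod 2) (k : ℂ → ZMod 2),
      (∀ x, x ∉ A1 → Sec F 0 x) ∧ (∀ x, x ∉ A2 → Sec F k x) ∧ ∀ x, x ∉ A1 → k x = g x := by
  obtain ⟨F, h1, h2, -⟩ := mv hA1.isOpen_compl hA2.isOpen_compl g (fun x hx => hg x hx.1 hx.2)
  exact ⟨F, _, h1, h2, fun x hx => if_pos hx⟩

theorem split_one {A1 A2 : Set ℂ} (hA1 : IsClosed A1) (hA2 : IsCompact A2) {m : ℂ}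
    (hm : A1 ∩ A2 = {m}) {g : ℂ → ZMod 2} (hg : ∀ x, x ∉ A1 → x ∉ A2 → LCst g x) :
    ∃ r k : ℂ → ZMod 2, (∀ x, x ∉ A1 → LCst r x) ∧ (∀ x, x ∉ A2 → LCst (r + k) x) ∧
      ∀ x, x ∉ A1 → k x = g x := by
  obtain ⟨F, k, h1, h2, h3⟩ := strip_mv hA1 hA2.isClosed hg
  have hP : A1 ∩ A2 ⊆ ({m} : Finset ℂ) := by simp [hm]
  have := (strip_par hA2 {m} hP h1 h2).2
  rw [Finset.sum_singleton] at this
  obtain ⟨r, hr1, hr2⟩ := strip_core {m} hP (by simp [hm]) h1 h2 (by simpa using not_br_of_bz this)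
  exact ⟨r, k, hr1, hr2, h3⟩

/-- An arc does not separate the plane. -/
theorem arc_const {β : ℝ → ℂ} {a b : ℝ} (hab : a ≤ b) (hβ : ContinuousOn β (Icc a b))
    (hinj : InjOn β (Icc a b)) {g : ℂ → ZMod 2} (hg : ∀ x, x ∉ β '' Icc a b → LCst g x)
    {u v : ℂ} (hu : u ∉ β '' Icc a b) (hv : v ∉ β '' Icc a b) : g u = g v := by
  have hcpt : IsCompact (β '' Icc a b) := isCompact_Icc.image_of_continuousOn hβ
  obtain ⟨ε, hε, hεd⟩ : ∃ ε > 0, ∀ x ∈ β '' Icc a b, ε < dist u x ∧ ε < dist v x := by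
    obtain ⟨e1, h1, h1'⟩ := Metric.isOpen_iff.1 hcpt.isClosed.isOpen_compl u hu
    obtain ⟨e2, h2, h2'⟩ := Metric.isOpen_iff.1 hcpt.isClosed.isOpen_compl v hv
    refine ⟨min e1 e2 / 2, by positivity, fun x hx => ⟨?_, ?_⟩⟩
    · by_contra h
      refine h1' (show x ∈ ball u e1 from ?_) hx
      rw [mem_ball, dist_comm]
      have := min_le_left e1 e2
      linarith [lt_min h1 h2]
    · by_contra h
      refine h2' (show x ∈ ball v e2 from ?_) hx
      rw [mem_ball, dist_comm]
      have := min_le_right e1 e2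
      linarith [lt_min h1 h2]
  have huc := isCompact_Icc.uniformContinuousOn_of_continuous hβ
  obtain ⟨δ, hδ, hδd⟩ := Metric.uniformContinuousOn_iff.1 huc ε hε
  have small : ∀ c d, c ∈ Icc a b → d ∈ Icc a b → c ≤ d → d - c < δ → ∀ g : ℂ → ZMod 2,
      (∀ x, x ∉ β '' Icc c d → LCst g x) → g u = g v := by
    intro c d hc hd hcd hδ' g hg
    have hcc : β c ∈ β '' Icc a b := ⟨c, hc, rfl⟩
    refine lcst_pre (compl_closedBall_pre (β c) hε.le) (h := g) (fun x hx => hg x ?_) ?_ ?_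
    · rintro ⟨s, hs, rfl⟩
      apply hx
      rw [mem_closedBall]
      refine (hδd s ⟨hc.1.trans hs.1, hs.2.trans hd.2⟩ c hc ?_).le
      rw [Real.dist_eq, abs_of_nonneg (by linarith [hs.1])]
      linarith [hs.2]
    · rw [mem_compl_iff, mem_closedBall, not_le]; exact (hεd _ hcc).1
    · rw [mem_compl_iff, mem_closedBall, not_le]; exact (hεd _ hcc).2
  have key : ∀ n : ℕ, ∀ d ∈ Icc a b, d - a ≤ n * (δ / 2) → ∀ g : ℂ → ZMod 2,
      (∀ x, x ∉ β '' Icc a d → LCst g x) → g u = g v := by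
    intro n
    induction n with
    | zero =>
      intro d hd hda g hg
      simp only [Nat.cast_zero, zero_mul] at hda
      exact small a d ⟨le_rfl, hab⟩ hd hd.1 (by linarith) g hg
    | succ n ih =>
      intro d hd hda g hg
      by_cases hs : d - a < δ
      · exact small a d ⟨le_rfl, hab⟩ hd hd.1 hs g hg
      set c := d - δ / 2 with hcdef
      have hac : a ≤ c := by linarith
      have hcd : c ≤ d := by linarith
      have hcI : c ∈ Icc a b := ⟨hac, hcd.trans hd.2⟩
      have s1 : Icc a c ⊆ Icc a b := Icc_subset_Icc_right hcI.2
      have s2 : Icc c d ⊆ Icc a b := Icc_subset_Icc hac hd.2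
      have hu' : β '' Icc a d = β '' Icc a c ∪ β '' Icc c d := by
        rw [← image_union, Icc_union_Icc_eq_Icc hac hcd]
      have hintr : β '' Icc a c ∩ β '' Icc c d = {β c} := by
        rw [← hinj.image_inter s1 s2]
        have : Icc a c ∩ Icc c d = {c} := by
          ext x
          simp only [mem_inter_iff, mem_Icc, mem_singleton_iff]
          constructor
          · rintro ⟨h1, h2⟩; linarith
          · rintro rfl; exact ⟨⟨hac, le_rfl⟩, le_rfl, hcd⟩
        rw [this, image_singleton]
      obtain ⟨r, k, hr, hk, hkg⟩ := split_one
        (isCompact_Icc.image_of_continuousOn (hβ.mono s1)).isClosed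
        (isCompact_Icc.image_of_continuousOn (hβ.mono s2)) hintr (g := g)
        (fun x h1 h2 => hg x (by rw [hu']; rintro (h | h); exacts [h1 h, h2 h]))
      have e1 : r u = r v := ih c hcI (by push_cast at hda; linarith) r hr
      have e2 : (r + k) u = (r + k) v := small c d hcI hd hcd (by linarith) _ hk
      have e3 := hkg u (fun h => hu (image_mono s1 h))
      have e4 := hkg v (fun h => hv (image_mono s1 h))
      simp only [Pi.add_apply] at e2
      grind
  obtain ⟨n, hn⟩ := exists_nat_ge ((b - a) / (δ / 2))
  refine key n b ⟨hab, le_rfl⟩ ?_ g hg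
  rwa [div_le_iff₀ (by positivity)] at hn

theorem finish_strip {A1 A : Set ℂ} {r k : ℂ → ZMod 2} {β : ℝ → ℂ} {a b : ℝ} (hab : a ≤ b)
    (hβ : ContinuousOn β (Icc a b)) (hinj : InjOn β (Icc a b)) (hA : A = β '' Icc a b)
    (hr : ∀ x, x ∉ A1 → LCst r x) (hk : ∀ x, x ∉ A → LCst (r + k) x) :
    ∃ r' : ℂ → ZMod 2, (∀ x, x ∉ A1 → LCst r' x) ∧ ∀ x, x ∉ A → r' x = k x := by
  subst hA
  by_cases hne : ∃ u, u ∉ β '' Icc a b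
  · obtain ⟨u, hu⟩ := hne
    refine ⟨r + fun _ => (r + k) u, fun x hx => (hr x hx).add (lcst_const _ x), fun x hx => ?_⟩
    have := arc_const hab hβ hinj hk hx hu
    simp only [Pi.add_apply] at this ⊢
    grind
  · push Not at hne
    exact ⟨r, hr, fun x hx => absurd (hne x) hx⟩

theorem strip {A1 : Set ℂ} (hA1 : IsClosed A1) {β : ℝ → ℂ} {a b : ℝ} (hab : a ≤ b)
    (hβ : ContinuousOn β (Icc a b)) (hinj : InjOn β (Icc a b)) {m : ℂ}
    (hm : A1 ∩ β '' Icc a b = {m}) {g : ℂ → ZMod 2}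
    (hg : ∀ x, x ∉ A1 → x ∉ β '' Icc a b → LCst g x) :
    ∃ r : ℂ → ZMod 2, (∀ x, x ∉ A1 → LCst r x) ∧
      ∀ x, x ∉ A1 → x ∉ β '' Icc a b → r x = g x := by
  obtain ⟨r, k, hr, hk, hkg⟩ := split_one hA1 (isCompact_Icc.image_of_continuousOn hβ) hm hg
  obtain ⟨r', h1, h2⟩ := finish_strip hab hβ hinj rfl hr hk
  exact ⟨r', h1, fun x hx hx' => (h2 x hx').trans (hkg x hx)⟩

open Classical in
/-- Two functions split along an arc meeting the rest in both end points. -/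
theorem strip_two {A1 : Set ℂ} (hA1 : IsClosed A1) {β : ℝ → ℂ} {a b : ℝ} (hab : a ≤ b)
    (hβ : ContinuousOn β (Icc a b)) (hinj : InjOn β (Icc a b)) {m n : ℂ} (hmn : m ≠ n)
    (hm : A1 ∩ β '' Icc a b = {m, n}) {g1 g2 : ℂ → ZMod 2}
    (hg1 : ∀ x, x ∉ A1 → x ∉ β '' Icc a b → LCst g1 x)
    (hg2 : ∀ x, x ∉ A1 → x ∉ β '' Icc a b → LCst g2 x) :
    ∃ g, (g = g1 ∨ g = g2 ∨ g = g1 + g2) ∧ ∃ r : ℂ → ZMod 2, (∀ x, x ∉ A1 → LCst r x) ∧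
      ∀ x, x ∉ A1 → x ∉ β '' Icc a b → r x = g x := by
  have hcpt := isCompact_Icc.image_of_continuousOn hβ
  obtain ⟨F1, k1, a1, b1, c1⟩ := strip_mv hA1 hcpt.isClosed hg1
  obtain ⟨F2, k2, a2, b2, c2⟩ := strip_mv hA1 hcpt.isClosed hg2
  have hP : A1 ∩ β '' Icc a b ⊆ ({m, n} : Finset ℂ) := by simp [hm]
  have hP' : (({m, n} : Finset ℂ) : Set ℂ) ⊆ A1 ∩ β '' Icc a b := by simp [hm]
  have main : ∀ (F : ℂ → ℂ → ZMod 2) (k g : ℂ → ZMod 2), (∀ x, x ∉ A1 → Sec F 0 x) →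
      (∀ x, x ∉ β '' Icc a b → Sec F k x) → (∀ x, x ∉ A1 → k x = g x) → bz F m = 0 →
      ∃ r : ℂ → ZMod 2, (∀ x, x ∉ A1 → LCst r x) ∧
        ∀ x, x ∉ A1 → x ∉ β '' Icc a b → r x = g x := by
    intro F k g h1 h2 h3 h4
    have := (strip_par hcpt {m, n} hP h1 h2).2
    rw [Finset.sum_pair hmn, h4, zero_add] at this
    obtain ⟨r, hr, hk⟩ := strip_core {m, n} hP hP' h1 h2 (by
      intro p hp
      simp only [Finset.mem_insert, Finset.mem_singleton] at hp
      rcases hp with rfl | rfl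
      · exact not_br_of_bz h4
      · exact not_br_of_bz this)
    obtain ⟨r', h1', h2'⟩ := finish_strip hab hβ hinj rfl hr hk
    exact ⟨r', h1', fun x hx hx' => (h2' x hx').trans (h3 x hx)⟩
  rcases z2 (bz F1 m) with h | h
  · exact ⟨g1, Or.inl rfl, main F1 k1 g1 a1 b1 c1 h⟩
  rcases z2 (bz F2 m) with h' | h'
  · exact ⟨g2, Or.inr (Or.inl rfl), main F2 k2 g2 a2 b2 c2 h'⟩
  refine ⟨g1 + g2, Or.inr (Or.inr rfl), main (F1 + F2) (k1 + k2) _ (fun x hx => ?_)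
    (fun x hx => (b1 x hx).add (b2 x hx)) (fun x hx => ?_) ?_⟩
  · have := (a1 x hx).add (a2 x hx)
    rwa [add_zero] at this
  · simp only [Pi.add_apply, c1 x hx, c2 x hx]
  · rw [bz_add hasCharts_plane (punct_of_finset (strip_par hcpt _ hP a1 b1).1 m)
      (punct_of_finset (strip_par hcpt _ hP a2 b2).1 m), h, h']
    decide

theorem no_inj_plane {f : ℂ → ℝ} (hf : Continuous f) (hinj : Function.Injective f) : False := by
  have h : ∀ z : ℂ, (∀ w, w ≠ z → f z < f w) ∨ (∀ w, w ≠ z → f w < f z) := by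
    intro z
    by_contra hcon
    push Not at hcon
    obtain ⟨⟨w, hw, h1⟩, ⟨w', hw', h2⟩⟩ := hcon
    have hc := (isConnected_compl_singleton_of_one_lt_rank (by simp) z).isPreconnected.image f
      hf.continuousOn
    have := hc.Icc_subset ⟨w, hw, rfl⟩ ⟨w', hw', rfl⟩ ⟨h1, h2⟩
    obtain ⟨y, hy, hyz⟩ := this
    exact hy (hinj hyz)
  have h01 : (0 : ℂ) ≠ 1 := zero_ne_one
  have h02 : (0 : ℂ) ≠ 2 := by norm_num
  have h12 : (1 : ℂ) ≠ 2 := by norm_num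
  rcases h 0 with h0 | h0 <;> rcases h 1 with h1 | h1 <;> rcases h 2 with h2 | h2 <;>
    linarith [h0 1 h01.symm, h0 2 h02.symm, h1 0 h01, h1 2 h12.symm, h2 0 h02, h2 1 h12]

end Plane
end DP

namespace DP

/-- A properly embedded line in the open set `U`. -/
structure PLine {S : Type*} [MetricSpace S] (U : Set S) (γ : ℝ → S) : Prop where
  op : IsOpen U
  emb : IsEmbedding γ
  sub : range γ ⊆ U
  cl : ∀ x ∈ U, x ∈ closure (range γ) → x ∈ range γ

section SL
variable {S : Type*} [MetricSpace S] {U : Set S} {γ : ℝ → S}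

theorem PLine.open' (h : PLine U γ) : IsOpen (U \ range γ) := by
  have : U \ range γ = U ∩ (closure (range γ))ᶜ := by
    ext x
    exact ⟨fun hx => ⟨hx.1, fun h' => hx.2 (h.cl x hx.1 h')⟩,
      fun hx => ⟨hx.1, fun h' => hx.2 (subset_closure h')⟩⟩
  rw [this]
  exact h.op.inter isClosed_closure.isOpen_compl

theorem PLine.no_int (hc : HasCharts S) (h : PLine U γ) {O : Set S} (hO : IsOpen O) {x : S}
    (hx : x ∈ O) : ∃ y ∈ O, y ∉ range γ := by
  by_contra hcon
  push Not at hcon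
  obtain ⟨e, he, -, hr⟩ := hc x O hO hx
  have h1 : ∀ z, e z ∈ range γ := fun z => hcon _ (hr (mem_range_self z))
  let f : ℂ → ℝ := fun z => h.emb.toHomeomorph.symm ⟨e z, h1 z⟩
  refine no_inj_plane (f := f) ?_ ?_
  · exact h.emb.toHomeomorph.symm.continuous.comp (he.continuous.subtype_mk _)
  · intro z w hzw
    have := h.emb.toHomeomorph.symm.injective hzw
    exact he.injective (by simpa using this)

/-- g extends over the line at `γ t` -/
def Ext (γ : ℝ → S) (g : S → ZMod 2) (t : ℝ) : Prop :=
  ∃ c, ∀ᶠ y in 𝓝 (γ t), y ∉ range γ → g y = c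

theorem PLine.chart (hc : HasCharts S) (h : PLine U γ) (t : ℝ) :
    ∃ (e : ℂ → S) (β : ℝ → ℂ) (a b : ℝ), IsOpenEmbedding e ∧ range e ⊆ U ∧ a < t ∧ t < b ∧
      (∀ s ∈ Icc a b, e (β s) = γ s) ∧ ContinuousOn β (Icc a b) ∧ InjOn β (Icc a b) ∧
      (∀ T : Set ℝ, T ⊆ Icc a b → e ⁻¹' (γ '' T) = β '' T) ∧
      ∀ T : Set ℝ, IsClosed T → IsClosed (e ⁻¹' (γ '' T)) := by
  obtain ⟨e, he, h0, hr⟩ := hc (γ t) U h.op (h.sub (mem_range_self t))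
  have hN : γ ⁻¹' (range e) ∈ 𝓝 t :=
    (he.isOpen_range.preimage h.emb.continuous).mem_nhds ⟨0, h0⟩
  obtain ⟨ε, hε, hb⟩ := Metric.mem_nhds_iff.1 hN
  have hI : Icc (t - ε / 2) (t + ε / 2) ⊆ γ ⁻¹' (range e) := by
    intro s hs
    apply hb
    rw [mem_ball, Real.dist_eq, abs_lt]
    constructor <;> linarith [hs.1, hs.2]
  have hI' : ∀ s : ℝ, s ∈ Icc (t - ε / 2) (t + ε / 2) → ∃ z, e z = γ s := fun s hs => hI hs
  choose! β hβ using hI'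
  have hβ' : ∀ s ∈ Icc (t - ε / 2) (t + ε / 2), e (β s) = γ s := fun s hs => hβ s hs
  refine ⟨e, β, t - ε / 2, t + ε / 2, he, hr, by linarith, by linarith, hβ', ?_, ?_, ?_, ?_⟩
  · have : ContinuousOn (e ∘ β) (Icc (t - ε / 2) (t + ε / 2)) :=
      h.emb.continuous.continuousOn.congr hβ'
    intro s hs
    exact he.isInducing.continuousWithinAt_iff.2 (this s hs)
  · intro s hs s' hs' heq
    apply h.emb.injective
    rw [← hβ' s hs, ← hβ' s' hs', heq]
  · intro T hT
    ext z
    constructor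
    · rintro ⟨s, hs, hz⟩
      refine ⟨s, hs, he.injective ?_⟩
      rw [hβ' s (hT hs), hz]
    · rintro ⟨s, hs, rfl⟩
      exact ⟨s, hs, (hβ' s (hT hs)).symm⟩
  · intro T hT
    obtain ⟨C, hC, hCT⟩ := h.emb.isInducing.isClosed_iff.1 hT
    have : e ⁻¹' (γ '' T) = e ⁻¹' (closure (range γ) ∩ C) := by
      ext z
      constructor
      · rintro ⟨s, hs, hz⟩
        refine ⟨subset_closure ⟨s, hz⟩, ?_⟩
        rw [← hz]
        rw [← hCT] at hs
        exact hs
      · rintro ⟨h1, h2⟩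
        obtain ⟨s, hs⟩ := h.cl _ (hr (mem_range_self z)) h1
        refine ⟨s, ?_, hs⟩
        rw [← hCT]
        show γ s ∈ C
        rw [hs]; exact h2
    rw [this]
    exact (isClosed_closure.inter hC).preimage he.continuous

theorem image_inter_aux (h : Function.Injective γ) (e : ℂ → S) (T T' : Set ℝ) :
    e ⁻¹' (γ '' T) ∩ e ⁻¹' (γ '' T') = e ⁻¹' (γ '' (T ∩ T')) := by
  rw [image_inter h, preimage_inter]

theorem ext_of {e : ℂ → S} {β : ℝ → ℂ} (he : IsOpenEmbedding e) {s : ℝ} (hs : e (β s) = γ s)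
    {r : ℂ → ZMod 2} {g : S → ZMod 2} (hr : LCst r (β s))
    (hrg : ∀ z, e z ∉ range γ → r z = g (e z)) : Ext γ g s := by
  refine ⟨r (β s), ?_⟩
  rw [← hs, ← he.map_nhds_eq, eventually_map]
  filter_upwards [hr] with z hz hz'
  rw [← hrg z hz', hz]

open Classical in
theorem PLine.ext_loc (hc : HasCharts S) (h : PLine U γ) {g : S → ZMod 2}
    (hg : ∀ x ∈ U, x ∉ range γ → LCst g x) (t : ℝ) :
    ∃ a b, a < t ∧ t < b ∧ ∀ t' ∈ Ioo a b, Ext γ g t' → ∀ s ∈ Ioo a b, Ext γ g s := by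
  obtain ⟨e, β, a, b, he, hr, hat, htb, hβ, hβc, hβi, hA, hcl⟩ := h.chart hc t
  refine ⟨a, b, hat, htb, fun t' ht' ⟨c, hcc⟩ s hs => ?_⟩
  obtain ⟨N, hN, hNo, htN⟩ := _root_.mem_nhds_iff.1 hcc
  have h1 : γ ⁻¹' N ∩ Ioo a b ∈ 𝓝 t' := ((hNo.preimage h.emb.continuous).inter isOpen_Ioo).mem_nhds
    ⟨htN, ht'⟩
  obtain ⟨ε, hε, hb⟩ := Metric.mem_nhds_iff.1 h1
  have hb' : ∀ s, t' - ε / 2 ≤ s → s ≤ t' + ε / 2 → γ s ∈ N ∧ s ∈ Ioo a b := by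
    intro s h1 h2
    apply hb
    rw [mem_ball, Real.dist_eq, abs_lt]
    constructor <;> linarith
  set a1 := t' - ε / 2 with ha1
  set b1 := t' + ε / 2 with hb1
  have haa1 : a < a1 := (hb' a1 le_rfl (by linarith)).2.1
  have hbb1 : b1 < b := (hb' b1 (by linarith) le_rfl).2.2
  have hab1 : a1 < b1 := by linarith
  have hK : ∀ z, e z ∈ range γ ↔ z ∈ e ⁻¹' (γ '' univ) := by intro z; rw [image_univ]; rfl
  let g' : ℂ → ZMod 2 := fun z => if e z ∈ range γ then c else g (e z)
  have hg' : ∀ z, z ∉ e ⁻¹' (γ '' (Ioo a1 b1)ᶜ) → LCst g' z := by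
    intro z hz
    by_cases hzK : e z ∈ range γ
    · obtain ⟨s, hs⟩ := hzK
      have hsI : s ∈ Ioo a1 b1 := by
        by_contra hsI
        exact hz ⟨s, hsI, hs⟩
      have hzN : e z ∈ N := hs ▸ (hb' s hsI.1.le hsI.2.le).1
      filter_upwards [(hNo.preimage he.continuous).mem_nhds hzN] with y hy
      simp only [g', if_pos (show e z ∈ range γ from ⟨s, hs⟩)]
      split_ifs with hyK
      · rfl
      · exact hN hy hyK
    · have h2 := (hg (e z) (hr (mem_range_self z)) hzK).pb (φ := e) he.continuous.continuousAt
      refine h2.congr ?_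
      have h3 := (hcl univ isClosed_univ).isOpen_compl.mem_nhds (show z ∈ _ from
        fun h => hzK ((hK z).2 h))
      filter_upwards [h3] with y hy
      simp only [g', Function.comp]
      rw [if_neg (fun h => hy ((hK y).1 h))]
  have hIc : ∀ a b : ℝ, a < b → (Ioo a b)ᶜ = Iic a ∪ Ici b := by
    intro a b hab
    ext x
    simp only [mem_compl_iff, mem_Ioo, not_and_or, not_lt, mem_union, mem_Iic, mem_Ici]
  -- first strip
  obtain ⟨r1, hr1, hr1'⟩ := strip (A1 := e ⁻¹' (γ '' ((Ioo a b)ᶜ ∪ Icc b1 b)))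
    (hcl _ (isOpen_Ioo.isClosed_compl.union isClosed_Icc)) (β := β) (a := a) (b := a1) haa1.le
    (hβc.mono (Icc_subset_Icc_right (by linarith)))
    (hβi.mono (Icc_subset_Icc_right (by linarith))) (m := β a) (by
      rw [← hA (Icc a a1) (Icc_subset_Icc_right (by linarith)), image_inter_aux h.emb.injective,
        ← image_singleton, ← hA {a} (by simp; linarith)]
      congr 2
      ext x
      simp only [mem_inter_iff, mem_union, mem_compl_iff, mem_Ioo, mem_Icc, mem_singleton_iff]
      constructor
      · rintro ⟨h1 | h1, h2⟩
        · by_contra hne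
          exact h1 ⟨lt_of_le_of_ne h2.1 (Ne.symm hne), by linarith⟩
        · linarith
      · rintro rfl
        exact ⟨Or.inl (by simp), le_rfl, haa1.le⟩) (g := g') (by
      intro x hx1 hx2
      apply hg'
      rw [← hA (Icc a a1) (Icc_subset_Icc_right (by linarith))] at hx2
      rintro ⟨s, hs, hsx⟩
      by_cases hs1 : s ∈ Icc a a1
      · exact hx2 ⟨s, hs1, hsx⟩
      · refine hx1 ⟨s, ?_, hsx⟩
        simp only [mem_union, mem_compl_iff, mem_Ioo, mem_Icc] at hs hs1 ⊢
        grind)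
  obtain ⟨r2, hr2, hr2'⟩ := strip (A1 := e ⁻¹' (γ '' (Ioo a b)ᶜ))
    (hcl _ isOpen_Ioo.isClosed_compl) (β := β) (a := b1) (b := b) hbb1.le
    (hβc.mono (Icc_subset_Icc_left (by linarith)))
    (hβi.mono (Icc_subset_Icc_left (by linarith))) (m := β b) (by
      rw [← hA (Icc b1 b) (Icc_subset_Icc_left (by linarith)), image_inter_aux h.emb.injective,
        ← image_singleton, ← hA {b} (by simp; linarith)]
      congr 2
      ext x
      simp only [mem_inter_iff, mem_compl_iff, mem_Ioo, mem_Icc, mem_singleton_iff]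
      constructor
      · rintro ⟨h1, h2⟩
        by_contra hne
        exact h1 ⟨by linarith, lt_of_le_of_ne h2.2 hne⟩
      · rintro rfl
        exact ⟨by simp, hbb1.le, le_rfl⟩) (g := r1) (by
      intro x hx1 hx2
      apply hr1
      rw [← hA (Icc b1 b) (Icc_subset_Icc_left (by linarith))] at hx2
      rw [image_union, preimage_union]
      rintro (h1 | h1)
      exacts [hx1 h1, hx2 h1])
  refine ext_of he (hβ s ⟨hs.1.le, hs.2.le⟩) (r := r2) (hr2 _ ?_) ?_
  · rintro ⟨s', hs', h'⟩
    rw [hβ s ⟨hs.1.le, hs.2.le⟩] at h'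
    exact hs' (h.emb.injective h' ▸ hs)
  · intro z hz
    have hnot : ∀ T : Set ℝ, z ∉ e ⁻¹' (γ '' T) := by
      rintro T ⟨s, -, hs⟩
      exact hz ⟨s, hs⟩
    rw [hr2' z (hnot _), hr1' z (hnot _)]
    · simp only [g', if_neg hz]
    · rw [← hA (Icc a a1) (Icc_subset_Icc_right (by linarith))]; exact hnot _
    · rw [← hA (Icc b1 b) (Icc_subset_Icc_left (by linarith))]; exact hnot _

theorem PLine.ext_two (hc : HasCharts S) (h : PLine U γ) {g1 g2 : S → ZMod 2}
    (hg1 : ∀ x ∈ U, x ∉ range γ → LCst g1 x) (hg2 : ∀ x ∈ U, x ∉ range γ → LCst g2 x) :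
    ∃ g, (g = g1 ∨ g = g2 ∨ g = g1 + g2) ∧ ∃ t, Ext γ g t := by
  obtain ⟨e, β, a, b, he, hr, hat, htb, hβ, hβc, hβi, hA, hcl⟩ := h.chart hc 0
  have hsub : Icc 0 b ⊆ Icc a b := Icc_subset_Icc_left hat.le
  have hK : ∀ z, e z ∈ range γ ↔ z ∈ e ⁻¹' (γ '' univ) := by intro z; rw [image_univ]; rfl
  have hlc : ∀ g : S → ZMod 2, (∀ x ∈ U, x ∉ range γ → LCst g x) →
      ∀ x, x ∉ e ⁻¹' (γ '' (Ioo 0 b)ᶜ) → x ∉ β '' Icc 0 b → LCst (g ∘ e) x := by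
    intro g hg x h1 h2
    refine (hg (e x) (hr (mem_range_self x)) ?_).pb he.continuous.continuousAt
    rintro ⟨s, hs⟩
    by_cases hsI : s ∈ Ioo 0 b
    · apply h2
      rw [← hA _ hsub]
      exact ⟨s, ⟨hsI.1.le, hsI.2.le⟩, hs⟩
    · exact h1 ⟨s, hsI, hs⟩
  have h0 : (0 : ℝ) ∈ Icc a b := ⟨hat.le, htb.le⟩
  have hb : b ∈ Icc a b := ⟨by linarith, le_rfl⟩
  obtain ⟨g, hgo, r, hr1, hr2⟩ := strip_two (A1 := e ⁻¹' (γ '' (Ioo 0 b)ᶜ))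
    (hcl _ isOpen_Ioo.isClosed_compl) htb.le (hβc.mono hsub) (hβi.mono hsub)
    (m := β 0) (n := β b) (fun h' => htb.ne (hβi h0 hb h')) (by
      rw [← hA _ hsub, image_inter_aux h.emb.injective, ← image_pair,
        ← hA {0, b} (by rintro x (rfl | rfl) <;> assumption)]
      congr 2
      ext x
      simp only [mem_inter_iff, mem_compl_iff, mem_Ioo, mem_Icc, mem_insert_iff, mem_singleton_iff]
      grind) (hlc g1 hg1) (hlc g2 hg2)
  have hfin : ∀ k : S → ZMod 2, g = k ∘ e → Ext γ k (b / 2) := by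
    rintro k rfl
    have hs : b / 2 ∈ Ioo 0 b := ⟨by linarith, by linarith⟩
    have hs' : b / 2 ∈ Icc a b := hsub ⟨hs.1.le, hs.2.le⟩
    refine ext_of he (hβ _ hs') (r := r) (hr1 _ ?_) ?_
    · rintro ⟨s', hs'', h'⟩
      rw [hβ _ hs'] at h'
      exact hs'' (h.emb.injective h' ▸ hs)
    · intro z hz
      have hnot : ∀ T : Set ℝ, z ∉ e ⁻¹' (γ '' T) := by
        rintro T ⟨s, -, hs⟩
        exact hz ⟨s, hs⟩
      rw [hr2 z (hnot _)]
      · rfl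
      · rw [← hA _ hsub]; exact hnot _
  rcases hgo with rfl | rfl | rfl
  · exact ⟨g1, Or.inl rfl, _, hfin g1 rfl⟩
  · exact ⟨g2, Or.inr (Or.inl rfl), _, hfin g2 rfl⟩
  · exact ⟨g1 + g2, Or.inr (Or.inr rfl), _, hfin (g1 + g2) rfl⟩

theorem PLine.ext_const (hc : HasCharts S) (h : PLine U γ) (hU : IsPreconnected U)
    {g : S → ZMod 2} (hg : ∀ x ∈ U, x ∉ range γ → LCst g x) (he : ∃ t, Ext γ g t)
    {x y : S} (hx : x ∈ U) (hxK : x ∉ range γ) (hy : y ∈ U) (hyK : y ∉ range γ) : g x = g y := by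
  classical
  have hall : ∀ t, Ext γ g t := by
    have : IsClopen {t | Ext γ g t} := by
      constructor
      · rw [← isOpen_compl_iff, isOpen_iff_mem_nhds]
        intro t ht
        obtain ⟨a, b, h1, h2, h3⟩ := h.ext_loc hc hg t
        filter_upwards [Ioo_mem_nhds h1 h2] with s hs hs'
        exact ht (h3 s hs hs' t ⟨h1, h2⟩)
      · rw [isOpen_iff_mem_nhds]
        intro t ht
        obtain ⟨a, b, h1, h2, h3⟩ := h.ext_loc hc hg t
        filter_upwards [Ioo_mem_nhds h1 h2] with s hs using h3 t ⟨h1, h2⟩ ht s hs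
    intro t
    have h2 := this.eq_univ he
    exact (h2 ▸ mem_univ t : t ∈ {t | Ext γ g t})
  have hG : ∀ z : S, ∃ c : ZMod 2, (z ∈ range γ → ∀ᶠ y in 𝓝 z, y ∉ range γ → g y = c) ∧
      (z ∉ range γ → c = g z) := by
    intro z
    by_cases hz : z ∈ range γ
    · obtain ⟨t, rfl⟩ := hz
      obtain ⟨c, hc'⟩ := hall t
      exact ⟨c, fun _ => hc', fun h => absurd ⟨t, rfl⟩ h⟩
    · exact ⟨g z, fun h => absurd h hz, fun _ => rfl⟩
  choose G hG1 hG2 using hG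
  rw [← hG2 x hxK, ← hG2 y hyK]
  refine lcst_pre hU (h := G) (fun z hz => ?_) hx hy
  by_cases hzK : z ∈ range γ
  · obtain ⟨N, hN, hNo, hzN⟩ := _root_.mem_nhds_iff.1 (hG1 z hzK)
    filter_upwards [hNo.mem_nhds hzN] with w hw
    by_cases hwK : w ∈ range γ
    · obtain ⟨N', hN', hNo', hwN'⟩ := _root_.mem_nhds_iff.1 (hG1 w hwK)
      obtain ⟨v, hv, hvK⟩ := h.no_int hc (hNo.inter hNo') ⟨hw, hwN'⟩
      rw [← hN hv.1 hvK, ← hN' hv.2 hvK]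
    · rw [hG2 w hwK]
      exact hN hw hwK
  · refine (hg z hz hzK).congr ?_
    filter_upwards [h.open'.mem_nhds ⟨hz, hzK⟩] with w hw
    exact (hG2 w hw.2).symm

open Classical in
theorem ind_lcst (hc : HasCharts S) {O : Set S} (hO : IsOpen O) (x : S) {y : S} (hy : y ∈ O) :
    LCst (fun z => if z ∈ connectedComponentIn O x then (1 : ZMod 2) else 0) y := by
  have := hc.locConn
  filter_upwards [hO.connectedComponentIn.mem_nhds (mem_connectedComponentIn hy)] with z hz
  by_cases h : y ∈ connectedComponentIn O x
  · rw [connectedComponentIn_eq h, if_pos hz, if_pos (mem_connectedComponentIn hy)]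
  · rw [if_neg h, if_neg]
    intro h'
    apply h
    rw [connectedComponentIn_eq h', ← connectedComponentIn_eq hz]
    exact mem_connectedComponentIn hy

open Classical in
/-- Every side of the line has the line in its closure. -/
theorem PLine.closure_side (hc : HasCharts S) (h : PLine U γ) (hU : IsPreconnected U) {x : S}
    (hx : x ∈ U \ range γ) : range γ ⊆ closure (connectedComponentIn (U \ range γ) x) := by
  rintro _ ⟨t, rfl⟩
  by_contra hcon
  have hn := isClosed_closure.isOpen_compl.mem_nhds hcon
  have hex : Ext γ (fun z => if z ∈ connectedComponentIn (U \ range γ) x then (1 : ZMod 2) else 0)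
      t := by
    refine ⟨0, ?_⟩
    filter_upwards [hn] with y hy _
    exact if_neg (fun h' => hy (subset_closure h'))
  obtain ⟨v, hv, hvK⟩ := h.no_int hc (isClosed_closure.isOpen_compl.inter h.op) (x := γ t)
    ⟨hcon, h.sub ⟨t, rfl⟩⟩
  have := h.ext_const hc hU (fun y hy hyK => ind_lcst hc h.open' x ⟨hy, hyK⟩) ⟨t, hex⟩ hx.1 hx.2
    hv.2 hvK
  rw [if_pos (mem_connectedComponentIn hx), if_neg (fun h' => hv.1 (subset_closure h'))] at this
  exact one_ne_zero this

open Classical in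
/-- There are at most two sides. -/
theorem PLine.two_sides (hc : HasCharts S) (h : PLine U γ) (hU : IsPreconnected U) {x y z : S}
    (hx : x ∈ U \ range γ) (hy : y ∈ U \ range γ) (hz : z ∈ U \ range γ)
    (hxy : y ∉ connectedComponentIn (U \ range γ) x) :
    z ∈ connectedComponentIn (U \ range γ) x ∨ z ∈ connectedComponentIn (U \ range γ) y := by
  by_contra hcon
  push Not at hcon
  have hyx : x ∉ connectedComponentIn (U \ range γ) y := by
    intro h'
    apply hxy
    rw [← connectedComponentIn_eq h']
    exact mem_connectedComponentIn hy
  let g1 : S → ZMod 2 := fun w => if w ∈ connectedComponentIn (U \ range γ) x then 1 else 0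
  let g2 : S → ZMod 2 := fun w => if w ∈ connectedComponentIn (U \ range γ) y then 1 else 0
  have l1 : ∀ w ∈ U, w ∉ range γ → LCst g1 w := fun w a b => ind_lcst hc h.open' x ⟨a, b⟩
  have l2 : ∀ w ∈ U, w ∉ range γ → LCst g2 w := fun w a b => ind_lcst hc h.open' y ⟨a, b⟩
  have e1 : g1 x = 1 := if_pos (mem_connectedComponentIn hx)
  have e2 : g1 y = 0 := if_neg hxy
  have e3 : g1 z = 0 := if_neg hcon.1
  have e4 : g2 x = 0 := if_neg hyx
  have e5 : g2 y = 1 := if_pos (mem_connectedComponentIn hy)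
  have e6 : g2 z = 0 := if_neg hcon.2
  obtain ⟨g, hgo, hex⟩ := h.ext_two hc l1 l2
  have hgl : ∀ w ∈ U, w ∉ range γ → LCst g w := by
    rcases hgo with rfl | rfl | rfl
    exacts [l1, l2, fun w a b => (l1 w a b).add (l2 w a b)]
  have c1 := h.ext_const hc hU hgl hex hx.1 hx.2 hz.1 hz.2
  have c2 := h.ext_const hc hU hgl hex hy.1 hy.2 hz.1 hz.2
  rcases hgo with rfl | rfl | rfl
  · rw [e1, e3] at c1; exact one_ne_zero c1
  · rw [e5, e6] at c2; exact one_ne_zero c2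
  · simp only [Pi.add_apply, e1, e3, e4, e6] at c1
    revert c1; decide

/-- Comparison with the interval model. -/
theorem exists_homeo_Ioo : Nonempty (ℝ ≃ₜ Ioo (0 : ℝ) 1) := by
  have h1 : ℝ ≃ₜ ball (0 : ℝ) 1 := Homeomorph.unitBall
  have h2 : (affineHomeomorph (1 / 2 : ℝ) (1 / 2) (by norm_num)) '' ball (0 : ℝ) 1 = Ioo 0 1 := by
    ext x
    simp only [affineHomeomorph_apply, mem_image, mem_ball, dist_zero_right, Real.norm_eq_abs,
      abs_lt, mem_Ioo]
    constructor
    · rintro ⟨y, hy, rfl⟩; constructor <;> linarith [hy.1, hy.2]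
    · rintro ⟨h, h'⟩; exact ⟨2 * x - 1, ⟨by linarith, by linarith⟩, by ring⟩
  exact ⟨h1.trans (((affineHomeomorph (1 / 2 : ℝ) (1 / 2) (by norm_num)).image _).trans
    (Homeomorph.setCongr h2))⟩

theorem PLine.of_crosscut (hU : IsOpen U) {K : Set S} (hK : IsGenCrosscut U K) :
    ∃ γ, PLine U γ ∧ range γ = K := by
  obtain ⟨hKU, ⟨φ⟩, hcl⟩ := hK
  obtain ⟨ψ⟩ := exists_homeo_Ioo
  have hr : range (fun t => (φ.symm (ψ t) : S)) = K := by
    have : (fun t => (φ.symm (ψ t) : S)) = Subtype.val ∘ (ψ.trans φ.symm) := rfl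
    rw [this, range_comp, (ψ.trans φ.symm).surjective.range_eq, image_univ, Subtype.range_coe]
  refine ⟨fun t => (φ.symm (ψ t) : S), ⟨hU, ?_, by rw [hr]; exact hKU, ?_⟩, hr⟩
  · exact IsEmbedding.subtypeVal.comp (ψ.trans φ.symm).isEmbedding
  · rw [hr]
    intro x hx hxc
    by_contra hxK
    have := hcl ⟨hxc, hxK⟩
    rw [hU.frontier_eq] at this
    exact this.2 hx

theorem PLine.crosscut (h : PLine U γ) : IsGenCrosscut U (range γ) := by
  obtain ⟨ψ⟩ := exists_homeo_Ioo
  refine ⟨h.sub, ⟨h.emb.toHomeomorph.symm.trans ψ⟩, fun x hx => ?_⟩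
  rw [h.op.frontier_eq]
  exact ⟨closure_mono h.sub hx.1, fun hxU => hx.2 (h.cl x hxU hx.1)⟩

end SL
end DP

namespace DP

section Ends
variable {S : Type*} [MetricSpace S] {U : Set S} {γ : ℝ → S}

theorem PLine.neg (h : PLine U γ) : PLine U (fun t => γ (-t)) := by
  have hr : range (fun t => γ (-t)) = range γ := (Equiv.neg ℝ).surjective.range_comp γ
  exact ⟨h.op, h.emb.comp (Homeomorph.neg ℝ).isEmbedding, hr ▸ h.sub, hr ▸ h.cl⟩

theorem PLine.range_neg (γ : ℝ → S) : range (fun t => γ (-t)) = range γ :=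
  (Equiv.neg ℝ).surjective.range_comp γ

theorem PLine.end_frontier (h : PLine U γ) {p : S} (hp : MapClusterPt p atTop γ) :
    p ∈ closure (range γ) ∧ p ∉ U ∧ p ∈ frontier U := by
  have h1 : p ∈ closure (range γ) := by
    rw [_root_.mem_closure_iff_nhds]
    intro t ht
    obtain ⟨s, hs⟩ := (hp.frequently ht).exists
    exact ⟨γ s, hs, s, rfl⟩
  have h2 : p ∉ U := by
    intro hpU
    obtain ⟨s, rfl⟩ := h.cl p hpU h1
    have h3 : Iio (s + 1) ∈ 𝓝 s := Iio_mem_nhds (by linarith)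
    rw [h.emb.isInducing.nhds_eq_comap, mem_comap] at h3
    obtain ⟨O, hO, hOs⟩ := h3
    obtain ⟨t, ht, ht'⟩ := ((hp.frequently hO).and_eventually (eventually_ge_atTop (s + 1))).exists
    have := hOs ht
    simp only [mem_Iio] at this
    linarith
  refine ⟨h1, h2, ?_⟩
  rw [h.op.frontier_eq]
  exact ⟨closure_mono h.sub h1, h2⟩

theorem PLine.tail [CompactSpace S] (h : PLine U γ) {G1 G2 : Set S} (h1 : IsOpen G1)
    (h2 : IsOpen G2) (hd : Disjoint G1 G2) (hN : closure (range γ) ∩ frontier U ⊆ G1 ∪ G2)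
    {p : S} (hp : MapClusterPt p atTop γ) (hpG : p ∈ G1) : ∃ k, ∀ t, k ≤ t → γ t ∈ G1 := by
  have h3 : ∀ᶠ t in atTop, γ t ∈ G1 ∪ G2 := by
    by_contra hcon
    have hfr : ∃ᶠ t in atTop, γ t ∈ (G1 ∪ G2)ᶜ := by
      rw [not_eventually] at hcon; exact hcon
    have hcpt : IsCompact (G1 ∪ G2)ᶜ := (h1.union h2).isClosed_compl.isCompact
    obtain ⟨q, hq, hcl⟩ := hcpt.exists_mapClusterPt_of_frequently hfr
    obtain ⟨a, -, b⟩ := h.end_frontier hcl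
    exact hq (hN ⟨a, b⟩)
  obtain ⟨k, hk⟩ := eventually_atTop.1 h3
  refine ⟨k, fun t ht => ?_⟩
  have hpre : IsPreconnected (γ '' Ici k) := isPreconnected_Ici.image _ h.emb.continuous.continuousOn
  have hsub : γ '' Ici k ⊆ G1 ∪ G2 := by rintro _ ⟨s, hs, rfl⟩; exact hk s hs
  refine hpre.subset_left_of_subset_union h1 h2 hd hsub ?_ ⟨t, ht, rfl⟩
  obtain ⟨s, hs, hs'⟩ := ((hp.frequently (h1.mem_nhds hpG)).and_eventually
    (eventually_ge_atTop k)).exists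
  exact ⟨γ s, ⟨s, hs', rfl⟩, hs⟩

open Classical in
/-- A shadow of a simple domain cannot be split with both ends on one side. -/
theorem PLine.no_split [CompactSpace S] (hc : HasCharts S) (h : PLine U γ) (hUc : IsConnected U)
    (hUc' : IsConnected Uᶜ) (hs : Simp U) {x : S} (hx : x ∈ U \ range γ) {G1 G2 : Set S}
    (h1 : IsOpen G1) (h2 : IsOpen G2) (hd : Disjoint G1 G2)
    (hN : closure (connectedComponentIn (U \ range γ) x) ∩ frontier U ⊆ G1 ∪ G2)
    {p q : S} (hp : MapClusterPt p atTop γ) (hq : MapClusterPt q atTop (fun t => γ (-t)))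
    (hpG : p ∈ G1) (hqG : q ∈ G1) :
    closure (connectedComponentIn (U \ range γ) x) ∩ frontier U ∩ G2 = ∅ := by
  have := hc.locConn
  set V := connectedComponentIn (U \ range γ) x with hV
  have hVo : IsOpen V := h.open'.connectedComponentIn
  have hVU : V ⊆ U \ range γ := connectedComponentIn_subset _ _
  have hKV : range γ ⊆ closure V := h.closure_side hc hUc.isPreconnected hx
  have hKV' : closure (range γ) ⊆ closure V := closure_minimal hKV isClosed_closure
  obtain ⟨k1, hk1⟩ := h.tail h1 h2 hd (fun y hy => hN ⟨hKV' hy.1, hy.2⟩) hp hpG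
  obtain ⟨k2, hk2⟩ := h.neg.tail h1 h2 hd (fun y hy => by
    rw [PLine.range_neg] at hy
    exact hN ⟨hKV' hy.1, hy.2⟩) hq hqG
  let C : Set S := (closure V \ (G1 ∪ G2)) ∪ γ '' Icc (-k2) k1
  have hC : IsCompact C := by
    refine IsCompact.union ?_ (isCompact_Icc.image h.emb.continuous)
    exact (isClosed_closure.inter (h1.union h2).isClosed_compl).isCompact
  have hCU : C ⊆ U := by
    rintro y (hy | ⟨s, hs, rfl⟩)
    · by_contra hyU
      apply hy.2
      apply hN
      refine ⟨hy.1, ?_⟩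
      rw [h.op.frontier_eq]
      exact ⟨closure_mono (hVU.trans sdiff_subset) hy.1, hyU⟩
    · exact h.sub ⟨s, rfl⟩
  have hKG : ∀ y ∈ range γ, y ∉ C → y ∈ G1 := by
    rintro _ ⟨s, rfl⟩ hy
    by_cases a : k1 ≤ s
    · exact hk1 s a
    by_cases b : k2 ≤ -s
    · have := hk2 (-s) b
      rwa [neg_neg] at this
    · exact absurd (Or.inr ⟨s, ⟨by linarith, by linarith⟩, rfl⟩) hy
  have hVcl : ∀ y ∈ U \ range γ, y ∈ closure V → y ∈ V := by
    intro y hy hyV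
    obtain ⟨w, hw1, hw2⟩ := _root_.mem_closure_iff.1 hyV _ h.open'.connectedComponentIn
      (mem_connectedComponentIn hy)
    rw [hV, connectedComponentIn_eq hw2, ← connectedComponentIn_eq hw1]
    exact mem_connectedComponentIn hy
  let g : S → ZMod 2 := fun y => if y ∈ V ∧ y ∈ G2 then 1 else 0
  have hg : ∀ y ∈ U, y ∉ C → LCst g y := by
    intro y hyU hyC
    by_cases hyV : y ∈ closure V
    · have hyN : y ∈ G1 ∪ G2 := by
        by_contra hyN
        exact hyC (Or.inl ⟨hyV, hyN⟩)
      rcases hyN with hy1 | hy2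
      · refine (lcst_const 0 y).congr ?_
        filter_upwards [h1.mem_nhds hy1] with w hw
        exact (if_neg (fun h' => disjoint_left.1 hd hw h'.2)).symm
      · have hyK : y ∉ range γ := fun h' => disjoint_left.1 hd (hKG y h' hyC) hy2
        refine (lcst_const 1 y).congr ?_
        filter_upwards [hVo.mem_nhds (hVcl y ⟨hyU, hyK⟩ hyV), h2.mem_nhds hy2] with w hw hw'
        exact (if_pos ⟨hw, hw'⟩).symm
    · refine (lcst_const 0 y).congr ?_
      filter_upwards [isClosed_closure.isOpen_compl.mem_nhds hyV] with w hw
      exact (if_neg (fun h' => hw (subset_closure h'.1))).symm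
  obtain ⟨c, hcc⟩ := one_ended h.op hUc hUc' hs hC hCU hg
  have val : ∀ y, y ∉ U → y ∈ closure V → ∀ G : Set S, IsOpen G → y ∈ G → ∃ w ∈ G, w ∈ V ∧ g w = c := by
    intro y hyU hyV G hG hyG
    obtain ⟨O, hO, hOo, hyO⟩ := _root_.mem_nhds_iff.1 (hcc y hyU)
    obtain ⟨w, hw, hwV⟩ := _root_.mem_closure_iff.1 hyV _ (hOo.inter hG) ⟨hyO, hyG⟩
    exact ⟨w, hw.2, hwV, hO hw.1 (hVU hwV).1⟩
  obtain ⟨a, b, -⟩ := h.end_frontier hp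
  obtain ⟨w, hw1, hw2, hw3⟩ := val p b (hKV' a) G1 h1 hpG
  have c0 : c = 0 := by
    rw [← hw3]
    exact if_neg (fun h' => disjoint_left.1 hd hw1 h'.2)
  rw [eq_empty_iff_forall_notMem]
  rintro y ⟨⟨hy1, hy2⟩, hy3⟩
  rw [h.op.frontier_eq] at hy2
  obtain ⟨w, hw1, hw2, hw3⟩ := val y hy2.2 hy1 G2 h2 hy3
  have c1 : c = 1 := by
    rw [← hw3]
    exact if_pos ⟨hw2, hw1⟩
  rw [c0] at c1
  exact zero_ne_one c1

end Ends

section Ultra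
variable {S : Type*} [MetricSpace S] [CompactSpace S]

/-- Ultrafilter limit of sets. -/
def uLim (𝓤 : Ultrafilter ℕ) (T : ℕ → Set S) : Set S :=
  {x | ∀ O : Set S, IsOpen O → x ∈ O → ∀ᶠ n in 𝓤, (T n ∩ O).Nonempty}

theorem not_uLim {𝓤 : Ultrafilter ℕ} {T : ℕ → Set S} {x : S} (hx : x ∉ uLim 𝓤 T) :
    ∃ O : Set S, IsOpen O ∧ x ∈ O ∧ ∀ᶠ n in 𝓤, T n ∩ O = ∅ := by
  simp only [uLim, mem_ofPred_eq] at hx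
  push Not at hx
  obtain ⟨O, hO, hxO, h⟩ := hx
  exact ⟨O, hO, hxO, h⟩

theorem uLim_closed (𝓤 : Ultrafilter ℕ) (T : ℕ → Set S) : IsClosed (uLim 𝓤 T) := by
  rw [← isOpen_compl_iff, isOpen_iff_mem_nhds]
  intro x hx
  obtain ⟨O, hO, hxO, h⟩ := not_uLim hx
  filter_upwards [hO.mem_nhds hxO] with y hy hy'
  obtain ⟨n, h1, h2⟩ := ((hy' O hO hy).and h).exists
  rw [h2] at h1
  exact not_nonempty_empty h1

theorem uLim_nhds {𝓤 : Ultrafilter ℕ} {T : ℕ → Set S} {G : Set S} (hG : IsOpen G)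
    (h : uLim 𝓤 T ⊆ G) : ∀ᶠ n in 𝓤, T n ⊆ G := by
  have hcpt : IsCompact Gᶜ := hG.isClosed_compl.isCompact
  have h1 : ∀ x ∈ Gᶜ, ∃ O : Set S, IsOpen O ∧ x ∈ O ∧ ∀ᶠ n in 𝓤, T n ∩ O = ∅ :=
    fun x hx => not_uLim (fun h' => hx (h h'))
  choose! O hO hxO hT using h1
  obtain ⟨t, ht, htc⟩ := hcpt.elim_nhds_subcover O (fun x hx => (hO x hx).mem_nhds (hxO x hx))
  filter_upwards [(eventually_all_finset t).2 (fun x hx => hT x (ht x hx))] with n hn y hy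
  by_contra hyG
  have := htc hyG
  simp only [mem_iUnion] at this
  obtain ⟨i, hi, hyi⟩ := this
  have h2 : y ∈ T n ∩ O i := ⟨hy, hyi⟩
  rw [hn i hi] at h2
  exact h2

theorem uLim_dense {𝓤 : Ultrafilter ℕ} {T : ℕ → Set S} {X : Set S} (hX : IsCompact X)
    (h : X ⊆ uLim 𝓤 T) {ε : ℝ} (hε : 0 < ε) : ∀ᶠ n in 𝓤, ∀ x ∈ X, ∃ y ∈ T n, dist x y < ε := by
  obtain ⟨t, ht, htc⟩ := hX.elim_nhds_subcover (fun x => ball x (ε / 2))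
    (fun x _ => ball_mem_nhds x (by linarith))
  have h1 : ∀ x ∈ t, ∀ᶠ n in 𝓤, (T n ∩ ball x (ε / 2)).Nonempty := fun x hx =>
    h (ht x hx) _ isOpen_ball (mem_ball_self (by linarith))
  filter_upwards [(eventually_all_finset t).2 h1] with n hn x hx
  have := htc hx
  simp only [mem_iUnion] at this
  obtain ⟨i, hi, hxi⟩ := this
  obtain ⟨y, hy, hyi⟩ := hn i hi
  refine ⟨y, hy, ?_⟩
  calc dist x y ≤ dist x i + dist i y := dist_triangle _ _ _
    _ < ε := by rw [mem_ball] at hxi hyi; rw [dist_comm i y]; linarith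

theorem uLim_union {𝓤 : Ultrafilter ℕ} {T T' : ℕ → Set S} {X : Set S}
    (h : ∀ ε > 0, ∀ᶠ n in 𝓤, ∀ x ∈ X, ∃ y ∈ T n ∪ T' n, dist x y < ε) :
    X ⊆ uLim 𝓤 T ∪ uLim 𝓤 T' := by
  intro x hx
  by_contra hcon
  rw [mem_union, not_or] at hcon
  obtain ⟨O, hO, hxO, h1⟩ := not_uLim hcon.1
  obtain ⟨O', hO', hxO', h2⟩ := not_uLim hcon.2
  obtain ⟨ε, hε, hb⟩ := Metric.isOpen_iff.1 (hO.inter hO') x ⟨hxO, hxO'⟩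
  obtain ⟨n, ⟨a, b⟩, c⟩ := ((h1.and h2).and (h ε hε)).exists
  obtain ⟨y, hy, hxy⟩ := c x hx
  have hyb : y ∈ O ∩ O' := hb (by rwa [mem_ball, dist_comm])
  rcases hy with hy | hy
  · exact (a ▸ (⟨hy, hyb.1⟩ : y ∈ T n ∩ O) : y ∈ (∅ : Set S))
  · exact (b ▸ (⟨hy, hyb.2⟩ : y ∈ T' n ∩ O') : y ∈ (∅ : Set S))

theorem uLim_sub {𝓤 : Ultrafilter ℕ} {T : ℕ → Set S} {X : Set S} (hX : IsClosed X)
    (h : ∀ᶠ n in 𝓤, T n ⊆ X) : uLim 𝓤 T ⊆ X := by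
  intro x hx
  by_contra hxX
  obtain ⟨n, ⟨y, hy1, hy2⟩, h2⟩ := ((hx _ hX.isOpen_compl hxX).and h).exists
  exact hy2 (h2 hy1)

/-- Covering a compact set by two components. -/
theorem comp_cover {L : Set S} (hL : IsClosed L) {p q : S} (hp : p ∈ L) (hq : q ∈ L)
    (hns : ∀ L1 L2 : Set S, IsClosed L1 → IsClosed L2 → Disjoint L1 L2 → L1 ∪ L2 = L →
      p ∈ L1 → q ∈ L1 → L2 = ∅) :
    L = connectedComponentIn L p ∪ connectedComponentIn L q := by
  refine Subset.antisymm ?_ (union_subset (connectedComponentIn_subset _ _)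
    (connectedComponentIn_subset _ _))
  intro x hx
  by_contra hcon
  rw [mem_union, not_or] at hcon
  have : CompactSpace L := isCompact_iff_compactSpace.1 hL.isCompact
  have key : ∀ y : L, x ∉ connectedComponentIn L (y : S) → ∃ Z : Set L, IsClopen Z ∧
      (⟨x, hx⟩ : L) ∈ Z ∧ y ∉ Z := by
    intro y hy
    have h1 : y ∉ connectedComponent (⟨x, hx⟩ : L) := by
      intro h2
      apply hy
      rw [connectedComponentIn_eq_image y.2]
      refine ⟨⟨x, hx⟩, ?_, rfl⟩
      have := connectedComponent_eq h2
      rw [Subtype.coe_eta, ← this]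
      exact mem_connectedComponent
    rw [connectedComponent_eq_iInter_isClopen, mem_iInter] at h1
    push Not at h1
    obtain ⟨⟨Z, hZ⟩, hyZ⟩ := h1
    exact ⟨Z, hZ.1, hZ.2, hyZ⟩
  obtain ⟨Z1, a1, b1, c1⟩ := key ⟨p, hp⟩ hcon.1
  obtain ⟨Z2, a2, b2, c2⟩ := key ⟨q, hq⟩ hcon.2
  have hcl := a1.inter a2
  have hemp := hns (Subtype.val '' (Z1 ∩ Z2)ᶜ) (Subtype.val '' (Z1 ∩ Z2))
    (hL.isClosedEmbedding_subtypeVal.isClosedMap _ hcl.compl.1)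
    (hL.isClosedEmbedding_subtypeVal.isClosedMap _ hcl.1)
    ((disjoint_image_iff Subtype.val_injective).2 disjoint_compl_left)
    (by rw [← image_union, compl_union_self, image_univ, Subtype.range_coe])
    ⟨⟨p, hp⟩, fun h => c1 h.1, rfl⟩ ⟨⟨q, hq⟩, fun h => c2 h.2, rfl⟩
  have hmem : x ∈ Subtype.val '' (Z1 ∩ Z2) := ⟨⟨x, hx⟩, ⟨b1, b2⟩, rfl⟩
  rw [hemp] at hmem
  exact hmem

end Ultra
end DP

namespace DP

section Dense
variable {S : Type*} [MetricSpace S]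

theorem cc_closed {L : Set S} (hL : IsClosed L) (p : S) :
    IsClosed (connectedComponentIn L p) := by
  by_cases hp : p ∈ L
  · refine isClosed_of_closure_subset ?_
    refine (isPreconnected_connectedComponentIn.closure).subset_connectedComponentIn
      (subset_closure (mem_connectedComponentIn hp)) ?_
    exact closure_minimal (connectedComponentIn_subset _ _) hL
  · rw [connectedComponentIn_eq_empty hp]; exact isClosed_empty

theorem indec {X : Set S} (h : ¬ IsDecomposable X) {A B : Set S} (hA : IsClosed A)
    (hB : IsClosed B) (hAc : IsConnected A) (hBc : IsConnected B) (hAB : A ∪ B = X) :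
    A = X ∨ B = X := by
  by_contra hc
  push Not at hc
  exact h ⟨A, B, ⟨hAc.nonempty, hA, hAc, hAB ▸ subset_union_left, hc.1⟩,
    ⟨hBc.nonempty, hB, hBc, hAB ▸ subset_union_right, hc.2⟩, hAB⟩

theorem PLine.sides_cover {U : Set S} {γ : ℝ → S} (hc : HasCharts S) (h : PLine U γ)
    (hU : IsConnected U) : ∃ x ∈ U \ range γ, ∃ y ∈ U \ range γ,
    frontier U ⊆ closure (connectedComponentIn (U \ range γ) x) ∪
      closure (connectedComponentIn (U \ range γ) y) := by
  obtain ⟨u, hu⟩ := hU.nonempty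
  obtain ⟨x, hxU, hxγ⟩ := h.no_int hc h.op hu
  have hx : x ∈ U \ range γ := ⟨hxU, hxγ⟩
  have fin : ∀ y ∈ U \ range γ, (∀ z ∈ U \ range γ, z ∈ connectedComponentIn (U \ range γ) x ∨
      z ∈ connectedComponentIn (U \ range γ) y) → frontier U ⊆
      closure (connectedComponentIn (U \ range γ) x) ∪
      closure (connectedComponentIn (U \ range γ) y) := by
    intro y hy H
    refine frontier_subset_closure.trans ?_
    refine closure_minimal ?_ (isClosed_closure.union isClosed_closure)
    intro z hz
    by_cases hzγ : z ∈ range γ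
    · exact Or.inl (h.closure_side hc hU.isPreconnected hx hzγ)
    · rcases H z ⟨hz, hzγ⟩ with h1 | h1
      · exact Or.inl (subset_closure h1)
      · exact Or.inr (subset_closure h1)
  by_cases H : ∃ y ∈ U \ range γ, y ∉ connectedComponentIn (U \ range γ) x
  · obtain ⟨y, hy, hxy⟩ := H
    exact ⟨x, hx, y, hy, fin y hy fun z hz => h.two_sides hc hU.isPreconnected hx hy hz hxy⟩
  · push Not at H
    exact ⟨x, hx, x, hx, fin x hx fun z hz => Or.inl (H z hz)⟩

variable [CompactSpace S]

theorem side_lim (hc : HasCharts S) {𝓤 : Ultrafilter ℕ} {U : ℕ → Set S} {γ : ℕ → ℝ → S}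
    {x p q : ℕ → S} {P Q : S} (h : ∀ n, PLine (U n) (γ n)) (hU : ∀ n, IsConnected (U n))
    (hU' : ∀ n, IsConnected (U n)ᶜ) (hs : ∀ᶠ n in 𝓤, Simp (U n))
    (hx : ∀ n, x n ∈ U n \ range (γ n)) (hp : ∀ n, MapClusterPt (p n) atTop (γ n))
    (hq : ∀ n, MapClusterPt (q n) atTop (fun t => γ n (-t)))
    (hP : Tendsto p 𝓤 (𝓝 P)) (hQ : Tendsto q 𝓤 (𝓝 Q)) {L : Set S}
    (hL : L = uLim 𝓤 (fun n => closure (connectedComponentIn (U n \ range (γ n)) (x n)) ∩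
      frontier (U n))) :
    P ∈ L ∧ Q ∈ L ∧ L = connectedComponentIn L P ∪ connectedComponentIn L Q := by
  have hLc : IsClosed L := hL ▸ uLim_closed _ _
  have mem : ∀ (r : ℕ → S), (∀ n, r n ∈ closure (range (γ n)) ∧ r n ∈ frontier (U n)) →
      ∀ R, Tendsto r 𝓤 (𝓝 R) → R ∈ L := by
    intro r hr R hR
    rw [hL]
    intro O hO hRO
    filter_upwards [hR (hO.mem_nhds hRO)] with n hn
    exact ⟨r n, ⟨closure_minimal ((h n).closure_side hc (hU n).isPreconnected (hx n))
      isClosed_closure (hr n).1, (hr n).2⟩, hn⟩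
  have hPL : P ∈ L := mem p (fun n => ⟨((h n).end_frontier (hp n)).1,
    ((h n).end_frontier (hp n)).2.2⟩) P hP
  have hQL : Q ∈ L := mem q (fun n => by
    have := (h n).neg.end_frontier (hq n)
    rw [PLine.range_neg] at this
    exact ⟨this.1, this.2.2⟩) Q hQ
  refine ⟨hPL, hQL, comp_cover hLc hPL hQL ?_⟩
  intro L1 L2 h1 h2 hd hun hp1 hq1
  obtain ⟨G1, G2, hG1, hG2, hL1, hL2, hG⟩ := normal_separation h1 h2 hd
  have hsub : L ⊆ G1 ∪ G2 := hun ▸ union_subset_union hL1 hL2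
  rw [hL] at hsub
  have e1 := uLim_nhds (hG1.union hG2) hsub
  by_contra hne
  obtain ⟨z, hz⟩ := nonempty_iff_ne_empty.2 hne
  have hzL : z ∈ L := hun ▸ Or.inr hz
  rw [hL] at hzL
  have e2 := hzL G2 hG2 (hL2 hz)
  obtain ⟨n, n1, n2, n3, n4, n5⟩ := (e1.and (e2.and (hs.and
    ((hP.eventually (hG1.mem_nhds (hL1 hp1))).and (hQ.eventually (hG1.mem_nhds (hL1 hq1))))))).exists
  have := (h n).no_split hc (hU n) (hU' n) n3 (hx n) hG1 hG2 hG n1 (hp n) (hq n) n4 n5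
  rw [this] at n2
  exact not_nonempty_empty n2

variable [ConnectedSpace S]

theorem finite_often {X : Set S} (hc : HasCharts S) (hX : IsClosed X)
    (hsh : IsShielded X) {U : ℕ → Set S}
    (hU : ∀ n, IsComplementaryDomain X (U n))
    (hd : ∀ ε > 0, ∀ᶠ n in atTop, ∀ x ∈ X, ∃ y ∈ frontier (U n), dist x y < ε)
    (V : Set S) : ∀ᶠ n in atTop, U n ≠ V := by
  by_cases hV : IsComplementaryDomain X V
  · have h1 := hsh V hV
    have h2 := dom_frontier hc hX hV
    obtain ⟨x, hx, hxV⟩ : ∃ x ∈ X, x ∉ frontier V := by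
      by_contra hcon
      push Not at hcon
      exact h1 (Subset.antisymm h2 hcon)
    have : IsClosed (frontier V) := isClosed_frontier
    obtain ⟨ε, hε, hb⟩ := Metric.isOpen_iff.1 this.isOpen_compl x hxV
    filter_upwards [hd ε hε] with n hn e
    obtain ⟨y, hy, hxy⟩ := hn x hx
    rw [e] at hy
    exact hb (by rwa [mem_ball, dist_comm]) hy
  · exact Eventually.of_forall fun n e => hV (e ▸ hU n)

theorem ev_simp {X : Set S} (hc : HasCharts S) (hX : IsClosed X) (hXc : IsConnected X)
    (hsh : IsShielded X) {U : ℕ → Set S}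
    (hU : ∀ n, IsComplementaryDomain X (U n))
    (hd : ∀ ε > 0, ∀ᶠ n in atTop, ∀ x ∈ X, ∃ y ∈ frontier (U n), dist x y < ε) :
    ∀ᶠ n in atTop, Simp (U n) := by
  have hf := simp_fin hc hX hXc
  have := (eventually_all_finite hf).2 (fun V _ => finite_often hc hX hsh hU hd V)
  filter_upwards [this] with n hn
  by_contra h
  exact hn (U n) ⟨hU n, h⟩ rfl

theorem shadow_dense {X : Set S} (hc : HasCharts S) (hX : IsClosed X) (hXc : IsConnected X)
    (hsh : IsShielded X) (hind : ¬ IsDecomposable X) {U K : ℕ → Set S}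
    (hU : ∀ n, IsComplementaryDomain X (U n)) (hK : ∀ n, IsGenCrosscut (U n) (K n))
    (hd : ∀ ε > 0, ∀ᶠ n in atTop, ∀ x ∈ X, ∃ y ∈ frontier (U n), dist x y < ε)
    {ε : ℝ} (hε : 0 < ε) :
    ∀ᶠ n in atTop, ∃ T, IsShadowOf (U n) (K n) T ∧ ∀ x ∈ X, ∃ y ∈ T, dist x y < ε := by
  by_contra hbad
  rw [Filter.not_eventually] at hbad
  obtain ⟨𝓤, h𝓤⟩ := Ultrafilter.exists_le (f := atTop ⊓ 𝓟 {n | ¬ ∃ T, IsShadowOf (U n) (K n) T ∧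
    ∀ x ∈ X, ∃ y ∈ T, dist x y < ε}) (h := frequently_mem_iff_neBot.1 hbad)
  have hat : (𝓤 : Filter ℕ) ≤ atTop := h𝓤.trans inf_le_left
  have hB : ∀ᶠ n in 𝓤, ¬ ∃ T, IsShadowOf (U n) (K n) T ∧ ∀ x ∈ X, ∃ y ∈ T, dist x y < ε :=
    (h𝓤.trans inf_le_right) (mem_principal_self _)
  choose γ hγ hγK using fun n => PLine.of_crosscut (dom_open hc hX (hU n)) (hK n)
  have hUc : ∀ n, IsConnected (U n) := fun n => dom_conn (hU n)
  have hUc' : ∀ n, IsConnected (U n)ᶜ := fun n => dom_compl_conn hc hX hXc (hU n)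
  choose x hx y hy hxy using fun n => (hγ n).sides_cover hc (hUc n)
  have e1 : ∀ n, ∃ p, MapClusterPt p atTop (γ n) := fun n => by
    obtain ⟨p, _, hp⟩ := (isCompact_univ (X := S)).exists_mapClusterPt (f := atTop) (u := γ n)
      (by simp)
    exact ⟨p, hp⟩
  have e2 : ∀ n, ∃ p, MapClusterPt p atTop (fun t => γ n (-t)) := fun n => by
    obtain ⟨p, _, hp⟩ := (isCompact_univ (X := S)).exists_mapClusterPt (f := atTop)
      (u := fun t => γ n (-t)) (by simp)
    exact ⟨p, hp⟩
  choose p hp using e1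
  choose q hq using e2
  have lim : ∀ r : ℕ → S, ∃ R, Tendsto r 𝓤 (𝓝 R) := fun r => by
    obtain ⟨R, _, hR⟩ := (isCompact_univ (X := S)).ultrafilter_le_nhds (𝓤.map r) (by simp)
    exact ⟨R, hR⟩
  obtain ⟨P, hP⟩ := lim p
  obtain ⟨Q, hQ⟩ := lim q
  have hs := (ev_simp hc hX hXc hsh hU hd).filter_mono hat
  obtain ⟨a1, a2, a3⟩ := side_lim hc hγ hUc hUc' hs hx hp hq hP hQ rfl
  obtain ⟨b1, b2, b3⟩ := side_lim hc hγ hUc hUc' hs hy hp hq hP hQ rfl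
  set TV := (fun n => closure (connectedComponentIn (U n \ range (γ n)) (x n)) ∩ frontier (U n))
    with hTV
  set TW := (fun n => closure (connectedComponentIn (U n \ range (γ n)) (y n)) ∩ frontier (U n))
    with hTW
  have hcov : X ⊆ uLim 𝓤 TV ∪ uLim 𝓤 TW := by
    refine uLim_union fun δ hδ => ?_
    filter_upwards [(hd δ hδ).filter_mono hat] with n hn z hz
    obtain ⟨w, hw, hzw⟩ := hn z hz
    refine ⟨w, ?_, hzw⟩
    rcases hxy n hw with h1 | h1
    · exact Or.inl ⟨h1, hw⟩
    · exact Or.inr ⟨h1, hw⟩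
  have hVX : uLim 𝓤 TV ⊆ X := uLim_sub hX (Eventually.of_forall fun n =>
    inter_subset_right.trans (dom_frontier hc hX (hU n)))
  have hWX : uLim 𝓤 TW ⊆ X := uLim_sub hX (Eventually.of_forall fun n =>
    inter_subset_right.trans (dom_frontier hc hX (hU n)))
  have cV := uLim_closed 𝓤 TV
  have cW := uLim_closed 𝓤 TW
  set LV := uLim 𝓤 TV
  set LW := uLim 𝓤 TW
  have con : ∀ {L : Set S} {r : S}, r ∈ L → IsConnected (connectedComponentIn L r) :=
    fun h => isConnected_connectedComponentIn_iff.2 h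
  have hun : (connectedComponentIn LV P ∪ connectedComponentIn LW P) ∪
      (connectedComponentIn LV Q ∪ connectedComponentIn LW Q) = X := by
    rw [union_union_union_comm, ← a3, ← b3]
    exact Subset.antisymm (union_subset hVX hWX) hcov
  have key : X ⊆ LV ∨ X ⊆ LW := by
    have two : ∀ R, R ∈ LV → R ∈ LW →
        connectedComponentIn LV R ∪ connectedComponentIn LW R = X → X ⊆ LV ∨ X ⊆ LW := by
      intro R hV hW he
      rcases indec hind (cc_closed cV R) (cc_closed cW R) (con hV) (con hW) he with h | h
      · left; rw [← h]; exact connectedComponentIn_subset _ _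
      · right; rw [← h]; exact connectedComponentIn_subset _ _
    rcases indec hind ((cc_closed cV P).union (cc_closed cW P))
      ((cc_closed cV Q).union (cc_closed cW Q))
      (IsConnected.union ⟨P, mem_connectedComponentIn a1, mem_connectedComponentIn b1⟩
        (con a1) (con b1))
      (IsConnected.union ⟨Q, mem_connectedComponentIn a2, mem_connectedComponentIn b2⟩
        (con a2) (con b2)) hun with h | h
    · exact two P a1 b1 h
    · exact two Q a2 b2 h
  rcases key with h | h
  · obtain ⟨n, n1, n2⟩ := ((uLim_dense hX.isCompact h hε).and hB).exists
    exact n2 ⟨TV n, ⟨x n, hγK n ▸ hx n, by rw [hTV, ← hγK n]⟩, n1⟩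
  · obtain ⟨n, n1, n2⟩ := ((uLim_dense hX.isCompact h hε).and hB).exists
    exact n2 ⟨TW n, ⟨y n, hγK n ▸ hy n, by rw [hTW, ← hγK n]⟩, n1⟩

theorem dp_of_dense {X : Set S} (hc : HasCharts S) (hX : IsClosed X) (hXc : IsConnected X)
    (hsh : IsShielded X) (hind : ¬ IsDecomposable X) {U : ℕ → Set S}
    (hU : ∀ n, IsComplementaryDomain X (U n))
    (hd : ∀ ε > 0, ∀ᶠ n in atTop, ∀ x ∈ X, ∃ y ∈ frontier (U n), dist x y < ε) :
    DoublePassCondition X U := by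
  intro K hK
  have hne : ∀ n, ∃ T, IsShadowOf (U n) (K n) T := fun n => by
    obtain ⟨γ, hγ, hγK⟩ := PLine.of_crosscut (dom_open hc hX (hU n)) (hK n)
    obtain ⟨x, hx, -⟩ := hγ.sides_cover hc (dom_conn (hU n))
    exact ⟨_, x, hγK ▸ hx, rfl⟩
  set D : ℕ → Set ℝ := fun n => (fun T => hausdorffDist T X) '' {T | IsShadowOf (U n) (K n) T}
    with hD
  have hbd : ∀ n, BddBelow (D n) := fun n => ⟨0, by
    rintro _ ⟨T, _, rfl⟩; exact hausdorffDist_nonneg⟩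
  have hch : ∀ n : ℕ, ∃ T, IsShadowOf (U n) (K n) T ∧
      hausdorffDist T X < sInf (D n) + 1 / ((n : ℝ) + 1) := fun n => by
    obtain ⟨T0, hT0⟩ := hne n
    obtain ⟨_, ⟨T, hT, rfl⟩, h⟩ := exists_lt_of_csInf_lt (s := D n) ⟨_, T0, hT0, rfl⟩
      (lt_add_of_pos_right (sInf (D n)) (show (0:ℝ) < 1 / ((n : ℝ) + 1) by positivity))
    exact ⟨T, hT, h⟩
  choose Sh hSh hlt using hch
  refine ⟨Sh, hSh, ?_⟩
  rw [HausdorffConvergesTo, Metric.tendsto_atTop']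
  intro ε hε
  have h1 := shadow_dense hc hX hXc hsh hind hU hK hd (half_pos hε)
  have h2 : ∀ᶠ n : ℕ in atTop, 1 / ((n : ℝ) + 1) < ε / 2 :=
    tendsto_one_div_add_atTop_nhds_zero_nat.eventually (gt_mem_nhds (half_pos hε))
  obtain ⟨N, hN⟩ := eventually_atTop.1 (h1.and h2)
  refine ⟨N, fun n hn => ?_⟩
  obtain ⟨⟨T, hT, hTd⟩, h3⟩ := hN n hn.le
  have h4 : hausdorffDist T X ≤ ε / 2 := by
    refine hausdorffDist_le_of_mem_dist (half_pos hε).le (fun x hx => ⟨x, ?_, ?_⟩)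
      (fun x hx => ?_)
    · obtain ⟨z, hz, rfl⟩ := hT
      exact dom_frontier hc hX (hU n) hx.2
    · rw [dist_self]; positivity
    · obtain ⟨y, hy, h⟩ := hTd x hx
      exact ⟨y, hy, h.le⟩
  have h5 : sInf (D n) ≤ ε / 2 := (csInf_le (hbd n) ⟨T, hT, rfl⟩).trans h4
  rw [Real.dist_eq, sub_zero, abs_of_nonneg hausdorffDist_nonneg]
  linarith [hlt n]

end Dense
end DP

namespace DP

section Cont
variable {S : Type*} [MetricSpace S] [CompactSpace S]

theorem clopen_sep {L C : Set S} (hL : IsClosed L) (hC : IsClosed C) {p : S} (hp : p ∈ L)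
    (hd : Disjoint C (connectedComponentIn L p)) :
    ∃ Z1 Z2 : Set S, IsClosed Z1 ∧ IsClosed Z2 ∧ Disjoint Z1 Z2 ∧ Z1 ∪ Z2 = L ∧ p ∈ Z1 ∧
      Disjoint C Z1 := by
  classical
  have : CompactSpace L := isCompact_iff_compactSpace.1 hL.isCompact
  have key : ∀ y : L, (y : S) ∈ C → ∃ Z : Set L, IsClopen Z ∧
      (⟨p, hp⟩ : L) ∈ Z ∧ y ∉ Z := by
    intro y hy
    have h1 : y ∉ connectedComponent (⟨p, hp⟩ : L) := by
      intro h2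
      refine disjoint_left.1 hd hy ?_
      rw [connectedComponentIn_eq_image hp]
      exact ⟨y, h2, rfl⟩
    rw [connectedComponent_eq_iInter_isClopen, mem_iInter] at h1
    push Not at h1
    obtain ⟨⟨Z, hZ⟩, hyZ⟩ := h1
    exact ⟨Z, hZ.1, hZ.2, hyZ⟩
  choose! Z hZ hpZ hyZ using key
  have hK : IsCompact ((Subtype.val : L → S) ⁻¹' C) :=
    (hC.preimage continuous_subtype_val).isCompact
  obtain ⟨t, ht, htc⟩ := hK.elim_nhds_subcover (fun y => (Z y)ᶜ) (fun y hy =>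
    (hZ y hy).compl.isOpen.mem_nhds (hyZ y hy))
  set W : Set L := ⋂ y ∈ t, Z y with hW
  have hWc : IsClopen W := by
    rw [hW]
    exact isClopen_biInter_finset (fun y hy => hZ y (ht y hy))
  refine ⟨Subtype.val '' W, Subtype.val '' Wᶜ,
    hL.isClosedEmbedding_subtypeVal.isClosedMap _ hWc.1,
    hL.isClosedEmbedding_subtypeVal.isClosedMap _ hWc.compl.1,
    (disjoint_image_iff Subtype.val_injective).2 disjoint_compl_right,
    (by rw [← image_union, union_compl_self, image_univ, Subtype.range_coe]),
    ⟨⟨p, hp⟩, mem_iInter₂.2 fun y hy => hpZ y (ht y hy), rfl⟩, ?_⟩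
  rw [disjoint_left]
  rintro _ hyC ⟨y, hyW, rfl⟩
  have := htc hyC
  simp only [mem_iUnion] at this
  obtain ⟨i, hi, h⟩ := this
  exact h (mem_iInter₂.1 hyW i hi)

/-- Boundary bumping. -/
theorem bump {X D : Set S} (hX : IsClosed X) (hXc : IsConnected X) (hD : IsOpen D) {p : S}
    (hp : p ∈ X \ D) (hXD : (X ∩ D).Nonempty) :
    (connectedComponentIn (X \ D) p ∩ closure D).Nonempty := by
  by_contra hne
  rw [not_nonempty_iff_eq_empty, inter_comm] at hne
  have hL : IsClosed (X \ D) := hX.sdiff hD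
  obtain ⟨Z1, Z2, c1, c2, hd, hun, hp1, hdC⟩ := clopen_sep hL (isClosed_closure (s := D)) hp
    (disjoint_iff_inter_eq_empty.2 hne)
  have := (isPreconnected_iff_subset_of_fully_disjoint_closed hX).1 hXc.isPreconnected
    Z1 (Z2 ∪ (X ∩ closure D)) c1 (c2.union (hX.inter isClosed_closure))
    (by
      intro x hx
      by_cases hxD : x ∈ D
      · exact Or.inr (Or.inr ⟨hx, subset_closure hxD⟩)
      · have : x ∈ Z1 ∪ Z2 := hun ▸ ⟨hx, hxD⟩
        rcases this with h | h
        · exact Or.inl h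
        · exact Or.inr (Or.inl h))
    (by
      rw [disjoint_union_right]
      exact ⟨hd, (hdC.symm).mono_right inter_subset_right⟩)
  rcases this with h | h
  · obtain ⟨x, hx, hxD⟩ := hXD
    have : x ∈ X \ D := hun ▸ Or.inl (h hx)
    exact this.2 hxD
  · rcases h hp.1 with h' | h'
    · exact disjoint_left.1 hd hp1 h'
    · exact disjoint_left.1 hdC h'.2 hp1

theorem conn_add {X K u v : Set S} (hX : IsClosed X) (hXc : IsConnected X) (hK : IsClosed K)
    (hKc : IsConnected K) (hKX : K ⊆ X) (hu : IsOpen u) (hv : IsOpen v)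
    (hc : X \ K ⊆ u ∪ v) (hd : (X \ K) ∩ (u ∩ v) = ∅) :
    IsClosed (K ∪ (X \ v)) ∧ IsConnected (K ∪ (X \ v)) := by
  have hcl : IsClosed (K ∪ (X \ v)) := hK.union (hX.sdiff hv)
  refine ⟨hcl, hKc.nonempty.mono subset_union_left, ?_⟩
  have main : ∀ t t' : Set S, IsClosed t → IsClosed t' → (K ∪ (X \ v)) ⊆ t ∪ t' →
      Disjoint t t' → K ⊆ t → K ∪ (X \ v) ⊆ t := by
    intro t t' ht ht' hM hdis hKt
    have := (isPreconnected_iff_subset_of_fully_disjoint_closed hX).1 hXc.isPreconnected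
      (((K ∪ (X \ v)) ∩ t) ∪ (K ∪ (X \ u))) ((K ∪ (X \ v)) ∩ t')
      ((hcl.inter ht).union (hK.union (hX.sdiff hu))) (hcl.inter ht') ?_ ?_
    · rcases this with h | h
      · intro x hx
        rcases hM hx with h1 | h1
        · exact h1
        · exfalso
          have hxX : x ∈ X := by
            rcases hx with h2 | h2
            exacts [hKX h2, h2.1]
          have hxK : x ∉ K := fun h2 => disjoint_left.1 hdis (hKt h2) h1
          rcases h hxX with h3 | h3 | h3
          · exact disjoint_left.1 hdis h3.2 h1
          · exact hxK h3
          · rcases hx with h4 | h4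
            · exact hxK h4
            · rcases hc ⟨hxX, hxK⟩ with h5 | h5
              · exact h3.2 h5
              · exact h4.2 h5
      · exfalso
        obtain ⟨k, hk⟩ := hKc.nonempty
        exact disjoint_left.1 hdis (hKt hk) (h (hKX hk)).2
    · intro x hx
      by_cases hxK : x ∈ K
      · exact Or.inl (Or.inr (Or.inl hxK))
      · by_cases hxu : x ∈ u
        · have hxv : x ∉ v := fun hv' => by
            have : x ∈ (X \ K) ∩ (u ∩ v) := ⟨⟨hx, hxK⟩, hxu, hv'⟩
            rw [hd] at this; exact this
          have hxM : x ∈ K ∪ (X \ v) := Or.inr ⟨hx, hxv⟩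
          rcases hM hxM with h | h
          · exact Or.inl (Or.inl ⟨hxM, h⟩)
          · exact Or.inr ⟨hxM, h⟩
        · exact Or.inl (Or.inr (Or.inr ⟨hx, hxu⟩))
    · rw [disjoint_left]
      rintro x (h | h | h) ⟨h1, h2⟩
      · exact disjoint_left.1 hdis h.2 h2
      · exact disjoint_left.1 hdis (hKt h) h2
      · rcases h1 with h3 | h3
        · exact disjoint_left.1 hdis (hKt h3) h2
        · by_cases hxK : x ∈ K
          · exact disjoint_left.1 hdis (hKt hxK) h2
          · rcases hc ⟨h.1, hxK⟩ with h5 | h5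
            · exact h.2 h5
            · exact h3.2 h5
  rw [isPreconnected_iff_subset_of_fully_disjoint_closed hcl]
  intro t t' ht ht' hM hdis
  rcases (isPreconnected_iff_subset_of_fully_disjoint_closed hK).1 hKc.isPreconnected t t' ht ht'
    (subset_union_left.trans hM) hdis with h | h
  · exact Or.inl (main t t' ht ht' hM hdis h)
  · exact Or.inr (main t' t ht' ht (by rwa [union_comm t']) hdis.symm h)

/-- Proper subcontinua of indecomposable continua are nowhere dense. -/
theorem sub_dense {X K : Set S} (hX : IsClosed X) (hXc : IsConnected X)
    (hind : ¬ IsDecomposable X) (hK : IsClosed K) (hKc : IsConnected K) (hKX : K ⊆ X)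
    (hne : K ≠ X) : X ⊆ closure (X \ K) := by
  by_cases hcon : IsPreconnected (X \ K)
  · have hnon : (X \ K).Nonempty := by
      rw [nonempty_iff_ne_empty]
      intro h
      exact hne (Subset.antisymm hKX (sdiff_eq_empty.1 h))
    have hun : K ∪ closure (X \ K) = X := by
      refine Subset.antisymm (union_subset hKX (closure_minimal sdiff_subset hX)) ?_
      intro x hx
      by_cases hxK : x ∈ K
      · exact Or.inl hxK
      · exact Or.inr (subset_closure ⟨hx, hxK⟩)
    rcases indec hind hK isClosed_closure hKc ⟨hnon.closure, hcon.closure⟩ hun with h | h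
    · exact absurd h hne
    · exact h.symm.subset
  · exfalso
    unfold IsPreconnected at hcon
    push Not at hcon
    obtain ⟨u, v, hu, hv, hc, ⟨a, ha, hau⟩, ⟨b, hb, hbv⟩, hd⟩ := hcon
    obtain ⟨c1, c2⟩ := conn_add hX hXc hK hKc hKX hu hv hc hd
    obtain ⟨d1, d2⟩ := conn_add hX hXc hK hKc hKX hv hu (by rwa [union_comm])
      (by rwa [inter_comm v u])
    have hun : (K ∪ (X \ v)) ∪ (K ∪ (X \ u)) = X := by
      refine Subset.antisymm (union_subset (union_subset hKX sdiff_subset)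
        (union_subset hKX sdiff_subset)) ?_
      intro x hx
      by_cases hxK : x ∈ K
      · exact Or.inl (Or.inl hxK)
      · by_cases hxu : x ∈ u
        · have hxv : x ∉ v := fun hv' => by
            have : x ∈ (X \ K) ∩ (u ∩ v) := ⟨⟨hx, hxK⟩, hxu, hv'⟩
            rw [hd] at this; exact this
          exact Or.inl (Or.inr ⟨hx, hxv⟩)
        · exact Or.inr (Or.inr ⟨hx, hxu⟩)
    rcases indec hind c1 d1 c2 d2 hun with h | h
    · have : b ∈ K ∪ (X \ v) := h.symm.subset hb.1
      rcases this with h | h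
      exacts [hb.2 h, h.2 hbv]
    · have : a ∈ K ∪ (X \ u) := h.symm.subset ha.1
      rcases this with h | h
      exacts [ha.2 h, h.2 hau]

/-- A proper subcontinuum through a point meeting finitely many open sets. -/
theorem exists_sub {X : Set S} (hX : IsClosed X) (hXc : IsConnected X) (hXn : X.Nontrivial)
    (hind : ¬ IsDecomposable X) {ι : Type*} (s : Finset ι) (D : ι → Set S)
    (hD : ∀ i, IsOpen (D i)) (hXD : ∀ i, (X ∩ D i).Nonempty) {p : S} (hp : p ∈ X) :
    ∃ C, IsClosed C ∧ IsConnected C ∧ C ⊆ X ∧ C ≠ X ∧ p ∈ C ∧ ∀ i ∈ s, (C ∩ D i).Nonempty := by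
  classical
  induction s using Finset.induction_on with
  | empty =>
    refine ⟨{p}, isClosed_singleton, isConnected_singleton, by simpa using hp, ?_, rfl, by simp⟩
    intro h
    rw [← h] at hXn
    exact not_nontrivial_singleton hXn
  | insert i s his ih =>
    obtain ⟨C, h1, h2, h3, h4, h5, h6⟩ := ih
    have one : ∃ C', IsClosed C' ∧ IsConnected C' ∧ C' ⊆ X ∧ C' ≠ X ∧ p ∈ C' ∧
        (C' ∩ D i).Nonempty := by
      by_cases hpD : p ∈ D i
      · refine ⟨{p}, isClosed_singleton, isConnected_singleton, by simpa using hp, ?_, rfl,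
          ⟨p, rfl, hpD⟩⟩
        intro h
        rw [← h] at hXn
        exact not_nontrivial_singleton hXn
      · obtain ⟨x, hxX, hxD⟩ := hXD i
        obtain ⟨δ, hδ, hb⟩ := Metric.nhds_basis_closedBall.mem_iff.1 ((hD i).mem_nhds hxD)
        have hpL : p ∈ X \ ball x δ := ⟨hp, fun h => hpD (hb (ball_subset_closedBall h))⟩
        obtain ⟨y, hy1, hy2⟩ := bump hX hXc isOpen_ball hpL ⟨x, hxX, mem_ball_self hδ⟩
        refine ⟨connectedComponentIn (X \ ball x δ) p, cc_closed (hX.sdiff isOpen_ball) p,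
          isConnected_connectedComponentIn_iff.2 hpL,
          (connectedComponentIn_subset _ _).trans sdiff_subset, ?_,
          mem_connectedComponentIn hpL, ⟨y, hy1, hb (closure_ball_subset_closedBall hy2)⟩⟩
        intro h
        have : x ∈ connectedComponentIn (X \ ball x δ) p := h.symm.subset hxX
        exact (connectedComponentIn_subset _ _ this).2 (mem_ball_self hδ)
    obtain ⟨C', k1, k2, k3, k4, k5, k6⟩ := one
    refine ⟨C ∪ C', h1.union k1, IsConnected.union ⟨p, h5, k5⟩ h2 k2, union_subset h3 k3, ?_,
      Or.inl h5, ?_⟩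
    · intro h
      rcases indec hind h1 k1 h2 k2 h with h | h
      exacts [h4 h, k4 h]
    · intro j hj
      rw [Finset.mem_insert] at hj
      rcases hj with rfl | hj
      · exact k6.mono (inter_subset_inter_left _ subset_union_right)
      · exact (h6 j hj).mono (inter_subset_inter_left _ subset_union_left)

/-- Baire pigeonhole. -/
theorem many_comps (hc : HasCharts S) {X : Set S} (hX : IsClosed X) (hXc : IsConnected X)
    (hXn : X.Nontrivial) (hind : ¬ IsDecomposable X) {ι : Type*} [Finite ι] (D : ι → Set S)
    (hD : ∀ i, IsOpen (D i)) (hXD : ∀ i, (X ∩ D i).Nonempty) {z : S} (hz : z ∈ X)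
    (hzD : ∀ i, z ∉ closure (D i)) :
    ∃ e : ℂ → S, IsOpenEmbedding e ∧ e 0 ∈ X ∧ (∀ i, Disjoint (range e) (D i)) ∧
      ((fun p => connectedComponentIn (X \ e '' ball 0 (1/2)) p) ''
        {p | p ∈ X \ e '' ball 0 1 ∧ ∀ i,
          (connectedComponentIn (X \ e '' ball 0 1) p ∩ D i).Nonempty}).Infinite := by
  classical
  have := Fintype.ofFinite ι
  by_contra hcon
  push Not at hcon
  obtain ⟨b, hbc, -, hb⟩ := TopologicalSpace.exists_countable_basis S
  set Z : Set S := (⋃ i, closure (D i))ᶜ with hZ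
  have hZo : IsOpen Z := (isClosed_iUnion_of_finite fun i => isClosed_closure).isOpen_compl
  have hzZ : z ∈ Z := by simpa [hZ] using hzD
  have hch : ∀ B : Set S, ∃ e : ℂ → S, B ∈ b → (X ∩ (B ∩ Z)).Nonempty →
      IsOpenEmbedding e ∧ e 0 ∈ X ∧ range e ⊆ B ∩ Z := by
    intro B
    by_cases h : B ∈ b ∧ (X ∩ (B ∩ Z)).Nonempty
    · obtain ⟨hB, x, hx, hxB⟩ := h
      obtain ⟨e, he, h0, hr⟩ := hc x (B ∩ Z) ((hb.isOpen hB).inter hZo) hxB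
      exact ⟨e, fun _ _ => ⟨he, h0 ▸ hx, hr⟩⟩
    · exact ⟨fun _ => z, fun h1 h2 => absurd ⟨h1, h2⟩ h⟩
  choose e he using hch
  set b' : Set (Set S) := {B ∈ b | (X ∩ (B ∩ Z)).Nonempty} with hb'
  have hb'c : b'.Countable := hbc.mono (sep_subset _ _)
  set F : Set S → Set (Set S) := fun B =>
    (fun p => connectedComponentIn (X \ e B '' ball 0 (1/2)) p) ''
        {p | p ∈ X \ e B '' ball 0 1 ∧ ∀ i,
          (connectedComponentIn (X \ e B '' ball 0 1) p ∩ D i).Nonempty} with hF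
  have hFfin : ∀ B ∈ b', (F B).Finite := by
    intro B hB
    obtain ⟨h1, h2, h3⟩ := he B hB.1 hB.2
    have := hcon (e B) h1 h2 (fun i => by
      rw [disjoint_left]
      intro x hx hxD
      exact (h3 hx).2 (mem_iUnion.2 ⟨i, subset_closure hxD⟩))
    exact this
  set 𝓖 : Set (Set S) := ⋃ B ∈ b', F B with h𝓖
  have h𝓖c : 𝓖.Countable := hb'c.biUnion fun B hB => (hFfin B hB).countable
  have hG : ∀ K ∈ 𝓖, IsClosed K ∧ X ⊆ closure (X \ K) := by
    intro K hK
    simp only [h𝓖, mem_iUnion] at hK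
    obtain ⟨B, hB, p, ⟨hp, -⟩, rfl⟩ := hK
    obtain ⟨h1, h2, h3⟩ := he B hB.1 hB.2
    have hop : IsOpen (e B '' ball 0 (1/2)) := h1.isOpenMap _ isOpen_ball
    have hp' : p ∈ X \ e B '' ball 0 (1/2) := ⟨hp.1, fun h => hp.2
      (image_mono (ball_subset_ball (by norm_num)) h)⟩
    have hcl := cc_closed (hX.sdiff hop) p
    refine ⟨hcl, sub_dense hX hXc hind hcl (isConnected_connectedComponentIn_iff.2 hp')
      ((connectedComponentIn_subset _ _).trans sdiff_subset) ?_⟩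
    intro h
    have : e B 0 ∈ connectedComponentIn (X \ e B '' ball 0 (1/2)) p := h.symm.subset h2
    exact (connectedComponentIn_subset _ _ this).2 ⟨0, by simp, rfl⟩
  have hcov : ∀ p ∈ X, ∃ K ∈ 𝓖, p ∈ K := by
    intro p hp
    obtain ⟨C, h1, h2, h3, h4, h5, h6⟩ := exists_sub hX hXc hXn hind Finset.univ D hD hXD hp
    obtain ⟨x, hxZ, hx⟩ := _root_.mem_closure_iff.1 (sub_dense hX hXc hind h1 h2 h3 h4 hz) Z hZo hzZ
    obtain ⟨B, hB, hxB, hBC⟩ := hb.exists_subset_of_mem_open hx.2 h1.isOpen_compl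
    have hB' : B ∈ b' := ⟨hB, x, hx.1, hxB, hxZ⟩
    obtain ⟨k1, k2, k3⟩ := he B hB'.1 hB'.2
    have hsub : ∀ r : ℝ, C ⊆ X \ e B '' ball 0 r := fun r y hy => ⟨h3 hy, fun h =>
      hBC (k3 (image_subset_range _ _ h)).1 hy⟩
    refine ⟨connectedComponentIn (X \ e B '' ball 0 (1/2)) p, ?_,
      mem_connectedComponentIn (hsub _ h5)⟩
    simp only [h𝓖, mem_iUnion]
    refine ⟨B, hB', p, ⟨hsub _ h5, fun i => ?_⟩, rfl⟩
    exact (h6 i (Finset.mem_univ i)).mono (inter_subset_inter_left _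
      (h2.isPreconnected.subset_connectedComponentIn h5 (hsub _)))
  -- Baire in the subtype
  have hXcpt : CompactSpace X := isCompact_iff_compactSpace.1 hX.isCompact
  have hXne : Nonempty X := ⟨⟨z, hz⟩⟩
  have : Countable 𝓖 := h𝓖c.to_subtype
  obtain ⟨K, y, hy⟩ := nonempty_interior_of_iUnion_of_closed (X := X)
    (f := fun K : 𝓖 => (Subtype.val : X → S) ⁻¹' (K : Set S))
    (fun K => (hG K K.2).1.preimage continuous_subtype_val)
    (by
      rw [eq_univ_iff_forall]
      intro p
      obtain ⟨K, hK, hpK⟩ := hcov p p.2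
      exact mem_iUnion.2 ⟨⟨K, hK⟩, hpK⟩)
  obtain ⟨O, hO, hOK⟩ := isOpen_induced_iff.1 (isOpen_interior
    (s := (Subtype.val : X → S) ⁻¹' (K : Set S)))
  have hyO : (y : S) ∈ O := by
    have : y ∈ (Subtype.val : X → S) ⁻¹' O := hOK ▸ hy
    exact this
  obtain ⟨w, hwO, hw⟩ := _root_.mem_closure_iff.1 ((hG K K.2).2 y.2) O hO hyO
  have : (⟨w, hw.1⟩ : X) ∈ interior ((Subtype.val : X → S) ⁻¹' (K : Set S)) := hOK ▸ hwO
  have h' := interior_subset this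
  exact hw.2 h'

end Cont
end DP

namespace DP
universe u
section F2
variable {S : Type u} [MetricSpace S]

theorem LCst.sum {ι : Type*} (s : Finset ι) {a : ι → S → ZMod 2} {x : S}
    (h : ∀ i ∈ s, LCst (a i) x) : LCst (∑ i ∈ s, a i) x := by
  classical
  induction s using Finset.induction_on with
  | empty => exact lcst_const 0 x
  | insert i s hi ih =>
    rw [Finset.sum_insert hi]
    exact (h i (Finset.mem_insert_self _ _)).add
      (ih fun j hj => h j (Finset.mem_insert_of_mem hj))

theorem pre_frontier {D U : Set S} (hD : IsPreconnected D) (h1 : (D ∩ U).Nonempty)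
    (h2 : (D \ U).Nonempty) : (D ∩ frontier U).Nonempty := by
  by_contra hne
  rw [not_nonempty_iff_eq_empty] at hne
  obtain ⟨a, ha, haU⟩ := h1
  obtain ⟨b, hb, hbU⟩ := h2
  have key : ∀ x ∈ D, x ∈ interior U ∨ x ∉ closure U := by
    intro x hx
    by_contra h
    push Not at h
    have : x ∈ D ∩ frontier U := ⟨hx, h.2, h.1⟩
    rw [hne] at this
    exact this
  obtain ⟨x, -, h3, h4⟩ := hD (interior U) (closure U)ᶜ isOpen_interior
    isClosed_closure.isOpen_compl key
    ⟨a, ha, (key a ha).resolve_right fun h => h (subset_closure haU)⟩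
    ⟨b, hb, (key b hb).resolve_left fun h => hbU (interior_subset h)⟩
  exact h4 (subset_closure (interior_subset h3))

open Classical in
theorem lcst_ind {G1 G2 : Set S} (h1 : IsOpen G1) (h2 : IsOpen G2) (hd : Disjoint G1 G2)
    {x : S} (hx : x ∈ G1 ∪ G2) : LCst (fun y => if y ∈ G1 then (1 : ZMod 2) else 0) x := by
  rcases hx with hx | hx
  · filter_upwards [h1.mem_nhds hx] with y hy
    simp [hy, hx]
  · filter_upwards [h2.mem_nhds hx] with y hy
    have a1 := disjoint_right.1 hd hy
    have a2 := disjoint_right.1 hd hx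
    simp [a1, a2]

variable [CompactSpace S]

theorem sepfun {Y : Set S} (hY : IsClosed Y) {m : ℕ} (p : Fin m → S) (hp : ∀ i, p i ∈ Y)
    (hd : ∀ i j, i ≠ j → connectedComponentIn Y (p i) ≠ connectedComponentIn Y (p j)) :
    ∃ N : Set S, IsOpen N ∧ Y ⊆ N ∧ ∃ f : Fin m → S → ZMod 2, (∀ k, ∀ x ∈ N, LCst (f k) x) ∧
      ∀ k i, f k (p i) = if i = k then 1 else 0 := by
  classical
  have one : ∀ k, ∃ N : Set S, IsOpen N ∧ Y ⊆ N ∧ ∃ f : S → ZMod 2, (∀ x ∈ N, LCst f x) ∧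
      ∀ i, f (p i) = if i = k then 1 else 0 := by
    intro k
    obtain ⟨Z1, Z2, c1, c2, hdis, hun, hp1, hdC⟩ := clopen_sep hY
      (C := p '' {i | i ≠ k}) ((Set.toFinite _).isClosed) (hp k) (by
        rw [disjoint_left]
        rintro _ ⟨i, hi, rfl⟩ h
        exact hd k i (Ne.symm hi) (connectedComponentIn_eq h))
    obtain ⟨G1, G2, hG1, hG2, hL1, hL2, hG⟩ := normal_separation c1 c2 hdis
    refine ⟨G1 ∪ G2, hG1.union hG2, hun ▸ union_subset_union hL1 hL2,
      fun y => if y ∈ G1 then 1 else 0, fun x hx => lcst_ind hG1 hG2 hG hx, ?_⟩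
    intro i
    by_cases hik : i = k
    · subst hik
      simp [hL1 hp1]
    · have h1 : p i ∉ Z1 := fun h => disjoint_left.1 hdC ⟨i, hik, rfl⟩ h
      have h2 : p i ∈ Z1 ∪ Z2 := hun ▸ hp i
      have h3 : p i ∉ G1 := disjoint_right.1 hG (hL2 (h2.resolve_left h1))
      simp [h3, hik]
  choose N hN hYN f hf hfp using one
  exact ⟨⋂ k, N k, isOpen_iInter_of_finite hN, subset_iInter hYN, f,
    fun k x hx => hf k x (mem_iInter.1 hx k), hfp⟩

theorem no_cover (hc : HasCharts S) {X : Set S} (hX : IsClosed X) (hXc : IsConnected X)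
    {e : ℂ → S} (he : IsOpenEmbedding e) (he0 : e 0 ∈ X) {ι : Type u} [Fintype ι]
    {D O : ι → Set S} (hDc : ∀ i, IsPreconnected (D i)) (hDn : ∀ i, (D i).Nonempty)
    (hDe : ∀ i, Disjoint (range e) (D i)) (hO : ∀ i, IsOpen (O i))
    (hOd : ∀ i j, i ≠ j → Disjoint (O i) (O j)) (hOX : ⋃ i, O i = Xᶜ)
    (hOD : ∀ i, Disjoint (O i) (D i)) :
    ¬ ((fun p => connectedComponentIn (X \ e '' ball 0 (1/2)) p) ''
        {p | p ∈ X \ e '' ball 0 1 ∧ ∀ i,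
          (connectedComponentIn (X \ e '' ball 0 1) p ∩ D i).Nonempty}).Infinite := by
  classical
  intro hinf
  set Y := X \ e '' ball 0 (1/2) with hY
  have hop : ∀ r, IsOpen (e '' ball 0 r) := fun r => he.isOpenMap _ isOpen_ball
  set M : Set S := (e '' ball 0 1)ᶜ with hMdef
  set M' : Set S := (e '' closedBall 0 (1/2))ᶜ with hM'def
  have hM : IsCompact M := (hop 1).isClosed_compl.isCompact
  have hcb : ∀ r, IsCompact (e '' closedBall 0 r) := fun r =>
    (isCompact_closedBall 0 r).image he.continuous
  have hM' : IsOpen M' := (hcb _).isClosed.isOpen_compl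
  have hMM : M ⊆ M' := compl_subset_compl.2 (image_mono (closedBall_subset_ball (by norm_num)))
  obtain ⟨T, hT, Inv, hInv⟩ := fin_inv hc hM hM' hMM
  have hTf : Fintype T := Fintype.ofFinite T
  set m := Fintype.card (ι → T) + 1 with hm
  obtain ⟨emb⟩ : Nonempty (ℕ ↪ _) := ⟨hinf.natEmbedding⟩
  have hch : ∀ k : ℕ, ∃ p, (p ∈ X \ e '' ball 0 1 ∧ ∀ i,
          (connectedComponentIn (X \ e '' ball 0 1) p ∩ D i).Nonempty) ∧
      connectedComponentIn Y p = (emb k : Set S) := by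
    intro k
    obtain ⟨p, hp, h⟩ := (emb k).2
    exact ⟨p, hp, h⟩
  choose p hp hpe using hch
  have hYc : IsClosed Y := hX.sdiff (hop _)
  have hXMY : ∀ x ∈ X, x ∈ M → x ∈ Y := fun x h1 h2 => ⟨h1, fun h => h2
    (image_mono (ball_subset_ball (by norm_num)) h)⟩
  obtain ⟨N, hN, hYN, f, hf, hfp⟩ := sepfun hYc (m := m + 1) (fun i => p i)
    (fun i => hXMY _ (hp i).1.1 (hp i).1.2) (fun i j hij h => by
      rw [hpe, hpe] at h
      exact hij (Fin.ext (emb.injective (Subtype.ext h))))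
  set O1 : ι → Set S := fun i => N ∪ O i with hO1
  set O2 : ι → Set S := fun i => N ∪ ⋃ j ∈ {j | j ≠ i}, O j with hO2
  have hO1o : ∀ i, IsOpen (O1 i) := fun i => hN.union (hO i)
  have hO2o : ∀ i, IsOpen (O2 i) := fun i => hN.union (isOpen_biUnion fun j _ => hO j)
  have hO12 : ∀ i, O1 i ∩ O2 i ⊆ N := by
    rintro i x ⟨h1 | h1, h2 | h2⟩
    · exact h1
    · exact h1
    · exact h2
    · simp only [mem_iUnion] at h2
      obtain ⟨j, hj, h2⟩ := h2
      exact absurd h2 (disjoint_left.1 (hOd i j (Ne.symm hj)) h1)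
  choose F hF1 hF2 _ using fun (i : ι) (k : Fin m) => mv (hO1o i) (hO2o i) (f k.castSucc)
    (fun x hx => hf _ x (hO12 i hx))
  have hcase : ∀ x : S, x ∈ X ∨ ∃ i, x ∈ O i := by
    intro x
    by_cases hx : x ∈ X
    · exact Or.inl hx
    · have : x ∈ ⋃ i, O i := hOX ▸ hx
      exact Or.inr (mem_iUnion.1 this)
  have hFLC : ∀ i k, ∀ x ∈ M', LC (F i k) x := by
    intro i k x hx
    rcases hcase x with h | ⟨j, hj⟩
    · exact (hF1 i k x (Or.inl (hYN ⟨h, fun h' => hx (image_mono ball_subset_closedBall h')⟩))).lc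
    · by_cases hij : j = i
      · subst hij
        exact (hF1 _ k x (Or.inr hj)).lc
      · exact (hF2 i k x (Or.inr (mem_biUnion hij hj))).lc
  obtain ⟨k, l, hkl, hInvE⟩ := Fintype.exists_ne_map_eq_of_card_lt
    (fun (k : Fin m) (i : ι) => Inv (F i k)) (by rw [Fintype.card_fin]; omega)
  have hr : ∀ i, ∃ r, ∀ x ∈ M, Sec (F i k + F i l) r x := fun i =>
    hInv _ _ (hFLC i k) (hFLC i l) (congrFun hInvE i)
  choose r hr using hr
  set g : S → ZMod 2 := f k.castSucc + f l.castSucc with hg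
  have hgN : ∀ x ∈ N, LCst g x := fun x hx => (hf _ x hx).add (hf _ x hx)
  set a : ι → S → ZMod 2 := fun i => r i + fun y => if y ∈ O1 i then g y else 0 with ha
  have hb : ∀ i, ∀ x ∈ M, x ∈ O1 i → LCst (r i) x := by
    intro i x hx h1
    have := (hr i x hx).lcst_add ((hF1 i k x h1).add (hF1 i l x h1))
    simpa using this
  have haL : ∀ i, ∀ x ∈ M, x ∈ O2 i → LCst (a i) x := by
    intro i x hx h1
    have := (hr i x hx).lcst_add ((hF2 i k x h1).add (hF2 i l x h1))
    refine this.congr (Eventually.of_forall fun y => ?_)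
    simp only [ha, hg, Pi.add_apply]
    split_ifs <;> simp
  set G : S → ZMod 2 := g + ∑ i, a i with hG
  have hXN : ∀ x ∈ M, x ∈ X → x ∈ N := fun x h1 h2 => hYN (hXMY x h2 h1)
  have hGM : ∀ x ∈ M, LCst G x := by
    intro x hx
    rcases hcase x with h | ⟨i, hi⟩
    · exact (hgN x (hXN x hx h)).add (LCst.sum _ fun i _ => haL i x hx (Or.inl (hXN x hx h)))
    · have h1 : LCst (r i + ∑ j ∈ Finset.univ.erase i, a j) x := by
        refine (hb i x hx (Or.inr hi)).add (LCst.sum _ fun j hj => haL j x hx (Or.inr ?_))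
        exact mem_biUnion (show i ∈ {i | i ≠ j} from (Finset.ne_of_mem_erase hj).symm) hi
      refine h1.congr ?_
      filter_upwards [(hO i).mem_nhds hi] with y hy
      have h2 : y ∈ O1 i := Or.inr hy
      rw [hG, ← Finset.add_sum_erase _ _ (Finset.mem_univ i)]
      have h3 : a i y = r i y + g y := by simp [ha, h2]
      simp only [Pi.add_apply, h3]
      grind
  -- connectedness
  have hCM : ∀ k, connectedComponentIn (X \ e '' ball 0 1) (p k) ⊆ X ∩ M := fun k x hx =>
    ⟨(connectedComponentIn_subset _ _ hx).1, (connectedComponentIn_subset _ _ hx).2⟩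
  have hsph : IsPreconnected (e '' sphere 0 1) :=
    (isPreconnected_sphere (by rw [Complex.rank_real_complex]; norm_num) 0 1).image _
      he.continuous.continuousOn
  have hsphM : e '' sphere 0 1 ⊆ M := by
    rintro _ ⟨w, hw, rfl⟩ ⟨w', hw', h⟩
    rw [he.injective h] at hw'
    simp at hw hw'
    linarith
  have hG1 : ∀ k, G (p k) = G (e 1) := by
    intro k
    obtain ⟨y, hy1, hy2⟩ := bump hX hXc (hop 1) (hp k).1 ⟨e 0, he0, 0, by simp, rfl⟩
    have hy3 : y ∈ e '' closedBall 0 1 :=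
      closure_minimal (image_mono ball_subset_closedBall) (hcb 1).isClosed hy2
    obtain ⟨w, hw, rfl⟩ := hy3
    have hws : w ∈ sphere (0:ℂ) 1 := by
      have h1 : w ∉ ball (0:ℂ) 1 := fun h => (hCM k hy1).2 ⟨w, h, rfl⟩
      simp at hw h1 ⊢
      linarith
    rw [lcst_pre isPreconnected_connectedComponentIn (fun x hx => hGM x (hCM k hx).2)
      (mem_connectedComponentIn (hp k).1) hy1]
    exact lcst_pre hsph (fun x hx => hGM x (hsphM hx)) ⟨w, hws, rfl⟩ ⟨1, by simp, rfl⟩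
  choose d hd using hDn
  have ha1 : ∀ i k, a i (p k) = a i (d i) := by
    intro i k
    refine lcst_pre (IsPreconnected.union' ((hp k).2 i) isPreconnected_connectedComponentIn
      (hDc i)) (fun x hx => ?_) (Or.inl (mem_connectedComponentIn (hp k).1)) (Or.inr (hd i))
    rcases hx with hx | hx
    · exact haL i x (hCM k hx).2 (Or.inl (hXN x (hCM k hx).2 (hCM k hx).1))
    · have hxM : x ∈ M := fun h => disjoint_right.1 (hDe i) hx (image_subset_range _ _ h)
      refine haL i x hxM ?_
      rcases hcase x with h | ⟨j, hj⟩
      · exact Or.inl (hXN x hxM h)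
      · refine Or.inr (mem_biUnion (show j ∈ {j | j ≠ i} from ?_) hj)
        rintro rfl
        exact disjoint_left.1 (hOD _) hj hx
  have hg1 : ∀ k, g (p k) = G (e 1) + ∑ i, a i (d i) := by
    intro k
    rw [← hG1 k, ← Finset.sum_congr rfl (fun i _ => ha1 i k)]
    simp only [hG, Pi.add_apply, Finset.sum_apply]
    grind
  have e1 := hg1 (k.castSucc : Fin (m+1))
  rw [← hg1 (Fin.last m : Fin (m+1))] at e1
  simp only [hg, Pi.add_apply] at e1
  have q1 := hfp k.castSucc k.castSucc
  have q2 := hfp l.castSucc k.castSucc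
  have q3 := hfp k.castSucc (Fin.last m)
  have q4 := hfp l.castSucc (Fin.last m)
  rw [if_pos rfl] at q1
  rw [if_neg (fun h => hkl (Fin.castSucc_injective _ h))] at q2
  rw [if_neg (Fin.castSucc_lt_last k).ne'] at q3
  rw [if_neg (Fin.castSucc_lt_last l).ne'] at q4
  rw [q1, q2, q3, q4] at e1
  simp at e1

variable [ConnectedSpace S]

theorem exists_dense_dom (hc : HasCharts S) {X : Set S} (hX : IsClosed X) (hXc : IsConnected X)
    (hXn : X.Nontrivial) (hind : ¬ IsDecomposable X) {ε : ℝ} (hε : 0 < ε) :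
    ∃ U, IsComplementaryDomain X U ∧ ∀ x ∈ X, ∃ y ∈ frontier U, dist x y < ε := by
  classical
  obtain ⟨z, hz⟩ := hXc.nonempty
  have hch : ∀ x ∈ X \ {z}, ∃ B : Set S, IsOpen B ∧ x ∈ B ∧ B ⊆ ball x (ε/2) ∧ z ∉ closure B ∧
      IsPreconnected B := by
    intro x hx
    have hxz : 0 < dist x z := dist_pos.2 hx.2
    obtain ⟨B, h1, h2, h3, h4⟩ := hc.conn_nhds (isOpen_ball (x := x)
      (ε := min (ε/2) (dist x z / 2))) (mem_ball_self (by positivity))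
    refine ⟨B, h1, h2, h3.trans (ball_subset_ball (min_le_left _ _)), ?_, h4⟩
    intro h
    have := closure_ball_subset_closedBall (closure_mono h3 h)
    rw [mem_closedBall, dist_comm] at this
    have := this.trans (min_le_right _ _)
    linarith
  choose! B hBo hxB hBε hzB hBc using hch
  have hcov : ∀ x ∈ X, ∃ y ∈ X \ {z}, dist x y < ε / 2 := by
    intro x hx
    by_cases hxz : x = z
    · subst hxz
      have := hXc.isPreconnected.preperfect_of_nontrivial hXn x hx
      rw [accPt_iff_nhds] at this
      obtain ⟨y, ⟨hy1, hy2⟩, hy3⟩ := this _ (ball_mem_nhds x (half_pos hε))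
      exact ⟨y, ⟨hy2, hy3⟩, by rwa [dist_comm]⟩
    · exact ⟨x, ⟨hx, hxz⟩, by rw [dist_self]; positivity⟩
  choose! c hcX hcd using hcov
  obtain ⟨t, htc⟩ := hX.isCompact.elim_nhds_subcover' (fun x hx => ball (c x) (ε/2))
    (fun x hx => isOpen_ball.mem_nhds (hcd x hx))
  set ι := {x // x ∈ t} with hι
  have hcX' : ∀ i : ι, c i.1 ∈ X \ {z} := fun i => hcX _ i.1.2
  set D : ι → Set S := fun i => B (c i.1) with hD
  have hXD : ∀ i, (X ∩ D i).Nonempty := fun i => ⟨c i.1, (hcX' i).1, hxB _ (hcX' i)⟩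
  obtain ⟨e, he, he0, hed, hinf⟩ := many_comps hc hX hXc hXn hind D (fun i => hBo _ (hcX' i))
    hXD hz (fun i => hzB _ (hcX' i))
  have hex : ∃ U, IsComplementaryDomain X U ∧ ∀ i, (U ∩ D i).Nonempty := by
    by_contra hcon
    push Not at hcon
    have hJ : ∀ U : Set S, ∃ i : ι, IsComplementaryDomain X U → U ∩ D i = ∅ := by
      intro U
      by_cases hU : IsComplementaryDomain X U
      · obtain ⟨i, hi⟩ := hcon U hU
        exact ⟨i, fun _ => hi⟩
      · have : Nonempty ι := by
          by_contra hne
          rw [not_nonempty_iff] at hne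
          have := htc hz
          simp only [mem_iUnion] at this
          obtain ⟨x, hx, _⟩ := this
          exact hne.false ⟨x, hx⟩
        exact ⟨this.some, fun h => absurd h hU⟩
    choose J hJ using hJ
    refine no_cover hc hX hXc he he0 (D := D)
      (O := fun i => ⋃ U ∈ {U | IsComplementaryDomain X U ∧ J U = i}, U)
      (fun i => hBc _ (hcX' i)) (fun i => (hXD i).mono inter_subset_right) hed ?_ ?_ ?_ ?_ hinf
    · exact fun i => isOpen_biUnion fun U hU => dom_open hc hX hU.1
    · intro i j hij
      rw [disjoint_left]
      intro x h1 h2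
      simp only [mem_iUnion] at h1 h2
      obtain ⟨U, hU, hxU⟩ := h1
      obtain ⟨V, hV, hxV⟩ := h2
      have : U = V := by rw [dom_of_mem hU.1 hxU, dom_of_mem hV.1 hxV]
      apply hij
      rw [← hU.2, ← hV.2, this]
    · ext x
      simp only [mem_iUnion]
      constructor
      · rintro ⟨i, U, hU, hx⟩
        exact dom_sub hU.1 hx
      · intro hx
        exact ⟨_, connectedComponentIn Xᶜ x, ⟨⟨x, hx, rfl⟩, rfl⟩, mem_connectedComponentIn hx⟩
    · intro i
      rw [disjoint_left]
      intro x h1 h2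
      simp only [mem_iUnion] at h1
      obtain ⟨U, hU, hxU⟩ := h1
      have := hJ U hU.1
      rw [hU.2] at this
      have h3 : x ∈ U ∩ D i := ⟨hxU, h2⟩
      rw [this] at h3
      exact h3
  obtain ⟨U, hU, hUD⟩ := hex
  refine ⟨U, hU, fun x hx => ?_⟩
  have := htc hx
  simp only [mem_iUnion] at this
  obtain ⟨y, hy, hxy⟩ := this
  have hyX := hcX' ⟨y, hy⟩
  obtain ⟨w, hw1, hw2⟩ := hUD ⟨y, hy⟩
  have hfr : (D ⟨y, hy⟩ ∩ frontier U).Nonempty := by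
    exact pre_frontier (hBc _ hyX) ⟨w, hw2, hw1⟩ ⟨c y, hxB _ hyX,
      fun h => dom_sub hU h hyX.1⟩
  obtain ⟨v, hv1, hv2⟩ := hfr
  refine ⟨v, hv2, ?_⟩
  have h1 := hBε _ hyX hv1
  have := dist_triangle_right x v (c y)
  rw [mem_ball] at h1 hxy
  linarith

theorem forward (hc : HasCharts S) {X : Set S} (hX : IsClosed X) (hXc : IsConnected X)
    (hsh : IsShielded X) (hind : ¬ IsDecomposable X) :
    ∃ U : ℕ → Set S, (∀ n, IsComplementaryDomain X (U n)) ∧ DoublePassCondition X U := by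
  have hXn : X.Nontrivial := by
    rw [← not_subsingleton_iff]
    intro hs
    obtain ⟨p, hp⟩ := hXc.nonempty
    have hXp : X = {p} := hs.eq_singleton_of_mem hp
    have hne : ∃ x, x ∉ X := by
      obtain ⟨e, he, h0, -⟩ := hc p univ isOpen_univ (mem_univ p)
      refine ⟨e 1, fun h => ?_⟩
      rw [hXp, mem_singleton_iff, ← h0] at h
      exact one_ne_zero (he.injective h)
    obtain ⟨x, hx⟩ := hne
    have hU : IsComplementaryDomain X (connectedComponentIn Xᶜ x) := ⟨x, hx, rfl⟩
    refine hsh _ hU ?_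
    obtain ⟨y, hy⟩ := dom_frontier_ne hXc.nonempty hU
    have h1 := dom_frontier hc hX hU
    refine Subset.antisymm h1 fun w hw => ?_
    rwa [hs hw (h1 hy)]
  choose U hU hd using fun n : ℕ => exists_dense_dom hc hX hXc hXn hind
    (ε := 1 / ((n:ℝ) + 1)) (by positivity)
  refine ⟨U, hU, dp_of_dense hc hX hXc hsh hind hU fun ε hε => ?_⟩
  filter_upwards [tendsto_one_div_add_atTop_nhds_zero_nat.eventually (gt_mem_nhds hε)]
    with n hn x hx
  obtain ⟨y, hy, h⟩ := hd n x hx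
  exact ⟨y, hy, h.trans hn⟩

end F2
end DP

namespace DP
section Horo

theorem emb_of_left {α β : Type*} [TopologicalSpace α] [TopologicalSpace β] {f : α → β}
    {g : β → α} (hf : Continuous f) (hg : ∀ x, ContinuousAt g (f x)) (h : ∀ x, g (f x) = x) :
    IsEmbedding f := by
  refine ⟨isInducing_iff_nhds.2 fun x => le_antisymm (hf.tendsto x).le_comap ?_,
    Function.LeftInverse.injective h⟩
  have h1 : Tendsto (g ∘ f) (comap f (𝓝 (f x))) (𝓝 (g (f x))) :=
    (hg x).tendsto.comp tendsto_comap
  have h2 : g ∘ f = id := funext h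
  rw [h2, h x] at h1
  exact h1

theorem horo_aux (t : ℝ) : (1 + (t:ℂ) * Complex.I) ≠ 0 := by
  intro h
  have := congrArg Complex.re h
  simp at this

theorem horo_circ {u : ℂ} (hu : u ≠ 0) : ‖u - 1 / 2‖ = 1 / 2 ↔ (u⁻¹).re = 1 := by
  have h0 : Complex.normSq u ≠ 0 := by simpa using hu
  rw [Complex.inv_re, div_eq_one_iff_eq h0]
  rw [← sq_eq_sq₀ (norm_nonneg _) (by norm_num), ← Complex.normSq_eq_norm_sq]
  rw [Complex.normSq_apply, Complex.normSq_apply]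
  simp
  constructor <;> intro h <;> nlinarith

variable {S : Type*} [MetricSpace S]

theorem exists_pline (hc : HasCharts S) {U : Set S} (hU : IsOpen U)
    (hf : (frontier U).Nonempty) : ∃ γ, PLine U γ := by
  obtain ⟨q, hq⟩ := hf
  obtain ⟨e, he, h0, -⟩ := hc q univ isOpen_univ (mem_univ q)
  have hqU : q ∉ U := by
    rw [hU.frontier_eq] at hq; exact hq.2
  obtain ⟨u, hu1, hu2⟩ := _root_.mem_closure_iff.1 hq.1 (range e) he.isOpen_range ⟨0, h0⟩
  obtain ⟨w0, rfl⟩ := hu1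
  have hVo : IsOpen (e ⁻¹' U) := hU.preimage he.continuous
  have hne : ((e ⁻¹' U)ᶜ).Nonempty := ⟨0, by simpa [h0] using hqU⟩
  obtain ⟨p, hp, hpr⟩ := hVo.isClosed_compl.exists_infDist_eq_dist hne w0
  have hball : ∀ z, dist z w0 < dist w0 p → e z ∈ U := by
    intro z hz
    by_contra hcon
    have : infDist w0 (e ⁻¹' U)ᶜ ≤ dist w0 z := infDist_le_dist_of_mem hcon
    rw [dist_comm] at hz
    linarith
  have hd : w0 - p ≠ 0 := by
    intro h
    rw [sub_eq_zero] at h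
    exact hp (h ▸ hu2)
  set w : ℝ → ℂ := fun t => p + (w0 - p) * (1 + (t:ℂ) * Complex.I)⁻¹ with hw
  have hwc : Continuous w := by
    refine continuous_const.add (continuous_const.mul (Continuous.inv₀ (by fun_prop) horo_aux))
  have hquot : ∀ t, (w t - p) / (w0 - p) = (1 + (t:ℂ) * Complex.I)⁻¹ := by
    intro t; simp only [hw]; field_simp; ring
  have hwe : IsEmbedding w := by
    refine emb_of_left (g := fun z => (((z - p) / (w0 - p))⁻¹).im) hwc ?_ ?_
    · intro t
      refine Complex.continuous_im.continuousAt.comp (ContinuousAt.inv₀ ?_ ?_)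
      · fun_prop
      · rw [hquot]; exact inv_ne_zero (horo_aux t)
    · intro t
      simp only [hquot, inv_inv]; simp
  have hrw : ∀ z, ‖(z - p) / (w0 - p) - 1 / 2‖ = 1 / 2 → z ≠ p → z ∈ range w := by
    intro z hz hzp
    have h1 : (z - p) / (w0 - p) ≠ 0 := div_ne_zero (sub_ne_zero.2 hzp) hd
    have h2 := (horo_circ h1).1 hz
    refine ⟨(((z - p) / (w0 - p))⁻¹).im, ?_⟩
    have h3 : (1 + (((((z - p) / (w0 - p))⁻¹).im : ℝ) : ℂ) * Complex.I) =
        ((z - p) / (w0 - p))⁻¹ := by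
      apply Complex.ext
      · rw [h2]; simp
      · simp
    simp only [hw]
    rw [h3, inv_inv]
    field_simp; ring
  have hwr : ∀ t, ‖(w t - p) / (w0 - p) - 1 / 2‖ = 1 / 2 := by
    intro t
    rw [hquot]
    refine (horo_circ (inv_ne_zero (horo_aux t))).2 ?_
    simp
  have hcpt : IsCompact {z : ℂ | ‖(z - p) / (w0 - p) - 1 / 2‖ = 1 / 2} := by
    refine Metric.isCompact_of_isClosed_isBounded (isClosed_eq (by fun_prop) continuous_const) ?_
    refine (Metric.isBounded_closedBall (x := p) (r := ‖w0 - p‖)).subset ?_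
    intro z hz
    simp only [mem_ofPred_eq] at hz
    rw [mem_closedBall, dist_eq_norm]
    have h1 : ‖(z - p) / (w0 - p)‖ ≤ 1 := by
      calc _ = ‖((z - p) / (w0 - p) - 1 / 2) + 1 / 2‖ := by congr 1; ring
        _ ≤ 1 / 2 + ‖(1 / 2 : ℂ)‖ := by rw [← hz]; exact norm_add_le _ _
        _ = 1 := by norm_num
    rw [norm_div, div_le_one (norm_pos_iff.2 hd)] at h1
    exact h1
  refine ⟨fun t => e (w t), hU, he.isEmbedding.comp hwe, ?_, ?_⟩
  · rintro _ ⟨t, rfl⟩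
    refine hball _ ?_
    rw [dist_eq_norm, dist_eq_norm]
    have h1 : w t - w0 = (w0 - p) * (-(t * Complex.I) * (1 + (t:ℂ) * Complex.I)⁻¹) := by
      have := horo_aux t
      simp only [hw]; field_simp; ring
    rw [h1, norm_mul]
    have h2 : ‖-(t * Complex.I) * (1 + (t:ℂ) * Complex.I)⁻¹‖ < 1 := by
      rw [norm_mul, norm_inv, ← div_eq_mul_inv, div_lt_one (norm_pos_iff.2 (horo_aux t))]
      rw [← sq_lt_sq₀ (norm_nonneg _) (norm_nonneg _), ← Complex.normSq_eq_norm_sq,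
        ← Complex.normSq_eq_norm_sq, Complex.normSq_apply, Complex.normSq_apply]
      simp
    have := norm_pos_iff.2 hd
    nlinarith
  · intro x hx hxc
    have h1 : closure (range fun t => e (w t)) ⊆
        e '' {z : ℂ | ‖(z - p) / (w0 - p) - 1 / 2‖ = 1 / 2} := by
      refine closure_minimal ?_ (hcpt.image he.continuous).isClosed
      rintro _ ⟨t, rfl⟩
      exact ⟨w t, hwr t, rfl⟩
    obtain ⟨z, hz, rfl⟩ := h1 hxc
    obtain ⟨t, rfl⟩ := hrw z hz (fun h => hp (h ▸ hx))
    exact ⟨t, rfl⟩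

variable [CompactSpace S]

theorem shadow_ne (hc : HasCharts S) {U K T : Set S} (hUo : IsOpen U) (hU : IsConnected U)
    (hK : IsGenCrosscut U K) (hT : IsShadowOf U K T) : T.Nonempty := by
  obtain ⟨γ, hγ, rfl⟩ := PLine.of_crosscut hUo hK
  obtain ⟨x, hx, rfl⟩ := hT
  obtain ⟨p, hp⟩ : ∃ p, MapClusterPt p atTop γ := by
    obtain ⟨p, -, hp⟩ := isCompact_univ.exists_mapClusterPt (u := γ) (f := atTop) (by simp)
    exact ⟨p, hp⟩
  obtain ⟨h1, -, h3⟩ := hγ.end_frontier hp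
  refine ⟨p, ?_, h3⟩
  have := closure_mono (hγ.closure_side hc hU.isPreconnected hx)
  rw [closure_closure] at this
  exact this h1

theorem conv_dense {X : Set S} (hX : X.Nonempty) {T : ℕ → Set S} (hT : ∀ n, (T n).Nonempty)
    (h : HausdorffConvergesTo T X) {ε : ℝ} (hε : 0 < ε) :
    ∀ᶠ n in atTop, ∀ x ∈ X, ∃ y ∈ T n, dist x y < ε := by
  have h1 : ∀ᶠ n in atTop, hausdorffDist (T n) X < ε := Tendsto.eventually h (gt_mem_nhds hε)
  filter_upwards [h1] with n hn x hx
  have hb : ∀ A : Set S, Bornology.IsBounded A := fun A =>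
    (isCompact_univ.isBounded).subset (subset_univ A)
  obtain ⟨y, hy, hxy⟩ := exists_dist_lt_of_hausdorffDist_lt' hx hn
    (hausdorffEDist_ne_top_of_nonempty_of_bounded (hT n) hX (hb _) (hb _))
  exact ⟨y, hy, by rwa [dist_comm]⟩

theorem dp_dense [ConnectedSpace S] (hc : HasCharts S) {X : Set S} (hX : IsClosed X) (hXc : IsConnected X)
    {U : ℕ → Set S} (hU : ∀ n, IsComplementaryDomain X (U n)) (hdp : DoublePassCondition X U)
    {ε : ℝ} (hε : 0 < ε) : ∀ᶠ n in atTop, ∀ x ∈ X, ∃ y ∈ frontier (U n), dist x y < ε := by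
  choose γ hγ using fun n => exists_pline hc (dom_open hc hX (hU n))
    (dom_frontier_ne hXc.nonempty (hU n))
  obtain ⟨T, hT, hconv⟩ := hdp _ (fun n => (hγ n).crosscut)
  have hne := fun n => shadow_ne hc (dom_open hc hX (hU n)) (dom_conn (hU n)) (hγ n).crosscut (hT n)
  filter_upwards [conv_dense hXc.nonempty hne hconv hε] with n hn x hx
  obtain ⟨y, hy, hxy⟩ := hn x hx
  obtain ⟨z, -, hz⟩ := hT n
  rw [hz] at hy
  exact ⟨y, hy.2, hxy⟩

theorem cutR (hc : HasCharts S) {V V' N1 C C2 : Set S} (hV : IsOpen V) (hV' : IsOpen V')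
    (hN : IsOpen N1) (hd : Disjoint V V') (hC : IsClosed C) (hC2 : IsClosed C2)
    (hcov : C ∪ C2 ⊆ V ∪ V' ∪ N1) {x0 y0 : S} (hx0 : x0 ∈ V) (hy0 : y0 ∉ V) (hy0' : y0 ∉ N1)
    {ω : S → S → ZMod 2} {h : S → ZMod 2} (hω : ∀ x, x ∉ C → Sec ω 0 x)
    (hωl : ∀ x, x ≠ x0 → x ≠ y0 → LC ω x) (hbr : Br ω x0) (hs : ∀ x ∈ N1, Sec ω h x)
    (hz : ∀ x ∈ N1, x ∉ C2 → h x = 0) : False := by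
  classical
  obtain ⟨F, hF1, hF2⟩ := glue (hV.union hN)
    ((hV'.union hN).union (hC.union hC2).isOpen_compl) ω 0
    (fun y => if y ∈ N1 then h y else 0) (by
      rintro x ⟨hx1, hx2⟩
      rw [add_zero]
      by_cases hxN : x ∈ N1
      · refine (hs x hxN).congr ?_
        filter_upwards [hN.mem_nhds hxN] with y hy
        rw [if_pos hy]
      · have hxV : x ∈ V := hx1.resolve_right hxN
        have hx3 : x ∈ (C ∪ C2)ᶜ := by
          rcases hx2 with (h1 | h1) | h1
          · exact absurd h1 (disjoint_left.1 hd hxV)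
          · exact absurd h1 hxN
          · exact h1
        rw [compl_union] at hx3
        refine (hω x hx3.1).congr ?_
        filter_upwards [hC2.isOpen_compl.mem_nhds hx3.2] with y hy
        by_cases hyN : y ∈ N1
        · rw [if_pos hyN, hz y hyN hy]; rfl
        · rw [if_neg hyN]; rfl)
  have hLC : ∀ x, x ∉ ({x0} : Finset S) → LC F x := by
    intro x hx
    rw [Finset.mem_singleton] at hx
    by_cases hx1 : x ∈ V ∪ N1
    · have hxy : x ≠ y0 := by
        rintro rfl
        exact hx1.elim hy0 hy0'
      exact (hF1 x hx1).symm.lc (hωl x hx hxy)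
    · have hx2 : x ∈ V' ∪ N1 ∪ (C ∪ C2)ᶜ := by
        by_cases hx3 : x ∈ C ∪ C2
        · rcases hcov hx3 with (h1 | h1) | h1
          · exact absurd (Or.inl h1) hx1
          · exact Or.inl (Or.inl h1)
          · exact Or.inl (Or.inr h1)
        · exact Or.inr hx3
      have := hF2 x hx2
      rw [add_zero] at this
      exact this.lc
  have hp := parity hc hLC
  rw [Finset.sum_singleton] at hp
  refine not_br_of_bz hp (br_congr' ?_ hbr)
  refine eventually_nhdsWithin_of_eventually_nhds ?_
  filter_upwards [(hV.union hN).mem_nhds (Or.inl hx0)] with y hy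
  exact (hF1 y hy).symm
end Horo
end DP

namespace DP
section SecN
variable {S : Type*} [MetricSpace S]

/-- a class with compact support branching at two points -/
structure Om (ω : S → S → ZMod 2) (C O : Set S) (x0 y0 : S) : Prop where
  cpt : IsCompact C
  sub : C ⊆ O
  sec0 : ∀ x, x ∉ C → Sec ω 0 x
  lc : ∀ x, x ≠ x0 → x ≠ y0 → LC ω x
  br1 : Br ω x0
  br2 : Br ω y0

theorem exists_om (hc : HasCharts S) {O : Set S} (hO : IsOpen O) (hconn : IsPreconnected O)
    {p q : S} (hp : p ∈ O) (hq : q ∈ O) (hpq : p ≠ q) : ∃ ω C, Om ω C O p q := by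
  obtain ⟨f, C, h1, h2, h3, h4, h5, h6⟩ := eta hc hO hconn hp hq hpq
  exact ⟨f, C, h1, h2, h3, h4, h5, h6⟩

theorem om_ext (hc : HasCharts S) {ω η : S → S → ZMod 2} {C C' O O' : Set S} {p q : S}
    (h1 : Om ω C O p q) (h2 : Om η C' O' p q) :
    ∃ ζ : S → S → ZMod 2, (∀ x, LC ζ x) ∧ ∀ x, x ≠ p → x ≠ q → Eqv ζ (ω + η) x := by
  classical
  have hP : ∀ x, x ∉ ({p, q} : Finset S) → x ≠ p ∧ x ≠ q := by
    intro x hx; simpa [not_or] using hx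
  have hl1 : ∀ x, x ∉ ({p, q} : Finset S) → LC ω x := fun x hx => h1.lc x (hP x hx).1 (hP x hx).2
  have hl2 : ∀ x, x ∉ ({p, q} : Finset S) → LC η x := fun x hx => h2.lc x (hP x hx).1 (hP x hx).2
  obtain ⟨ζ, hz1, hz2⟩ := extend_finset (f := ω + η) ({p, q} : Finset S) (by
    intro x hx
    have h3 := punct_of_finset hl1 x
    have h4 := punct_of_finset hl2 x
    simp only [Finset.mem_insert, Finset.mem_singleton] at hx
    rcases hx with rfl | rfl
    · exact br_br hc h3 h4 h1.br1 h2.br1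
    · exact br_br hc h3 h4 h1.br2 h2.br2)
  refine ⟨ζ, fun x => ?_, fun x hp hq => hz1 x (by simp [hp, hq])⟩
  by_cases hx : x ∈ ({p, q} : Finset S)
  · exact hz2 x hx
  · exact (hz1 x hx).symm.lc ((hl1 x hx).add (hl2 x hx))

theorem near_comp (hc : HasCharts S) {U G D : Set S} (hU : IsOpen U) (hUc : IsConnected U)
    (hUc' : IsConnected Uᶜ) (hs : Simp U) (hG : IsCompact G) (hGU : G ⊆ U)
    (hDc : IsPreconnected D) (hDG : Disjoint D G) {x x0 : S} (hxD : x ∈ D)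
    (hxU : x ∉ U) (hx0D : x0 ∈ D) (hx0U : x0 ∈ U) :
    ∀ z, z ∉ U → ∀ᶠ y in 𝓝 z, y ∈ U → y ∈ connectedComponentIn (U \ G) x0 := by
  classical
  have ho : IsOpen (U \ G) := hU.sdiff hG.isClosed
  have hx0 : x0 ∈ U \ G := ⟨hx0U, disjoint_left.1 hDG hx0D⟩
  obtain ⟨c, hcc⟩ := one_ended hU hUc hUc' hs hG hGU
    (g := fun z => if z ∈ connectedComponentIn (U \ G) x0 then 1 else 0)
    (fun y h1 h2 => ind_lcst hc ho x0 ⟨h1, h2⟩)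
  have hout : ∀ y, y ∉ U → y ∉ connectedComponentIn (U \ G) x0 :=
    fun y hy h => hy (connectedComponentIn_subset _ _ h).1
  rcases z2 c with rfl | rfl
  · exfalso
    have hl : ∀ y ∈ D, LCst (fun z => if z ∈ connectedComponentIn (U \ G) x0 then (1 : ZMod 2)
        else 0) y := by
      intro y hy
      by_cases hyU : y ∈ U
      · exact ind_lcst hc ho x0 ⟨hyU, disjoint_left.1 hDG hy⟩
      · filter_upwards [hcc y hyU] with w hw
        simp only [if_neg (hout y hyU)]
        by_cases hwU : w ∈ U
        · exact hw hwU
        · simp only [if_neg (hout w hwU)]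
    have := lcst_pre hDc hl hx0D hxD
    simp only [if_pos (mem_connectedComponentIn hx0), if_neg (hout x hxU)] at this
    exact one_ne_zero this
  · intro z hz
    filter_upwards [hcc z hz] with y hy hyU
    by_contra hcon
    have := hy hyU
    simp only [if_neg hcon] at this
    exact zero_ne_one this

theorem sec_off (hc : HasCharts S) {U O C : Set S} (hUc' : IsConnected Uᶜ) (hs : Simp U)
    (hO : IsOpen O) (hOc : IsPreconnected O) (hOU : O ⊆ U) {x0 y0 : S} (hx : x0 ∈ O)
    (hy : y0 ∈ O) (hxy : x0 ≠ y0) {ω : S → S → ZMod 2} (hω : Om ω C U x0 y0) :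
    ∃ (r : S → ZMod 2) (c : ZMod 2), (∀ x, x ∉ O → Sec ω r x) ∧
      ∀ x, x ∉ U → ∀ᶠ y in 𝓝 x, r y = c := by
  obtain ⟨η, C', hη⟩ := exists_om hc hO hOc hx hy hxy
  obtain ⟨ζ, hz1, hz2⟩ := om_ext hc hω hη
  have hne : ∀ x, x ∉ O → x ≠ x0 ∧ x ≠ y0 := fun x h =>
    ⟨fun h' => h (h' ▸ hx), fun h' => h (h' ▸ hy)⟩
  have hz0 : ∀ x, x ∉ U → Sec ζ 0 x := by
    intro x hxU
    have hxO : x ∉ O := fun h => hxU (hOU h)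
    have := (hω.sec0 x (fun h => hxU (hω.sub h))).add (hη.sec0 x (fun h => hxO (hη.sub h)))
    rw [add_zero] at this
    exact (hz2 x (hne x hxO).1 (hne x hxO).2).symm.sec this
  obtain ⟨r, hr⟩ := hs ζ hz1 ⟨0, hz0⟩
  have hl : ∀ x ∈ Uᶜ, LCst r x := fun x hxU => by
    have := (hz0 x hxU).lcst_add (hr x)
    rwa [zero_add] at this
  obtain ⟨u, hu⟩ := hUc'.nonempty
  refine ⟨r, r u, fun x hxO => ?_, fun x hxU => ?_⟩
  · have h1 := (hz2 x (hne x hxO).1 (hne x hxO).2).sec (hr x)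
    have h2 := h1.add (hη.sec0 x (fun h => hxO (hη.sub h)))
    rw [add_assoc, add_self_fun2, add_zero, add_zero] at h2
    exact h2
  · have := hl x hxU
    filter_upwards [this] with y hy
    rw [hy]
    exact lcst_pre hUc'.isPreconnected hl hxU hu

theorem ult_z2 (𝓤 : Ultrafilter ℕ) (a : ℕ → ZMod 2) : ∃ c, ∀ᶠ k in 𝓤, a k = c := by
  have : ∀ᶠ k in 𝓤, a k = 0 ∨ a k = 1 := Eventually.of_forall fun k => z2 _
  rcases Ultrafilter.eventually_or.1 this with h | h
  · exact ⟨0, h⟩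
  · exact ⟨1, h⟩

variable [CompactSpace S]

theorem sec_glob (hc : HasCharts S) {N : Set S} (hN : IsOpen N) (hne : Nᶜ.Nonempty)
    {ω : S → S → ZMod 2}
    (H : ∀ G, IsCompact G → G ⊆ N → ∃ r : S → ZMod 2, ∀ x ∈ G, Sec ω r x) :
    ∃ h : S → ZMod 2, ∀ x ∈ N, Sec ω h x := by
  have h1 : ∀ k : ℕ, ∃ r : S → ZMod 2, ∀ x, 1 / ((k:ℝ) + 1) ≤ infDist x Nᶜ → Sec ω r x := by
    intro k
    refine H {x | 1 / ((k:ℝ) + 1) ≤ infDist x Nᶜ}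
      (isClosed_le continuous_const (continuous_infDist_pt _)).isCompact ?_
    intro x hx
    by_contra hcon
    have h0 : infDist x Nᶜ = 0 := infDist_zero_of_mem hcon
    have : (0:ℝ) < 1 / ((k:ℝ) + 1) := by positivity
    have hx' : 1 / ((k:ℝ) + 1) ≤ infDist x Nᶜ := hx
    linarith
  choose r hr using h1
  set 𝓤 : Ultrafilter ℕ := hyperfilter ℕ
  choose h hh using fun x => ult_z2 𝓤 (fun k => r k x)
  refine ⟨h, fun x hx => ?_⟩
  have hpos : 0 < infDist x Nᶜ :=
    (hN.isClosed_compl.notMem_iff_infDist_pos hne).1 (fun h => h hx)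
  obtain ⟨K, hK⟩ := exists_nat_one_div_lt hpos
  obtain ⟨B, hB, hxB, hBO, hBc, hBs⟩ := hc.sec_nhds (f := ω) {y | 1 / ((K:ℝ) + 1) < infDist y Nᶜ}
    (isOpen_lt continuous_const (continuous_infDist_pt _)) (by exact hK)
  have hBr : ∀ k, K ≤ k → ∀ y ∈ B, Sec ω (r k) y := by
    intro k hk y hy
    refine hr k y (le_trans ?_ (le_of_lt (hBO hy)))
    exact Nat.one_div_le_one_div hk
  obtain ⟨s, hs⟩ := hBs (fun y hy => (hBr K le_rfl y hy).lc)
  obtain ⟨c, hcc⟩ := ult_z2 𝓤 (fun k => (r k + s) x)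
  have hge : ∀ᶠ k in (𝓤 : Filter ℕ), K ≤ k :=
    (Nat.hyperfilter_le_atTop) (eventually_ge_atTop K)
  have hy : ∀ y ∈ B, h y = s y + c := by
    intro y hy
    obtain ⟨k, ⟨hk1, hk2⟩, hk3⟩ := ((hge.and hcc).and (hh y)).exists
    have := lcst_pre hBc (fun z hz => (hBr k hk1 z hz).lcst_add (hs z hz)) hy hxB
    simp only [Pi.add_apply] at this hk2
    grind
  refine ((hs x hxB).add_lcst (lcst_const c x)).congr ?_
  filter_upwards [hB.mem_nhds hxB] with y hyB
  rw [hy y hyB]; rfl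

theorem sec_N (hc : HasCharts S) {U N D D' C : Set S} (hU : IsOpen U) (hUc : IsConnected U)
    (hUc' : IsConnected Uᶜ) (hs : Simp U) (hN : IsOpen N) (hNU : N ⊆ U)
    (hDc : IsPreconnected D) (hDc' : IsPreconnected D') (hDN : Disjoint D N) (hDN' : Disjoint D' N)
    {x y x0 y0 : S} (hxD : x ∈ D) (hxU : x ∉ U) (hx0D : x0 ∈ D) (hx0U : x0 ∈ U)
    (hyD : y ∈ D') (hyU : y ∉ U) (hy0D : y0 ∈ D') (hy0U : y0 ∈ U)
    (hxy : x0 ≠ y0) (hfr : (frontier U).Nonempty) {ω : S → S → ZMod 2} (hω : Om ω C U x0 y0) :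
    ∃ h : S → ZMod 2, ∀ x ∈ N, Sec ω h x := by
  refine sec_glob hc hN ⟨x0, disjoint_left.1 hDN hx0D⟩ fun G hG hGN => ?_
  have hGU := hGN.trans hNU
  have h1 := near_comp hc hU hUc hUc' hs hG hGU hDc (hDN.mono_right hGN) hxD hxU hx0D hx0U
  have h2 := near_comp hc hU hUc hUc' hs hG hGU hDc' (hDN'.mono_right hGN) hyD hyU hy0D hy0U
  have hx0 : x0 ∈ U \ G := ⟨hx0U, fun h => disjoint_left.1 hDN hx0D (hGN h)⟩
  have hy0 : y0 ∈ U \ G := ⟨hy0U, fun h => disjoint_left.1 hDN' hy0D (hGN h)⟩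
  obtain ⟨z, hz⟩ := hfr
  have hzU : z ∉ U := by rw [hU.frontier_eq] at hz; exact hz.2
  obtain ⟨w, hwU, hw⟩ : ∃ w ∈ U, (w ∈ U → w ∈ connectedComponentIn (U \ G) x0) ∧
      (w ∈ U → w ∈ connectedComponentIn (U \ G) y0) := by
    obtain ⟨w, hw1, hw2⟩ := _root_.mem_closure_iff_nhds.1 hz.1 _ ((h1 z hzU).and (h2 z hzU))
    exact ⟨w, hw2, hw1⟩
  have heq : connectedComponentIn (U \ G) x0 = connectedComponentIn (U \ G) y0 :=
    (connectedComponentIn_eq (hw.1 hwU)).trans (connectedComponentIn_eq (hw.2 hwU)).symm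
  have := hc.locConn
  obtain ⟨r, c, hr, -⟩ := sec_off hc hUc' hs ((hU.sdiff hG.isClosed).connectedComponentIn (x := x0))
    isPreconnected_connectedComponentIn ((connectedComponentIn_subset _ _).trans sdiff_subset)
    (mem_connectedComponentIn hx0) (heq ▸ mem_connectedComponentIn hy0) hxy hω
  exact ⟨r, fun p hp => hr p (fun h => (connectedComponentIn_subset _ _ h).2 hp)⟩
end SecN
end DP

namespace DP
universe u
section NonAlt
variable {S : Type u} [MetricSpace S]

theorem comp_compl_open (hc : HasCharts S) {O : Set S} (hO : IsOpen O) (x : S) :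
    IsOpen (O \ connectedComponentIn O x) := by
  have := hc.locConn
  rw [isOpen_iff_mem_nhds]
  rintro y ⟨hy, hyx⟩
  filter_upwards [(hO.connectedComponentIn (x := y)).mem_nhds (mem_connectedComponentIn hy)]
    with z hz
  refine ⟨connectedComponentIn_subset _ _ hz, fun h => hyx ?_⟩
  rw [connectedComponentIn_eq h, ← connectedComponentIn_eq hz]
  exact mem_connectedComponentIn hy

variable [CompactSpace S]

/-- the domains in which a line with ends in `B` splits `U ∩ D` -/
def BadDom (X B D : Set S) : Set (Set S) :=
  {U | IsComplementaryDomain X U ∧ ∃ γ, PLine U γ ∧ Disjoint (range γ) D ∧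
    closure (range γ) \ range γ ⊆ B ∧ ∃ x0 ∈ U ∩ D, ∃ x1 ∈ U ∩ D,
      x1 ∉ connectedComponentIn (U \ range γ) x0}

theorem nonalt [ConnectedSpace S] (hc : HasCharts S) {X B D : Set S} (hX : IsClosed X)
    (hBX : B ⊆ X) (hBc : IsConnected B) (hD : IsOpen D) (hDc : IsPreconnected D)
    (hDB : Disjoint D B) : (BadDom X B D).Finite := by
  classical
  have hcl := hc.locConn
  by_contra hinf
  have hinf : (BadDom X B D).Infinite := hinf
  let emb := hinf.natEmbedding
  have hU := fun k => (emb k).2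
  have hinj : ∀ k l, k ≠ l → Disjoint (emb k).1 (emb l).1 := by
    intro k l hkl
    rw [disjoint_left]
    intro p hp hq
    apply hkl
    apply emb.injective
    apply Subtype.ext
    by_contra hne
    exact disjoint_left.1 (dom_disj (hU k).1 (hU l).1 hne) hp hq
  choose hdom γ hγ hγD hγB x0 hx0 x1 hx1 hsep using hU
  have hL : ∀ k, ∀ p ∈ D, p ∉ range (γ k) := fun k p hp h => disjoint_left.1 (hγD k) h hp
  have hx0' : ∀ k, x0 k ∈ connectedComponentIn ((emb k).1 \ range (γ k)) (x0 k) := fun k =>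
    mem_connectedComponentIn ⟨(hx0 k).1, hL k _ (hx0 k).2⟩
  have hne : ∀ k, x0 k ≠ x1 k := fun k h => hsep k (h ▸ hx0' k)
  choose η C hη using fun k => exists_om hc (dom_open hc hX (hdom k))
    (dom_conn (hdom k)).isPreconnected (hx0 k).1 (hx1 k).1 (hne k)
  choose δ C' hδ using fun k => exists_om hc hD hDc (hx0 k).2 (hx1 k).2 (hne k)
  choose ζ hz1 hz2 using fun k => om_ext hc (hη k) (hδ k)
  obtain ⟨T, hT, Inv, hInv⟩ := fin_inv hc (M := univ) (M' := univ) isCompact_univ isOpen_univ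
    subset_rfl
  obtain ⟨k, l, hkl, hI⟩ := Finite.exists_ne_map_eq_of_infinite (fun k => Inv (ζ k))
  obtain ⟨r, hr⟩ := hInv _ _ (fun x _ => hz1 k x) (fun x _ => hz1 l x) hI
  have hr : ∀ x, Sec (ζ k + ζ l) r x := fun x => hr x (mem_univ x)
  set U := (emb k).1 with hUdef
  set U' := (emb l).1 with hUdef'
  have hUX : ∀ p ∈ B, p ∉ U := fun p hp h => dom_sub (hdom k) h (hBX hp)
  have hUX' : ∀ p ∈ B, p ∉ U' := fun p hp h => dom_sub (hdom l) h (hBX hp)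
  have hUU := disjoint_left.1 (hinj k l hkl)
  have hz0 : ∀ m p, p ∉ (emb m).1 → p ∉ C' m → p ≠ x0 m → p ≠ x1 m → Sec (ζ m) 0 p := by
    intro m p h1 h2 h3 h4
    have := ((hη m).sec0 p (fun h => h1 ((hη m).sub h))).add ((hδ m).sec0 p h2)
    rw [add_zero] at this
    exact (hz2 m p h3 h4).symm.sec this
  have hz0' : ∀ m p, p ∉ (emb m).1 → p ∉ C' m → Sec (ζ m) 0 p := fun m p h1 h2 =>
    hz0 m p h1 h2 (fun h => h1 (h ▸ (hx0 m).1)) (fun h => h1 (h ▸ (hx1 m).1))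
  have hDB' : ∀ p ∈ B, p ∉ D := fun p hp h => disjoint_left.1 hDB h hp
  have hrB : ∀ p ∈ B, LCst r p := by
    intro p hp
    have := ((hz0' k p (hUX p hp) (fun h => hDB' p hp ((hδ k).sub h))).add
      (hz0' l p (hUX' p hp) (fun h => hDB' p hp ((hδ l).sub h)))).lcst_add (hr p)
    rwa [add_zero, zero_add] at this
  obtain ⟨b, hb⟩ := hBc.nonempty
  set Q : Set S := {p | ∀ᶠ q in 𝓝 p, r q = r b} with hQ
  have hQo : IsOpen Q := by
    rw [isOpen_iff_mem_nhds]
    intro p hp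
    exact Filter.Eventually.eventually_nhds hp
  have hBQ : B ⊆ Q := by
    intro p hp
    filter_upwards [hrB p hp] with q hq
    rw [hq]; exact lcst_pre hBc.isPreconnected hrB hp hb
  have hLQ : IsCompact (range (γ k) \ Q) := by
    have : range (γ k) \ Q = closure (range (γ k)) \ Q := by
      refine Subset.antisymm (sdiff_subset_sdiff_left subset_closure) ?_
      rintro p ⟨h1, h2⟩
      refine ⟨?_, h2⟩
      by_contra h3
      exact h2 (hBQ (hγB k ⟨h1, h3⟩))
    rw [this]
    exact (isClosed_closure.sdiff hQo).isCompact
  have hopen : IsOpen U := dom_open hc hX (hdom k)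
  obtain ⟨W, hWo, hWL, hWU⟩ : ∃ W, IsOpen W ∧ range (γ k) \ Q ⊆ W ∧ closure W ⊆ U := by
    obtain ⟨W, h1, h2, h3, -⟩ := exists_open_between_and_isCompact_closure hLQ hopen
      (sdiff_subset.trans (hγ k).sub)
    exact ⟨W, h1, h2, h3⟩
  set N1 : Set S := (U ∩ (C' k ∪ C' l ∪ {x0 k, x1 k})ᶜ) ∩ (Q ∪ W) with hN1
  have hfin : IsClosed ({x0 k, x1 k} : Set S) := (Set.toFinite _).isClosed
  have hN1o : IsOpen N1 := (hopen.inter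
    (((hδ k).cpt.isClosed.union (hδ l).cpt.isClosed).union hfin).isOpen_compl).inter (hQo.union hWo)
  have hVo : IsOpen (connectedComponentIn (U \ range (γ k)) (x0 k)) :=
    (hγ k).open'.connectedComponentIn
  have hcover : U ⊆ connectedComponentIn (U \ range (γ k)) (x0 k) ∪
      ((U \ range (γ k)) \ connectedComponentIn (U \ range (γ k)) (x0 k)) ∪ N1 := by
    intro p hp
    by_cases hpL : p ∈ range (γ k)
    · right
      have hpD : p ∉ D := disjoint_left.1 (hγD k) hpL
      refine ⟨⟨hp, ?_⟩, ?_⟩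
      · rintro ((h | h) | h | h)
        · exact hpD ((hδ k).sub h)
        · exact hpD ((hδ l).sub h)
        · exact hpD (h ▸ (hx0 k).2)
        · exact hpD (mem_singleton_iff.1 h ▸ (hx1 k).2)
      · by_cases hpQ : p ∈ Q
        · exact Or.inl hpQ
        · exact Or.inr (hWL ⟨hpL, hpQ⟩)
    · left
      by_cases hpV : p ∈ connectedComponentIn (U \ range (γ k)) (x0 k)
      · exact Or.inl hpV
      · exact Or.inr ⟨⟨hp, hpL⟩, hpV⟩
  refine cutR hc (N1 := N1) (C := C k) (C2 := closure W) (h := r + fun _ => r b) hVo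
    (comp_compl_open hc (hγ k).open' (x0 k)) hN1o disjoint_sdiff_right (hη k).cpt.isClosed
    isClosed_closure ((union_subset (hη k).sub hWU).trans hcover) (hx0' k) (hsep k) ?_ (hη k).sec0
    (hη k).lc (hη k).br1 ?_ ?_
  · intro h
    exact h.1.2 (Or.inr (Or.inr rfl))
  · rintro p ⟨⟨hpU, hp2⟩, -⟩
    simp only [mem_compl_iff, mem_union, mem_insert_iff, mem_singleton_iff, not_or] at hp2
    obtain ⟨⟨h1, h2⟩, h3, h4⟩ := hp2
    have e1 := (hr p).add (hz0' l p (fun h => hUU hpU h) h2)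
    rw [add_assoc, add_self_fun2, add_zero, add_zero] at e1
    have e2 := ((hz2 k p h3 h4).sec e1).add ((hδ k).sec0 p h1)
    rw [add_assoc, add_self_fun2, add_zero, add_zero] at e2
    exact e2.add_lcst (lcst_const _ p)
  · rintro p ⟨-, hp⟩ hpW
    have hpQ : p ∈ Q := hp.resolve_right (fun h => hpW (subset_closure h))
    have : r p = r b := Filter.Eventually.self_of_nhds (p := fun q => r q = r b) hpQ
    simp only [Pi.add_apply, this]
    grind
end NonAlt
end DP

namespace DP
section Line
variable {S : Type*} [MetricSpace S]

theorem first_hit {α : ℝ → S} (hα : Continuous α) {A : Set S} (hA : IsClosed A) {s : ℝ}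
    (hs : s ≤ 1) (h1 : α 1 ∈ A) : ∃ t, s ≤ t ∧ t ≤ 1 ∧ α t ∈ A ∧ ∀ x, s ≤ x → x < t → α x ∉ A := by
  have hcpt : IsCompact (Icc s 1 ∩ α ⁻¹' A) := isCompact_Icc.inter_right (hA.preimage hα)
  obtain ⟨t, ht, hl⟩ := hcpt.exists_isLeast ⟨1, ⟨hs, le_rfl⟩, h1⟩
  refine ⟨t, ht.1.1, ht.1.2, ht.2, fun x h2 h3 h4 => ?_⟩
  have := hl ⟨⟨h2, h3.le.trans ht.1.2⟩, h4⟩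
  linarith

theorem half_chain {α : ℕ → ℝ → S} (hα : ∀ n, Continuous (α n)) {A : ℕ → Set S}
    (hA : ∀ n, IsClosed (A n)) (hAs : ∀ n, ∀ x ∈ A n, ∃ s ∈ Icc (0:ℝ) 1, α n s = x)
    (h1 : ∀ n, α n 1 ∈ A (n + 1)) (hαA : ∀ n, ∀ s ∈ Icc (0:ℝ) 1, α n s ∈ A n)
    (hfar : ∀ n, Disjoint (A n) (A (n + 2))) {s0 : ℝ}
    (hs0 : s0 ∈ Icc (0:ℝ) 1) (hs0' : α 0 s0 ∉ A 1) :
    ∃ s t : ℕ → ℝ, s 0 = s0 ∧ ∀ n, 0 ≤ s n ∧ s n < t n ∧ t n ≤ 1 ∧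
      α n (t n) = α (n + 1) (s (n + 1)) ∧ ∀ x, s n ≤ x → x < t n → α n x ∉ A (n + 1) := by
  have step : ∀ n s, s ∈ Icc (0:ℝ) 1 ∧ α n s ∉ A (n + 1) → ∃ t s', (s < t ∧ t ≤ 1 ∧
      α n t = α (n + 1) s' ∧ ∀ x, s ≤ x → x < t → α n x ∉ A (n + 1)) ∧
      (s' ∈ Icc (0:ℝ) 1 ∧ α (n + 1) s' ∉ A (n + 1 + 1)) := by
    rintro n s ⟨hs, hsA⟩
    obtain ⟨t, h2, h3, h4, h5⟩ := first_hit (hα n) (hA (n + 1)) hs.2 (h1 n)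
    obtain ⟨s', hs', he⟩ := hAs _ _ h4
    refine ⟨t, s', ⟨lt_of_le_of_ne h2 (fun h => hsA (h ▸ h4)), h3, he.symm, h5⟩, hs', ?_⟩
    rw [he]
    exact disjoint_left.1 (hfar n) (hαA n t ⟨hs.1.trans h2, h3⟩)
  choose! t s' h using step
  let s : ℕ → ℝ := fun n => Nat.rec s0 (fun k x => s' k x) n
  have hs : ∀ n, s n ∈ Icc (0:ℝ) 1 ∧ α n (s n) ∉ A (n + 1) := by
    intro n
    induction n with
    | zero => exact ⟨hs0, hs0'⟩
    | succ k ih => exact (h k (s k) ih).2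
  refine ⟨s, fun n => t n (s n), rfl, fun n => ?_⟩
  obtain ⟨⟨h3, h4, h5, h6⟩, -⟩ := h n (s n) (hs n)
  exact ⟨(hs n).1.1, h3, h4, h5, h6⟩

theorem locFin_Icc : LocallyFinite (fun n : ℤ => Icc (n:ℝ) (n + 1)) := by
  intro x
  refine ⟨Ioo (x - 1) (x + 1), Ioo_mem_nhds (by linarith) (by linarith), ?_⟩
  refine (Set.finite_Icc (⌊x⌋ - 3) (⌊x⌋ + 3)).subset ?_
  rintro n ⟨y, hy1, hy2⟩
  have h1 := Int.floor_le x
  have h2 := Int.lt_floor_add_one x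
  constructor
  · have : ((⌊x⌋ - 3 : ℤ) : ℝ) ≤ n := by push_cast; linarith [hy1.1, hy1.2, hy2.1, hy2.2]
    exact_mod_cast this
  · have : (n : ℝ) ≤ ((⌊x⌋ + 3 : ℤ) : ℝ) := by push_cast; linarith [hy1.1, hy1.2, hy2.1, hy2.2]
    exact_mod_cast this

/-- Concatenation of a chain of arcs. -/
theorem concat {U : Set S} (hU : IsOpen U) [LocallyCompactSpace S] {B : ℤ → Set S}
    {σ : ℤ → ℝ → S} (hσ : ∀ n, Continuous (σ n)) (hi : ∀ n, Function.Injective (σ n))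
    (hB : ∀ n x, σ n x ∈ B n) (hBU : ∀ n, B n ⊆ U) (hm : ∀ n, σ n 1 = σ (n + 1) 0)
    (hn : ∀ n, ∀ x ∈ Icc (0:ℝ) 1, ∀ y ∈ Icc (0:ℝ) 1, σ n x = σ (n + 1) y → x = 1)
    (hfar : ∀ m n, m + 2 ≤ n → Disjoint (B m) (B n))
    (hfin : ∀ K, IsCompact K → K ⊆ U → {n | (B n ∩ K).Nonempty}.Finite) :
    ∃ γ, PLine U γ ∧ ∀ t, γ t ∈ B ⌊t⌋ := by
  set γ : ℝ → S := fun t => σ ⌊t⌋ (Int.fract t) with hγ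
  have hγB : ∀ t, γ t ∈ B ⌊t⌋ := fun t => hB _ _
  have hon : ∀ n : ℤ, ∀ t ∈ Icc (n:ℝ) (n + 1), γ t = σ n (t - n) := by
    intro n t ht
    rcases lt_or_eq_of_le ht.2 with h | h
    · have : ⌊t⌋ = n := Int.floor_eq_iff.2 ⟨ht.1, h⟩
      simp only [hγ, Int.fract, this]
    · have h2 : ⌊t⌋ = n + 1 := by rw [h]; simp
      have h3 : t - ((n + 1 : ℤ) : ℝ) = 0 := by push_cast; linarith
      have h4 : t - n = 1 := by linarith
      simp only [hγ, Int.fract, h2]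
      rw [h3, h4]
      exact (hm n).symm
  have hcont : Continuous γ := by
    refine locFin_Icc.continuous ?_ (fun _ => isClosed_Icc) (fun n => ?_)
    · refine eq_univ_of_forall fun t => mem_iUnion.2 ⟨⌊t⌋, Int.floor_le t, ?_⟩
      exact (Int.lt_floor_add_one t).le
    · refine ContinuousOn.congr (f := fun t => σ n (t - n)) ?_ (hon n)
      exact ((hσ n).comp (continuous_id.sub continuous_const)).continuousOn
  have hlt : ∀ s t, ⌊s⌋ < ⌊t⌋ → γ s ≠ γ t := by
    intro s t h he
    rcases (show ⌊t⌋ = ⌊s⌋ + 1 ∨ ⌊s⌋ + 2 ≤ ⌊t⌋ by omega) with h1 | h1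
    · simp only [hγ] at he
      rw [h1] at he
      have := hn _ _ ⟨Int.fract_nonneg s, (Int.fract_lt_one s).le⟩ _
        ⟨Int.fract_nonneg t, (Int.fract_lt_one t).le⟩ he
      exact (Int.fract_lt_one s).ne this
    · exact disjoint_left.1 (hfar _ _ h1) (hγB s) (he ▸ hγB t)
  have hinj : Function.Injective γ := by
    intro s t he
    rcases lt_trichotomy ⌊s⌋ ⌊t⌋ with h | h | h
    · exact absurd he (hlt s t h)
    · simp only [hγ] at he
      rw [h] at he
      have := hi _ he
      rw [← Int.floor_add_fract s, ← Int.floor_add_fract t, h, this]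
    · exact absurd he.symm (hlt t s h)
  have hγU : ∀ t, γ t ∈ U := fun t => hBU _ (hγB t)
  have := hU.locallyCompactSpace
  have hce : IsClosedEmbedding (fun t => (⟨γ t, hγU t⟩ : U)) := by
    refine IsClosedEmbedding.of_continuous_injective_isClosedMap (hcont.subtype_mk _)
      (fun s t h => hinj (congrArg Subtype.val h)) (IsProperMap.isClosedMap ?_)
    refine isProperMap_iff_tendsto_cocompact.2 ⟨hcont.subtype_mk _, ?_⟩
    rw [hasBasis_cocompact.tendsto_right_iff]
    intro K hK
    have hK' : IsCompact (Subtype.val '' K) := hK.image continuous_subtype_val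
    have hf := hfin _ hK' (by rintro _ ⟨x, -, rfl⟩; exact x.2)
    have hc2 : IsCompact (⋃ n ∈ {n | (B n ∩ Subtype.val '' K).Nonempty}, Icc (n:ℝ) (n + 1)) :=
      hf.isCompact_biUnion fun _ _ => isCompact_Icc
    filter_upwards [hc2.compl_mem_cocompact] with t ht hK
    apply ht
    rw [mem_iUnion₂]
    exact ⟨⌊t⌋, ⟨γ t, hγB t, _, hK, rfl⟩, Int.floor_le t, (Int.lt_floor_add_one t).le⟩
  refine ⟨γ, ⟨hU, IsEmbedding.subtypeVal.comp hce.isEmbedding, ?_, ?_⟩, hγB⟩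
  · rintro _ ⟨t, rfl⟩; exact hγU t
  · intro x hx hxc
    have h1 : (⟨x, hx⟩ : U) ∈ closure (range (fun t => (⟨γ t, hγU t⟩ : U))) := by
      rw [closure_subtype]
      convert hxc using 2
      rw [← range_comp]; rfl
    rw [hce.isClosed_range.closure_eq] at h1
    obtain ⟨t, ht⟩ := h1
    exact ⟨t, congrArg Subtype.val ht⟩

theorem exists_line {U : Set S} (hU : IsOpen U) [LocallyCompactSpace S] {e : ℤ → ℂ → S}
    (he : ∀ n, IsOpenEmbedding (e n)) (heU : ∀ n, range (e n) ⊆ U)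
    (hadj : ∀ n, (range (e n) ∩ range (e (n + 1))).Nonempty)
    (hfar : ∀ m n, m + 2 ≤ n → Disjoint (range (e m)) (range (e n)))
    (hfin : ∀ K, IsCompact K → K ⊆ U → {n | (range (e n) ∩ K).Nonempty}.Finite) :
    ∃ γ, PLine U γ ∧ ∀ t, γ t ∈ range (e ⌊t⌋) := by
  choose c hc1 hc2 using hadj
  have hzw : ∀ n, ∃ z w, e n z = c (n - 1) ∧ e n w = c n := by
    intro n
    have h := hc2 (n - 1)
    rw [sub_add_cancel] at h
    obtain ⟨z, hz⟩ := h
    obtain ⟨w, hw⟩ := hc1 n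
    exact ⟨z, w, hz, hw⟩
  choose z w hz hw using hzw
  have hne : ∀ n, w n - z n ≠ 0 := by
    intro n h
    rw [sub_eq_zero] at h
    have h1 : c (n - 1) = c n := by rw [← hz, ← hw, h]
    exact disjoint_left.1 (hfar (n - 1) (n + 1) (by omega)) (hc1 (n - 1)) (h1 ▸ hc2 n)
  set α : ℤ → ℝ → S := fun n x => e n (z n + x * (w n - z n)) with hα
  have hαc : ∀ n, Continuous (α n) := fun n => (he n).continuous.comp (by fun_prop)
  have hαi : ∀ n, Function.Injective (α n) := by
    intro n x y hxy
    have h1 := (he n).injective hxy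
    have h2 := mul_right_cancel₀ (hne n) (add_left_cancel h1)
    exact_mod_cast h2
  have hα0 : ∀ n, α n 0 = c (n - 1) := fun n => by simp [hα, hz]
  have hα1 : ∀ n, α n 1 = c n := fun n => by simp [hα, hw]
  have hαr : ∀ n x, α n x ∈ range (e n) := fun n x => mem_range_self _
  set A : ℤ → Set S := fun n => α n '' Icc 0 1 with hA
  have hAc : ∀ n, IsClosed (A n) := fun n => (isCompact_Icc.image (hαc n)).isClosed
  have hAd : ∀ m n, m + 2 ≤ n → Disjoint (A m) (A n) := fun m n h =>
    (hfar m n h).mono (by rintro _ ⟨x, -, rfl⟩; exact hαr _ _)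
      (by rintro _ ⟨x, -, rfl⟩; exact hαr _ _)
  have h01 : (0:ℝ) ∈ Icc (0:ℝ) 1 := ⟨le_rfl, zero_le_one⟩
  have h11 : (1:ℝ) ∈ Icc (0:ℝ) 1 := ⟨zero_le_one, le_rfl⟩
  have hαA0 : ∀ n, α n 0 ∈ A (n - 1) := fun n => ⟨1, h11, by rw [hα1, hα0]⟩
  have hαA1 : ∀ n, α n 1 ∈ A (n + 1) := fun n => ⟨0, h01, by rw [hα1, hα0, add_sub_cancel_right]⟩
  -- the middle arc
  obtain ⟨t0, ht0, ht1, ht2, ht3⟩ := first_hit (hαc 0) (hAc 1) zero_le_one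
    (by simpa using hαA1 0)
  obtain ⟨u', hu0, hu1, hu2, hu3⟩ := first_hit (α := fun x => α 0 (1 - x))
    ((hαc 0).comp (by fun_prop)) (hAc (-1)) (s := 1 - t0) (by linarith)
    (by simpa using hαA0 0)
  set u0 := 1 - u' with hu0def
  have hlt : u0 < t0 := by
    refine lt_of_le_of_ne (by linarith) fun h => ?_
    have : α 0 u0 ∈ A (-1) := hu2
    exact disjoint_left.1 (hAd (-1) 1 (by norm_num)) this (h ▸ ht2)
  have hu3' : ∀ x, u0 < x → x ≤ t0 → α 0 x ∉ A (-1) := by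
    intro x h1 h2
    have := hu3 (1 - x) (by linarith) (by linarith)
    simpa using this
  obtain ⟨s1, hs1, hs1e⟩ := ht2
  obtain ⟨v1, hv1, hv1e⟩ := (hu2 : α 0 u0 ∈ A (-1))
  have ht0A : α 0 t0 ∈ A 0 := ⟨t0, ⟨ht0, ht1⟩, rfl⟩
  have hu0A : α 0 u0 ∈ A 0 := ⟨u0, ⟨by linarith, by linarith⟩, rfl⟩
  obtain ⟨s, t, hs0, hst⟩ := half_chain (α := fun k : ℕ => α (k + 1)) (A := fun k => A (k + 1))
    (fun n => hαc _) (fun n => hAc _) (fun n x hx => hx) (fun n => by simpa using hαA1 (n + 1))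
    (fun n s hs => ⟨s, hs, rfl⟩) (fun n => hAd _ _ (by push_cast; omega)) hs1
    (by
      simp only [Nat.cast_zero, zero_add, Nat.cast_one]
      rw [hs1e]
      exact disjoint_left.1 (hAd 0 (1 + 1) (by norm_num)) ht0A)
  obtain ⟨s', t', hs0', hst'⟩ := half_chain (α := fun (k : ℕ) x => α (Int.negSucc k) (1 - x))
    (A := fun k => A (Int.negSucc k)) (fun n => (hαc _).comp (by fun_prop)) (fun n => hAc _)
    (fun n x hx => by
      obtain ⟨y, hy, rfl⟩ := hx
      exact ⟨1 - y, ⟨by linarith [hy.2], by linarith [hy.1]⟩, by simp⟩)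
    (fun n => by
      have := hαA0 (Int.negSucc n)
      rw [sub_self]
      convert this using 2
      omega)
    (fun n s hs => ⟨1 - s, ⟨by linarith [hs.2], by linarith [hs.1]⟩, rfl⟩)
    (fun n => (hAd _ _ (by omega)).symm) (s0 := 1 - v1) ⟨by linarith [hv1.2], by linarith [hv1.1]⟩
    (by
      rw [sub_sub_cancel]
      have : α (Int.negSucc 0) v1 = α 0 u0 := hv1e
      rw [this]
      exact disjoint_right.1 (hAd (Int.negSucc 1) 0 (by omega)) hu0A)
  -- the pieces
  let p : ℤ → ℝ := fun n => match n with
    | Int.ofNat 0 => u0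
    | Int.ofNat (k + 1) => s k
    | Int.negSucc k => 1 - t' k
  let q : ℤ → ℝ := fun n => match n with
    | Int.ofNat 0 => t0
    | Int.ofNat (k + 1) => t k
    | Int.negSucc k => 1 - s' k
  have hpq : ∀ n, 0 ≤ p n ∧ p n < q n ∧ q n ≤ 1 := by
    rintro ((_ | k) | k)
    · exact ⟨by simp only [p]; linarith, hlt, ht1⟩
    · exact ⟨(hst k).1, (hst k).2.1, (hst k).2.2.1⟩
    · obtain ⟨h1, h2, h3, -⟩ := hst' k
      simp only [p, q]
      exact ⟨by linarith, by linarith, by linarith⟩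
  have hmatch : ∀ n, α n (q n) = α (n + 1) (p (n + 1)) := by
    rintro ((_ | k) | (_ | k))
    · have : (Int.ofNat 0 + 1) = Int.ofNat (0 + 1) := rfl
      rw [this]
      simp only [p, q]
      rw [hs0]
      exact hs1e.symm
    · have : (Int.ofNat (k + 1) + 1) = Int.ofNat (k + 1 + 1) := rfl
      rw [this]
      exact (hst k).2.2.2.1
    · have : (Int.negSucc 0 + 1) = Int.ofNat 0 := rfl
      rw [this]
      simp only [p, q]
      rw [hs0', sub_sub_cancel]
      exact hv1e
    · have : (Int.negSucc (k + 1) + 1) = Int.negSucc k := by omega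
      rw [this]
      exact (hst' k).2.2.2.1.symm
  have hpqI : ∀ n, ∀ x, p n ≤ x → x ≤ q n → x ∈ Icc (0:ℝ) 1 := fun n x h1 h2 =>
    ⟨(hpq n).1.trans h1, h2.trans (hpq n).2.2⟩
  have hcross : ∀ n x y, p n ≤ x → x ≤ q n → p (n + 1) ≤ y → y ≤ q (n + 1) →
      α n x = α (n + 1) y → x = q n ∨ y = p (n + 1) := by
    intro n x y hx1 hx2 hy1 hy2 hxy
    have hxA : α n x ∈ A (n + 1) := hxy ▸ ⟨y, hpqI _ y hy1 hy2, rfl⟩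
    have hyA : α (n + 1) y ∈ A n := hxy ▸ ⟨x, hpqI _ x hx1 hx2, rfl⟩
    by_contra hcon
    rw [not_or] at hcon
    have hx3 := lt_of_le_of_ne hx2 hcon.1
    have hy3 := lt_of_le_of_ne hy1 (Ne.symm hcon.2)
    revert hx1 hx2 hy1 hy2 hxA hyA hx3 hy3
    clear hxy hcon
    rcases n with ((_ | k) | (_ | k))
    · intro hx1 hx2 hy1 hy2 hxA hyA hx3 hy3
      have hx1' : u0 ≤ x := hx1
      exact ht3 x (by linarith) hx3 (by simpa using hxA)
    · intro hx1 hx2 hy1 hy2 hxA hyA hx3 hy3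
      exact (hst k).2.2.2.2 x hx1 hx3 (by simpa using hxA)
    · have : (Int.negSucc 0 + 1) = Int.ofNat 0 := rfl
      rw [this]
      intro hx1 hx2 hy1 hy2 hxA hyA hx3 hy3
      exact hu3' y hy3 hy2 hyA
    · have : (Int.negSucc (k + 1) + 1) = Int.negSucc k := by omega
      rw [this]
      intro hx1 hx2 hy1 hy2 hxA hyA hx3 hy3
      simp only [p, q] at hy3 hy2
      refine (hst' k).2.2.2.2 (1 - y) (by linarith) (by linarith) ?_
      simpa using hyA
  have hr0 : ∀ n, ∀ x ∈ Icc (0:ℝ) 1, p n ≤ p n + x * (q n - p n) ∧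
      p n + x * (q n - p n) ≤ q n := by
    intro n x hx
    have := (hpq n).2.1
    constructor <;> nlinarith [hx.1, hx.2]
  refine concat hU (σ := fun n x => α n (p n + x * (q n - p n))) (B := fun n => range (e n))
    (fun n => (hαc n).comp (by fun_prop)) ?_ (fun n x => hαr _ _) heU ?_ ?_ hfar hfin
  · intro n x y hxy
    have h1 := hαi n hxy
    exact mul_right_cancel₀ (sub_ne_zero.2 (hpq n).2.1.ne') (add_left_cancel h1)
  · intro n
    simp only [one_mul, zero_mul, add_zero, add_sub_cancel]
    exact hmatch n
  · intro n x hx y hy hxy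
    have h1 := hr0 n x hx
    have h2 := hr0 (n + 1) y hy
    have h3 : p n + x * (q n - p n) = q n := by
      rcases hcross n _ _ h1.1 h1.2 h2.1 h2.2 hxy with h | h
      · exact h
      · rw [h, ← hmatch n] at hxy
        exact hαi n hxy
    have h4 := sub_ne_zero.2 (hpq n).2.1.ne'
    have h5 : x * (q n - p n) = 1 * (q n - p n) := by linarith
    exact mul_right_cancel₀ h4 h5
end Line
end DP

namespace DP
section Graph
variable {I : Type*} (G : SimpleGraph I)

/-- points at distance at most `n` from `F` -/
def Bl (F : Set I) (n : ℕ) : Set I := {j | ∃ f ∈ F, ∃ p : G.Walk f j, p.length ≤ n}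

theorem Bl_finite (hlf : ∀ i, {j | G.Adj i j}.Finite) {F : Set I} (hF : F.Finite) (n : ℕ) :
    (Bl G F n).Finite := by
  induction n with
  | zero =>
    refine hF.subset ?_
    rintro j ⟨f, hf, p, hp⟩
    have := SimpleGraph.Walk.eq_of_length_eq_zero (Nat.le_zero.1 hp)
    exact this ▸ hf
  | succ n ih =>
    refine (ih.union (ih.biUnion fun i _ => hlf i)).subset ?_
    rintro j ⟨f, hf, p, hp⟩
    have key : ∀ {x y : I} (q : G.Walk x y), q.length ≤ n + 1 →
        (∃ q' : G.Walk x y, q'.length ≤ n) ∨ ∃ z, ∃ q' : G.Walk x z, q'.length ≤ n ∧ G.Adj z y := by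
      intro x y q hq
      rcases Nat.lt_or_ge q.length (n + 1) with h | h
      · exact Or.inl ⟨q, by omega⟩
      · have hq' : q.length = n + 1 := le_antisymm hq h
        right
        have hl : q.length ≠ 0 := by omega
        refine ⟨q.getVert n, q.take n, ?_, ?_⟩
        · rw [SimpleGraph.Walk.take_length]; omega
        · have h2 := q.adj_getVert_succ (i := n) (by omega)
          rwa [← hq', SimpleGraph.Walk.getVert_length] at h2
    rcases key p hp with ⟨q, hq⟩ | ⟨z, q, hq, hz⟩
    · exact Or.inl ⟨f, hf, q, hq⟩
    · exact Or.inr (mem_biUnion (x := z) ⟨f, hf, q, hq⟩ hz)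

theorem chain_walk {w : ℕ → I} {n : ℕ} (h : ∀ i < n, G.Adj (w i) (w (i + 1))) :
    ∀ i j, i ≤ j → j ≤ n → ∃ p : G.Walk (w i) (w j), p.length = j - i := by
  intro i j hij
  induction j, hij using Nat.le_induction with
  | base => intro _; exact ⟨SimpleGraph.Walk.nil, by simp⟩
  | succ j hij ih =>
    intro hj
    obtain ⟨p, hp⟩ := ih (by omega)
    refine ⟨p.concat (h j (by omega)), ?_⟩
    rw [SimpleGraph.Walk.length_concat, hp]; omega

theorem geo {a b : I} (hab : G.Reachable a b) : ∃ (w : ℕ → I) (n : ℕ), w 0 = a ∧ w n = b ∧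
    (∀ i < n, G.Adj (w i) (w (i + 1))) ∧
    ∀ i j, i ≤ j → j ≤ n → ∀ p : G.Walk (w i) (w j), j - i ≤ p.length := by
  obtain ⟨p, hp⟩ := hab.exists_walk_length_eq_dist
  have hadj : ∀ i < p.length, G.Adj (p.getVert i) (p.getVert (i + 1)) := fun i hi =>
    p.adj_getVert_succ hi
  refine ⟨p.getVert, p.length, by simp, by simp, hadj, ?_⟩
  intro i j hij hj q
  have h1 := ((p.take i).append q).append (p.drop j) |>.length.le_refl
  have h2 := SimpleGraph.dist_le (((p.take i).append q).append (p.drop j))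
  rw [SimpleGraph.Walk.length_append, SimpleGraph.Walk.length_append,
    SimpleGraph.Walk.take_length, SimpleGraph.Walk.drop_length, ← hp] at h2
  omega

theorem bigeo (hlf : ∀ i, {j | G.Adj i j}.Finite) {F : Set I} (hF : F.Finite) {l : I → ZMod 2}
    (hl : ∀ i j, G.Adj i j → i ∉ F → j ∉ F → l i = l j) {a : I}
    (h0 : {i | G.Reachable a i ∧ i ∉ F ∧ l i = 0}.Infinite)
    (h1 : {i | G.Reachable a i ∧ i ∉ F ∧ l i = 1}.Infinite) :
    ∃ (g : ℤ → I) (K : ℤ), (∀ m, G.Adj (g m) (g (m + 1))) ∧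
      (∀ m n, m + 2 ≤ n → g m ≠ g n ∧ ¬ G.Adj (g m) (g n)) ∧
      (∀ m, K ≤ m → g m ∉ F ∧ l (g m) = 1) ∧ ∀ m, m ≤ -K → g m ∉ F ∧ l (g m) = 0 := by
  obtain ⟨d, hd⟩ := ((hF.prod hF).image (fun x => G.dist x.1 x.2)).bddAbove
  have hd : ∀ f ∈ F, ∀ f' ∈ F, G.dist f f' ≤ d := fun f hf f' hf' =>
    hd ⟨(f, f'), ⟨hf, hf'⟩, rfl⟩
  have key : ∀ k : ℕ, ∃ (w : ℕ → I) (n j : ℕ), k < j ∧ j + k < n ∧ w j ∈ F ∧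
      (∀ i < n, G.Adj (w i) (w (i + 1))) ∧
      (∀ i j, i ≤ j → j ≤ n → ∀ p : G.Walk (w i) (w j), j - i ≤ p.length) ∧
      (∀ i, j < i → i ≤ n → w i ∉ F ∧ l (w i) = 1) ∧
      (∀ i, i + d < j → w i ∉ F ∧ l (w i) = 0) := by
    intro k
    obtain ⟨a', ⟨ha1, ha2, ha3⟩, ha4⟩ := (h0.sdiff (Bl_finite G hlf hF k)).nonempty
    obtain ⟨b', ⟨hb1, hb2, hb3⟩, hb4⟩ := (h1.sdiff (Bl_finite G hlf hF k)).nonempty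
    obtain ⟨w, n, hw0, hwn, hadj, hgeo⟩ := geo G (ha1.symm.trans hb1)
    have hfwd : ∀ m ≤ n, (∀ i ≤ m, w i ∉ F) → ∀ i ≤ m, l (w i) = 0 := by
      intro m hm hmF i hi
      induction i with
      | zero => rw [hw0, ha3]
      | succ i ih =>
        rw [← ih (by omega)]
        exact (hl _ _ (hadj i (by omega)) (hmF i (by omega)) (hmF _ hi)).symm
    have hex : ∃ j ≤ n, w j ∈ F := by
      by_contra hcon
      push Not at hcon
      have := hfwd n le_rfl hcon n le_rfl
      rw [hwn, hb3] at this
      exact one_ne_zero this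
    classical
    obtain ⟨j, hj⟩ : ∃ j, j = Nat.findGreatest (fun j => w j ∈ F) n := ⟨_, rfl⟩
    obtain ⟨j', hj'n, hj'F⟩ := hex
    have hjF : w j ∈ F := by
      rw [hj]; exact Nat.findGreatest_spec (P := fun j => w j ∈ F) hj'n hj'F
    have hjn : j ≤ n := by rw [hj]; exact Nat.findGreatest_le n
    have hafter : ∀ i, j < i → i ≤ n → w i ∉ F := fun i hi hin =>
      Nat.findGreatest_is_greatest (P := fun j => w j ∈ F) (hj ▸ hi) hin
    refine ⟨w, n, j, ?_, ?_, hjF, hadj, hgeo, ?_, ?_⟩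
    · obtain ⟨p, hp⟩ := chain_walk G hadj 0 j (Nat.zero_le _) hjn
      by_contra hcon
      apply ha4
      rw [← hw0]
      exact ⟨w j, hjF, p.reverse, by rw [SimpleGraph.Walk.length_reverse]; omega⟩
    · obtain ⟨p, hp⟩ := chain_walk G hadj j n hjn le_rfl
      by_contra hcon
      apply hb4
      rw [← hwn]
      exact ⟨w j, hjF, p, by omega⟩
    · intro i hi hin
      refine ⟨hafter i hi hin, ?_⟩
      have : ∀ m, m ≤ n - i → l (w (n - m)) = 1 := by
        intro m hm
        induction m with
        | zero => rw [Nat.sub_zero, hwn, hb3]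
        | succ m ih =>
          rw [← ih (by omega)]
          have h2 := hadj (n - (m + 1)) (by omega)
          rw [show n - (m + 1) + 1 = n - m by omega] at h2
          exact hl _ _ h2 (hafter _ (by omega) (by omega)) (hafter _ (by omega) (by omega))
      have h3 := this (n - i) le_rfl
      rwa [show n - (n - i) = i by omega] at h3
    · have hno : ∀ i, i + d < j → w i ∉ F := by
        intro i hi hiF
        obtain ⟨p, hp⟩ := chain_walk G hadj i j (by omega) hjn
        obtain ⟨q, hq⟩ := p.reachable.exists_walk_length_eq_dist
        have h2 := hgeo i j (by omega) hjn q
        have h3 := hd _ hiF _ hjF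
        omega
      intro i hi
      exact ⟨hno i hi, hfwd i (by omega) (fun i' hi' => hno i' (by omega)) i le_rfl⟩
  choose w n j hkj hjn hjF hadj hgeo hright hleft using key
  have hfin : ∀ m : ℤ, ∀ k : ℕ, m.natAbs ≤ k → w k (j k + m).toNat ∈ Bl G F m.natAbs := by
    intro m k hk
    have := hkj k
    have := hjn k
    rcases le_total 0 m with hm | hm
    · obtain ⟨p, hp⟩ := chain_walk G (hadj k) (j k) (j k + m).toNat (by omega) (by omega)
      exact ⟨_, hjF k, p, by omega⟩
    · obtain ⟨p, hp⟩ := chain_walk G (hadj k) (j k + m).toNat (j k) (by omega) (by omega)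
      exact ⟨_, hjF k, p.reverse, by rw [SimpleGraph.Walk.length_reverse]; omega⟩
  set 𝓤 : Ultrafilter ℕ := hyperfilter ℕ
  have hge : ∀ K : ℕ, ∀ᶠ k in (𝓤 : Filter ℕ), K ≤ k := fun K =>
    (Nat.hyperfilter_le_atTop) (eventually_ge_atTop K)
  have hlim : ∀ m : ℤ, ∃ x, ∀ᶠ k in (𝓤 : Filter ℕ), w k (j k + m).toNat = x := by
    intro m
    have h2 : ∀ᶠ k in (𝓤 : Filter ℕ), ∃ x ∈ Bl G F m.natAbs, w k (j k + m).toNat = x := by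
      filter_upwards [hge m.natAbs] with k hk
      exact ⟨_, hfin m k hk, rfl⟩
    obtain ⟨x, -, hx⟩ := (Ultrafilter.eventually_exists_mem_iff (Bl_finite G hlf hF _)).1 h2
    exact ⟨x, hx⟩
  choose g hg using hlim
  refine ⟨g, d + 1, ?_, ?_, ?_, ?_⟩
  · intro m
    obtain ⟨k, ⟨h2, h3⟩, h4⟩ := (((hg m).and (hg (m + 1))).and (hge (m.natAbs + 1))).exists
    have := hkj k
    have := hjn k
    rw [← h2, ← h3]
    convert hadj k (j k + m).toNat (by omega) using 2
    omega
  · intro m m' hmm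
    obtain ⟨k, ⟨h2, h3⟩, h4⟩ :=
      (((hg m).and (hg m')).and (hge (m.natAbs + m'.natAbs + 1))).exists
    have := hkj k
    have := hjn k
    have hp := hgeo k (j k + m).toNat (j k + m').toNat (by omega) (by omega)
    rw [h2, h3] at hp
    constructor
    · intro he
      rw [← he] at hp
      have := hp SimpleGraph.Walk.nil
      simp at this
      omega
    · intro he
      have := hp he.toWalk
      simp at this
      omega
  · intro m hm
    obtain ⟨k, h2, h4⟩ := ((hg m).and (hge (m.natAbs + 1))).exists
    have := hkj k
    have := hjn k
    rw [← h2]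
    exact hright k _ (by omega) (by omega)
  · intro m hm
    obtain ⟨k, h2, h4⟩ := ((hg m).and (hge (m.natAbs + 1))).exists
    have := hkj k
    have := hjn k
    rw [← h2]
    exact hleft k _ (by omega)
end Graph
end DP

namespace DP
universe u
section SepLine
variable {S : Type u} [MetricSpace S] [CompactSpace S]

theorem cover (hc : HasCharts S) {U N F : Set S} (hU : IsOpen U) (hN : IsOpen N)
    (hF : IsClosed F) (hFN : U ∩ F ⊆ N) :
    ∃ (I : Type u) (e : I → ℂ → S), (∀ i, IsOpenEmbedding (e i)) ∧
      (∀ i, closure (range (e i)) ⊆ N) ∧ (U ∩ F ⊆ ⋃ i, range (e i)) ∧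
      ∀ K, IsCompact K → K ⊆ U → {i | (range (e i) ∩ K).Nonempty}.Finite := by
  have := hU.locallyCompactSpace
  have hsc : SigmaCompactSpace U := inferInstance
  obtain ⟨I, c, r, h1, h2, h3⟩ := refinement_of_locallyCompact_sigmaCompact_of_nhds_basis_set
    (X := U) (ι := fun _ => ℂ → S)
    (p := fun x e => IsOpenEmbedding e ∧ x.1 ∈ range e ∧ closure (range e) ⊆ N)
    (B := fun _ e => Subtype.val ⁻¹' range e) (s := Subtype.val ⁻¹' F)
    (hF.preimage continuous_subtype_val) (by
      intro x hx
      refine ⟨fun t => ⟨fun ht => ?_, ?_⟩⟩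
      · rw [nhds_subtype_eq_comap, mem_comap] at ht
        obtain ⟨t', ht', htt⟩ := ht
        have hxN : x.1 ∈ N := hFN ⟨x.2, hx⟩
        obtain ⟨K, hK, hKc, hKs⟩ := exists_mem_nhds_isClosed_subset
          (inter_mem ht' (hN.mem_nhds hxN))
        obtain ⟨e, he, he0, her⟩ := hc x.1 (interior K) isOpen_interior
          (mem_interior_iff_mem_nhds.2 hK)
        have hrK := her.trans interior_subset
        refine ⟨e, ⟨he, ⟨0, he0⟩, ?_⟩, ?_⟩
        · exact (closure_minimal hrK hKc).trans (hKs.trans inter_subset_right)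
        · intro y hy
          exact htt (hKs (hrK hy)).1
      · rintro ⟨e, ⟨he, hxe, -⟩, hs⟩
        exact mem_of_superset ((he.isOpen_range.preimage continuous_subtype_val).mem_nhds hxe) hs)
  refine ⟨I, r, fun i => (h1 i).2.1, fun i => (h1 i).2.2.2, ?_, ?_⟩
  · rintro x ⟨hxU, hxF⟩
    have := h2 (show (⟨x, hxU⟩ : U) ∈ Subtype.val ⁻¹' F from hxF)
    rw [mem_iUnion] at this ⊢
    exact this
  · intro K hK hKU
    have hK' : IsCompact (Subtype.val ⁻¹' K : Set U) :=
      Topology.IsInducing.subtypeVal.isCompact_preimage' hK (by simpa using hKU)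
    refine (h3.finite_nonempty_inter_compact hK').subset ?_
    rintro i ⟨x, hx1, hx2⟩
    exact ⟨⟨x, hKU hx2⟩, hx1, hx2⟩

/-- the intersection graph -/
def iGraph {I : Type*} (e : I → ℂ → S) : SimpleGraph I where
  Adj i j := i ≠ j ∧ (range (e i) ∩ range (e j)).Nonempty
  symm := ⟨fun i j h => ⟨h.1.symm, by rw [inter_comm]; exact h.2⟩⟩
  loopless := ⟨fun i h => h.1 rfl⟩

theorem sep_line0 (hc : HasCharts S) {U N V V' C : Set S} (hU : IsOpen U) (hN : IsOpen N)
    (hNU : N ⊆ U) (hV : IsOpen V) (hV' : IsOpen V') (hd : Disjoint V V') (hcov : U ⊆ V ∪ V' ∪ N)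
    {x0 y0 : S} (hx0 : x0 ∈ V) (hy0 : y0 ∉ V) (hy0' : y0 ∉ N) {ω : S → S → ZMod 2}
    (hω : Om ω C U x0 y0) {h : S → ZMod 2} (hs : ∀ x ∈ N, Sec ω h x) :
    ∃ γ, PLine U γ ∧ range γ ⊆ N ∧ ∃ K : ℝ, (∀ t, K ≤ t → h (γ t) = 1) ∧
      ∀ t, t ≤ -K → h (γ t) = 0 := by
  classical
  obtain ⟨I, e, he, heN, hecov, hefin⟩ := cover hc hU hN (hV.union hV').isClosed_compl
    (by rintro p ⟨h1, h2⟩; exact (hcov h1).resolve_left h2)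
  have herN : ∀ i, range (e i) ⊆ N := fun i => subset_closure.trans (heN i)
  have hrc : ∀ i, IsPreconnected (range (e i)) := fun i => isPreconnected_range (he i).continuous
  set Gr := iGraph e with hGr
  have hlf : ∀ i, {j | Gr.Adj i j}.Finite := by
    intro i
    refine (hefin (closure (range (e i))) isClosed_closure.isCompact ((heN i).trans hNU)).subset ?_
    rintro j ⟨-, p, hp1, hp2⟩
    exact ⟨p, hp2, subset_closure hp1⟩
  set F : Set I := {i | (range (e i) ∩ C).Nonempty} with hFdef
  have hF : F.Finite := hefin C hω.cpt hω.sub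
  have hconst : ∀ i, i ∉ F → ∀ p ∈ range (e i), h p = h (e i 0) := by
    intro i hi p hp
    refine lcst_pre (hrc i) (fun q hq => ?_) hp (mem_range_self 0)
    have := (hω.sec0 q (fun hqC => hi ⟨q, hq, hqC⟩)).lcst_add (hs q (herN i hq))
    rwa [zero_add] at this
  set l : I → ZMod 2 := fun i => h (e i 0) with hldef
  have hl : ∀ i j, Gr.Adj i j → i ∉ F → j ∉ F → l i = l j := by
    rintro i j ⟨-, p, hp1, hp2⟩ hi hj
    rw [hldef]
    simp only
    rw [← hconst i hi p hp1, ← hconst j hj p hp2]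
  by_cases hboth : ∃ a, {i | Gr.Reachable a i ∧ i ∉ F ∧ l i = 0}.Infinite ∧
      {i | Gr.Reachable a i ∧ i ∉ F ∧ l i = 1}.Infinite
  · obtain ⟨a, ha0, ha1⟩ := hboth
    obtain ⟨g, K, hg1, hg2, hg3, hg4⟩ := bigeo Gr hlf hF hl ha0 ha1
    have hginj : ∀ m n, m < n → g m ≠ g n := by
      intro m n hmn
      rcases (show n = m + 1 ∨ m + 2 ≤ n by omega) with rfl | h2
      · exact (hg1 m).ne
      · exact (hg2 m n h2).1
    have hginj' : Function.Injective g := by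
      intro m n hmn
      by_contra hne
      rcases lt_or_gt_of_ne hne with h2 | h2
      · exact hginj m n h2 hmn
      · exact hginj n m h2 hmn.symm
    obtain ⟨γ, hγ, hγr⟩ := exists_line hU (e := fun n => e (g n)) (fun n => he _)
      (fun n => (herN _).trans hNU) (fun n => (hg1 n).2)
      (fun m n hmn => by
        rw [disjoint_iff_inter_eq_empty, ← not_nonempty_iff_eq_empty]
        intro h2
        exact (hg2 m n hmn).2 ⟨(hg2 m n hmn).1, h2⟩)
      (fun K hK hKU => by
        have h5 := Set.Finite.preimage (f := g) (s := {i | (range (e i) ∩ K).Nonempty})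
          hginj'.injOn (hefin K hK hKU)
        exact h5)
    refine ⟨γ, hγ, ?_, K + 1, ?_, ?_⟩
    · rintro _ ⟨t, rfl⟩
      exact herN _ (hγr t)
    · intro t ht
      have h2 : K ≤ ⌊t⌋ := Int.le_floor.2 (by linarith)
      rw [hconst _ (hg3 _ h2).1 _ (hγr t)]
      exact (hg3 _ h2).2
    · intro t ht
      have h2 : ⌊t⌋ ≤ -K := by
        have h3 : (⌊t⌋ : ℝ) ≤ ((-K : ℤ) : ℝ) := by
          push_cast; linarith [Int.floor_le t]
        exact_mod_cast h3
      rw [hconst _ (hg4 _ h2).1 _ (hγr t)]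
      exact (hg4 _ h2).2
  · exfalso
    push Not at hboth
    -- the constant of a component
    have hcc : ∀ κ : Gr.ConnectedComponent, ∃ c : ZMod 2,
        {i | Gr.connectedComponentMk i = κ ∧ i ∉ F ∧ l i ≠ c}.Finite ∧
        ((∀ i, Gr.connectedComponentMk i = κ → i ∉ F) →
          ∀ i, Gr.connectedComponentMk i = κ → l i = c) := by
      intro κ
      induction κ using SimpleGraph.ConnectedComponent.ind with
      | _ a =>
        by_cases hκ : ∀ i, Gr.connectedComponentMk i = Gr.connectedComponentMk a → i ∉ F
        · have hall : ∀ i, Gr.connectedComponentMk i = Gr.connectedComponentMk a → l i = l a := by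
            intro i hi
            obtain ⟨p⟩ := SimpleGraph.ConnectedComponent.exact hi
            clear hi
            have : ∀ {x y : I} (p : Gr.Walk x y),
                Gr.connectedComponentMk y = Gr.connectedComponentMk a → l x = l y := by
              intro x y p
              induction p with
              | nil => intro _; rfl
              | cons hadj p ih =>
                intro hy
                rw [← ih hy]
                have h2 := (SimpleGraph.ConnectedComponent.sound p.reachable).trans hy
                refine hl _ _ hadj (hκ _ ?_) (hκ _ h2)
                exact (SimpleGraph.ConnectedComponent.sound hadj.reachable).trans h2
            exact this p rfl
          refine ⟨l a, ?_, fun _ => hall⟩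
          convert Set.finite_empty
          rw [eq_empty_iff_forall_notMem]
          rintro i ⟨h2, -, h3⟩
          exact h3 (hall i h2)
        · by_cases h0 : {i | Gr.Reachable a i ∧ i ∉ F ∧ l i = 0}.Infinite
          · refine ⟨0, ?_, fun h2 => absurd h2 hκ⟩
            refine (hboth a h0).subset ?_
            rintro i ⟨h2, h3, h4⟩
            exact ⟨(SimpleGraph.ConnectedComponent.exact h2).symm, h3, (z2 _).resolve_left h4⟩
          · refine ⟨1, ?_, fun h2 => absurd h2 hκ⟩
            refine (not_infinite.1 h0).subset ?_
            rintro i ⟨h2, h3, h4⟩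
            exact ⟨(SimpleGraph.ConnectedComponent.exact h2).symm, h3, (z2 _).resolve_right h4⟩
    choose c hc1 hc2 using hcc
    set mk := Gr.connectedComponentMk with hmk
    set Bad : Set I := {i | i ∉ F ∧ l i ≠ c (mk i)} with hBad
    have hBadf : Bad.Finite := by
      refine (hF.biUnion (fun f _ => hc1 (mk f))).subset ?_
      rintro i ⟨h2, h3⟩
      by_cases hi : ∀ j, mk j = mk i → j ∉ F
      · exact absurd (hc2 (mk i) hi i rfl) h3
      · push Not at hi
        obtain ⟨j, hj, hjF⟩ := hi
        refine mem_biUnion hjF ⟨hj.symm, h2, ?_⟩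
        rw [hj]; exact h3
    have hsame : ∀ i j p, p ∈ range (e i) → p ∈ range (e j) → mk i = mk j := by
      intro i j p hi hj
      by_cases hij : i = j
      · rw [hij]
      · have : Gr.Adj i j := ⟨hij, p, hi, hj⟩
        exact SimpleGraph.ConnectedComponent.sound this.reachable
    set k : S → ZMod 2 := fun p => if hp : ∃ i, p ∈ range (e i) then c (mk hp.choose) else 0
      with hk
    have hkv : ∀ i p, p ∈ range (e i) → k p = c (mk i) := by
      intro i p hp
      have hp' : ∃ i, p ∈ range (e i) := ⟨i, hp⟩
      have : k p = c (mk hp'.choose) := by rw [hk]; exact dif_pos hp'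
      rw [this, hsame _ _ p hp'.choose_spec hp]
    have hkl : ∀ p ∈ ⋃ i, range (e i), LCst k p := by
      intro p hp
      obtain ⟨i, hi⟩ := mem_iUnion.1 hp
      filter_upwards [(he i).isOpen_range.mem_nhds hi] with q hq
      rw [hkv i q hq, hkv i p hi]
    have hFB := hF.union hBadf
    refine cutR (C := C) (C2 := ⋃ i ∈ F ∪ Bad, closure (range (e i))) (N1 := ⋃ i, range (e i))
      (h := h + k) hc hV hV' (isOpen_iUnion fun i => (he i).isOpen_range) hd hω.cpt.isClosed
      (hFB.isClosed_biUnion fun i _ => isClosed_closure) ?_ hx0 hy0 ?_ hω.sec0 hω.lc hω.br1 ?_ ?_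
    · have hUc : U ⊆ V ∪ V' ∪ ⋃ i, range (e i) := by
        intro p hp
        by_cases hp' : p ∈ V ∪ V'
        · exact Or.inl hp'
        · exact Or.inr (hecov ⟨hp, hp'⟩)
      refine (union_subset hω.sub ?_).trans hUc
      exact iUnion₂_subset fun i _ => (heN i).trans hNU
    · intro h2
      obtain ⟨i, hi⟩ := mem_iUnion.1 h2
      exact hy0' (herN i hi)
    · intro p hp
      obtain ⟨i, hi⟩ := mem_iUnion.1 hp
      exact (hs p (herN i hi)).add_lcst (hkl p hp)
    · intro p hp hp2
      obtain ⟨i, hi⟩ := mem_iUnion.1 hp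
      have hi2 : i ∉ F ∪ Bad := fun h3 => hp2 (mem_biUnion h3 (subset_closure hi))
      have hiF : i ∉ F := fun h3 => hi2 (Or.inl h3)
      have hiB : l i = c (mk i) := by
        by_contra h3
        exact hi2 (Or.inr ⟨hiF, h3⟩)
      have h4 : h p = c (mk i) := (hconst i hiF p hi).trans hiB
      rw [Pi.add_apply, h4, hkv i p hi]
      exact CharTwo.add_self_eq_zero _

theorem sep_line (hc : HasCharts S) {U N V V' C : Set S} (hU : IsOpen U)
    (hUc : IsConnected Uᶜ) (hsU : Simp U) (hN : IsOpen N)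
    (hNU : N ⊆ U) (hV : IsOpen V) (hV' : IsOpen V') (hd : Disjoint V V') (hcov : U ⊆ V ∪ V' ∪ N)
    {x0 y0 : S} (hx0 : x0 ∈ V) (hy0 : y0 ∉ V) (hx0' : x0 ∉ N) (hy0' : y0 ∉ N) (hx0U : x0 ∈ U)
    {ω : S → S → ZMod 2}
    (hω : Om ω C U x0 y0) {h : S → ZMod 2} (hs : ∀ x ∈ N, Sec ω h x) :
    ∃ γ, PLine U γ ∧ range γ ⊆ N ∧ y0 ∉ connectedComponentIn (U \ range γ) x0 := by
  have hcl := hc.locConn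
  obtain ⟨γ, hγ, hγN, K, hK1, hK0⟩ :=
    sep_line0 hc hU hN hNU hV hV' hd hcov hx0 hy0 hy0' hω hs
  refine ⟨γ, hγ, hγN, fun hy => ?_⟩
  set O := connectedComponentIn (U \ range γ) x0 with hO
  have hxO : x0 ∈ O := mem_connectedComponentIn ⟨hx0U, fun h2 => hx0' (hγN h2)⟩
  have hOs : O ⊆ U \ range γ := connectedComponentIn_subset _ _
  obtain ⟨r, c, hr, hrc⟩ := sec_off hc hUc hsU (hγ.open'.connectedComponentIn)
    isPreconnected_connectedComponentIn (hOs.trans sdiff_subset) hxO hy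
    (fun h2 => hy0 (h2 ▸ hx0)) hω
  have hpre : IsPreconnected (range γ) := isPreconnected_range hγ.emb.continuous
  have hcst : ∀ s t, (h + r) (γ s) = (h + r) (γ t) := by
    intro s t
    refine lcst_pre hpre (fun p hp => ?_) (mem_range_self s) (mem_range_self t)
    exact (hs p (hγN hp)).lcst_add (hr p fun h2 => (hOs h2).2 hp)
  have hcl2 : ∀ δ : ℝ → S, PLine U δ → ∀ L : ℝ, ∃ t ≥ L, r (δ t) = c := by
    intro δ hδ L
    obtain ⟨p, -, hp⟩ := isCompact_univ.exists_mapClusterPt (u := δ) (f := atTop) (by simp)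
    have h2 := (hp.frequently (hrc p (hδ.end_frontier hp).2.1)).and_eventually
      (eventually_ge_atTop L)
    obtain ⟨t, ht1, ht2⟩ := h2.exists
    exact ⟨t, ht2, ht1⟩
  obtain ⟨s, hs1, hs2⟩ := hcl2 γ hγ K
  obtain ⟨t, ht1, ht2⟩ := hcl2 _ hγ.neg K
  have := hcst s (-t)
  rw [Pi.add_apply, Pi.add_apply, hK1 s hs1, hK0 (-t) (by linarith)] at this
  rw [hs2, ht2] at this
  have h3 : (1 : ZMod 2) = 0 := add_right_cancel this
  exact absurd h3 (by decide)
end SepLine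
end DP

namespace DP
universe u
section Back
variable {S : Type u} [MetricSpace S] [CompactSpace S] [ConnectedSpace S]

theorem good_cut (hc : HasCharts S) {X A B : Set S} (hX : IsClosed X) (hXc : IsConnected X)
    (hA : IsClosed A) (hB : IsClosed B) (hAn : A.Nonempty) (hBn : B.Nonempty) (hAB : A ∪ B = X)
    {x y : S} (hx : x ∈ X) (hy : y ∈ X) {c : ℝ} (hc0 : 0 < c) {D D' : Set S}
    (hDo : IsOpen D) (hDo' : IsOpen D')
    (hDc : IsPreconnected D) (hDc' : IsPreconnected D') (hxD : x ∈ D) (hyD : y ∈ D')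
    (hD : ∀ p ∈ D, infDist p A - infDist p B < -c) (hD' : ∀ p ∈ D', c < infDist p A - infDist p B)
    {U : Set S} (hU : IsComplementaryDomain X U) (hs : Simp U) (hUD : (U ∩ D).Nonempty)
    (hUD' : (U ∩ D').Nonempty) (h1 : U ∉ BadDom X B D) (h2 : U ∉ BadDom X A D') :
    ∃ γ, PLine U γ ∧ ∀ T, IsShadowOf U (range γ) T → Disjoint T D ∨ Disjoint T D' := by
  have hUo := dom_open hc hX hU
  have hxU : x ∉ U := fun h => dom_sub hU h hx
  have hyU : y ∉ U := fun h => dom_sub hU h hy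
  set φ : S → ℝ := fun p => infDist p A - infDist p B with hφ
  have hφc : Continuous φ := (continuous_infDist_pt A).sub (continuous_infDist_pt B)
  obtain ⟨x0, hx0U, hx0D⟩ := hUD
  obtain ⟨y0, hy0U, hy0D⟩ := hUD'
  have hx0φ : φ x0 < -c := hD x0 hx0D
  have hy0φ : c < φ y0 := hD' y0 hy0D
  have hxy : x0 ≠ y0 := by
    rintro rfl; linarith
  set N : Set S := U ∩ {p | |φ p| < min c (infDist p Uᶜ)} with hNdef
  have hNo : IsOpen N := hUo.inter
    (isOpen_lt hφc.abs (continuous_const.min (continuous_infDist_pt _)))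
  have hNU : N ⊆ U := inter_subset_left
  have hDN : Disjoint D N := by
    rw [disjoint_left]
    rintro p hp ⟨-, hp2⟩
    have h3 := hD p hp
    have h4 : |φ p| < c := lt_of_lt_of_le hp2 (min_le_left _ _)
    have := (abs_lt.1 h4).1
    simp only [hφ] at this
    linarith
  have hDN' : Disjoint D' N := by
    rw [disjoint_left]
    rintro p hp ⟨-, hp2⟩
    have h3 := hD' p hp
    have h4 : |φ p| < c := lt_of_lt_of_le hp2 (min_le_left _ _)
    have := (abs_lt.1 h4).2
    simp only [hφ] at this
    linarith
  obtain ⟨ω, C, hω⟩ := exists_om hc hUo (dom_conn hU).isPreconnected hx0U hy0U hxy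
  obtain ⟨h, hh⟩ := sec_N hc hUo (dom_conn hU) (dom_compl_conn hc hX hXc hU) hs hNo hNU hDc hDc'
    hDN hDN' hxD hxU hx0D hx0U hyD hyU hy0D hy0U hxy (dom_frontier_ne hXc.nonempty hU) hω
  obtain ⟨γ, hγ, hγN, hsep⟩ := sep_line hc (V := U ∩ {p | φ p < 0}) (V' := U ∩ {p | 0 < φ p})
    hUo (dom_compl_conn hc hX hXc hU) hs hNo hNU
    (hUo.inter (isOpen_lt hφc continuous_const)) (hUo.inter (isOpen_lt continuous_const hφc))
    (by
      rw [disjoint_left]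
      rintro p ⟨-, hp⟩ ⟨-, hp'⟩
      have hp : φ p < 0 := hp
      have hp' : 0 < φ p := hp'
      linarith)
    (by
      intro p hp
      rcases lt_trichotomy (φ p) 0 with h3 | h3 | h3
      · exact Or.inl (Or.inl ⟨hp, h3⟩)
      · refine Or.inr ⟨hp, ?_⟩
        simp only [mem_ofPred_eq, h3, abs_zero]
        refine lt_min hc0 ?_
        exact (hUo.isClosed_compl.notMem_iff_infDist_pos ⟨x, hxU⟩).1 (fun h4 => h4 hp)
      · exact Or.inl (Or.inr ⟨hp, h3⟩))
    (x0 := x0) (y0 := y0) ⟨hx0U, show φ x0 < 0 by linarith⟩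
    (fun h3 => by have : φ y0 < 0 := h3.2; linarith)
    (fun h3 => disjoint_left.1 hDN hx0D h3) (fun h3 => disjoint_left.1 hDN' hy0D h3) hx0U hω hh
  have hend : closure (range γ) \ range γ ⊆ A ∩ B := by
    rintro p ⟨hp1, hp2⟩
    have hpU : p ∉ U := fun h3 => hp2 (hγ.cl p h3 hp1)
    have hpX : p ∈ X := by
      refine dom_frontier hc hX hU ?_
      rw [hUo.frontier_eq]
      exact ⟨closure_mono hγ.sub hp1, hpU⟩
    have hle : |φ p| ≤ infDist p Uᶜ := by
      have hcl : IsClosed {q | |φ q| ≤ infDist q Uᶜ} :=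
        isClosed_le hφc.abs (continuous_infDist_pt _)
      refine closure_minimal (fun q hq => ?_) hcl hp1
      have h5 : |φ q| < min c (infDist q Uᶜ) := (hγN hq).2
      exact (h5.trans_le (min_le_right _ _)).le
    rw [infDist_zero_of_mem (show p ∈ Uᶜ from hpU)] at hle
    have h0 : φ p = 0 := abs_nonpos_iff.1 hle
    simp only [hφ] at h0
    rw [← hAB] at hpX
    rcases hpX with h3 | h3
    · rw [infDist_zero_of_mem h3, zero_sub, neg_eq_zero] at h0
      exact ⟨h3, (hB.mem_iff_infDist_zero hBn).2 h0⟩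
    · rw [infDist_zero_of_mem h3, sub_zero] at h0
      exact ⟨(hA.mem_iff_infDist_zero hAn).2 h0, h3⟩
  have hallD : ∀ p ∈ U ∩ D, p ∈ connectedComponentIn (U \ range γ) x0 := by
    intro p hp
    by_contra h3
    exact h1 ⟨hU, γ, hγ, (hDN.mono_right hγN).symm, hend.trans inter_subset_right,
      x0, ⟨hx0U, hx0D⟩, p, hp, h3⟩
  have hallD' : ∀ p ∈ U ∩ D', p ∈ connectedComponentIn (U \ range γ) y0 := by
    intro p hp
    by_contra h3
    exact h2 ⟨hU, γ, hγ, (hDN'.mono_right hγN).symm, hend.trans inter_subset_left,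
      y0, ⟨hy0U, hy0D⟩, p, hp, h3⟩
  refine ⟨γ, hγ, ?_⟩
  rintro T ⟨z, hz, rfl⟩
  by_contra hno
  rw [not_or, not_disjoint_iff, not_disjoint_iff] at hno
  obtain ⟨⟨p, hp, hpD⟩, q, hq, hqD⟩ := hno
  obtain ⟨p', hp'D, hp'⟩ := _root_.mem_closure_iff.1 hp.1 D hDo hpD
  obtain ⟨q', hq'D, hq'⟩ := _root_.mem_closure_iff.1 hq.1 D' hDo' hqD
  have e1 := hallD p' ⟨(connectedComponentIn_subset _ _ hp').1, hp'D⟩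
  have e2 := hallD' q' ⟨(connectedComponentIn_subset _ _ hq').1, hq'D⟩
  rw [connectedComponentIn_eq e1, ← connectedComponentIn_eq hp', connectedComponentIn_eq hq',
    ← connectedComponentIn_eq e2] at hsep
  exact hsep (mem_connectedComponentIn ⟨hy0U, fun h3 => disjoint_left.1 hDN' hy0D (hγN h3)⟩)

theorem backward (hc : HasCharts S) {X : Set S} (hX : IsClosed X) (hXc : IsConnected X)
    (hsh : IsShielded X) {U : ℕ → Set S} (hU : ∀ n, IsComplementaryDomain X (U n))
    (hdp : DoublePassCondition X U) : ¬ IsDecomposable X := by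
  classical
  rintro ⟨A, B, ⟨hAn, hA, hAc, hAX, hAne⟩, ⟨hBn, hB, hBc, hBX, hBne⟩, hAB⟩
  obtain ⟨x, hxX, hxB⟩ : ∃ x ∈ X, x ∉ B := by
    by_contra h
    push Not at h
    exact hBne (hBX.antisymm h)
  obtain ⟨y, hyX, hyA⟩ : ∃ y ∈ X, y ∉ A := by
    by_contra h
    push Not at h
    exact hAne (hAX.antisymm h)
  have hxA : x ∈ A := by
    have := hxX
    rw [← hAB] at this
    exact this.resolve_right hxB
  have hyB : y ∈ B := by
    have := hyX
    rw [← hAB] at this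
    exact this.resolve_left hyA
  have hφc : Continuous (fun p => infDist p A - infDist p B) :=
    (continuous_infDist_pt A).sub (continuous_infDist_pt B)
  have hx0 : 0 < infDist x B := (hB.notMem_iff_infDist_pos hBn).1 hxB
  have hy0 : 0 < infDist y A := (hA.notMem_iff_infDist_pos hAn).1 hyA
  obtain ⟨c, hc0, hcx, hcy⟩ : ∃ c : ℝ, 0 < c ∧ c < infDist x B ∧ c < infDist y A := by
    obtain ⟨c, h1, h2⟩ := exists_between (lt_min hx0 hy0)
    exact ⟨c, h1, h2.trans_le (min_le_left _ _), h2.trans_le (min_le_right _ _)⟩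
  obtain ⟨D, hDo, hxD, hD, hDc⟩ := hc.conn_nhds (isOpen_lt hφc (continuous_const (y := -c)))
    (show x ∈ _ by simp only [mem_ofPred_eq, infDist_zero_of_mem hxA]; linarith)
  obtain ⟨D', hDo', hyD, hD', hDc'⟩ := hc.conn_nhds (isOpen_lt (continuous_const (y := c)) hφc)
    (show y ∈ _ by simp only [mem_ofPred_eq, infDist_zero_of_mem hyB]; linarith)
  have hDB : Disjoint D B := by
    rw [disjoint_left]
    intro p hp hpB
    have h1 : infDist p A - infDist p B < -c := hD hp
    rw [infDist_zero_of_mem hpB] at h1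
    linarith [infDist_nonneg (x := p) (s := A)]
  have hDA : Disjoint D' A := by
    rw [disjoint_left]
    intro p hp hpA
    have h1 : c < infDist p A - infDist p B := hD' hp
    rw [infDist_zero_of_mem hpA] at h1
    linarith [infDist_nonneg (x := p) (s := B)]
  have hd : ∀ ε > 0, ∀ᶠ n in atTop, ∀ x ∈ X, ∃ y ∈ frontier (U n), dist x y < ε :=
    fun ε hε => dp_dense hc hX hXc hU hdp hε
  have hb1 := (eventually_all_finite (nonalt hc hX hBX hBc hDo hDc hDB)).2
    (fun V _ => finite_often hc hX hsh hU hd V)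
  have hb2 := (eventually_all_finite (nonalt hc hX hAX hAc hDo' hDc' hDA)).2
    (fun V _ => finite_often hc hX hsh hU hd V)
  obtain ⟨ε, hε, hεD⟩ := Metric.isOpen_iff.1 hDo x hxD
  obtain ⟨δ, hδ, hδD⟩ := Metric.isOpen_iff.1 hDo' y hyD
  have hmeet : ∀ (G E : Set S), IsOpen E → (frontier G ∩ E).Nonempty → (G ∩ E).Nonempty := by
    rintro G E hE ⟨p, hp, hpE⟩
    obtain ⟨q, hq1, hq2⟩ := _root_.mem_closure_iff.1 (frontier_subset_closure hp) E hE hpE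
    exact ⟨q, hq2, hq1⟩
  have hev : ∀ᶠ n in atTop, ∃ γ, PLine (U n) γ ∧
      ∀ T, IsShadowOf (U n) (range γ) T → Disjoint T D ∨ Disjoint T D' := by
    filter_upwards [hb1, hb2, ev_simp hc hX hXc hsh hU hd, hd ε hε, hd δ hδ] with
      n h1 h2 h3 h4 h5
    refine good_cut hc hX hXc hA hB hAn hBn hAB hxX hyX hc0 hDo hDo' hDc hDc' hxD hyD
      (fun p hp => hD hp) (fun p hp => hD' hp) (hU n) h3 (hmeet _ _ hDo ?_) (hmeet _ _ hDo' ?_)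
      (fun h => h1 _ h rfl) (fun h => h2 _ h rfl)
    · obtain ⟨z, hz, hzd⟩ := h4 x hxX
      exact ⟨z, hz, hεD (by rw [mem_ball']; exact hzd)⟩
    · obtain ⟨z, hz, hzd⟩ := h5 y hyX
      exact ⟨z, hz, hδD (by rw [mem_ball']; exact hzd)⟩
  have hK : ∀ n, ∃ γ, PLine (U n) γ ∧ ((∃ γ, PLine (U n) γ ∧
      ∀ T, IsShadowOf (U n) (range γ) T → Disjoint T D ∨ Disjoint T D') →
      ∀ T, IsShadowOf (U n) (range γ) T → Disjoint T D ∨ Disjoint T D') := by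
    intro n
    by_cases h : ∃ γ, PLine (U n) γ ∧
      ∀ T, IsShadowOf (U n) (range γ) T → Disjoint T D ∨ Disjoint T D'
    · obtain ⟨γ, h1, h2⟩ := h
      exact ⟨γ, h1, fun _ => h2⟩
    · obtain ⟨γ, h1⟩ := exists_pline hc (dom_open hc hX (hU n))
        (dom_frontier_ne hXc.nonempty (hU n))
      exact ⟨γ, h1, fun h2 => absurd h2 h⟩
  choose γ hγ hγ2 using hK
  obtain ⟨T, hT, hconv⟩ := hdp _ (fun n => (hγ n).crosscut)
  have hne := fun n => shadow_ne hc (dom_open hc hX (hU n)) (dom_conn (hU n)) (hγ n).crosscut (hT n)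
  obtain ⟨n, h1, h2, h3⟩ := (hev.and ((conv_dense hXc.nonempty hne hconv hε).and
    (conv_dense hXc.nonempty hne hconv hδ))).exists
  rcases hγ2 n h1 (T n) (hT n) with h4 | h4
  · obtain ⟨z, hz, hzd⟩ := h2 x hxX
    exact disjoint_left.1 h4 hz (hεD (by rw [mem_ball']; exact hzd))
  · obtain ⟨z, hz, hzd⟩ := h3 y hyX
    exact disjoint_left.1 h4 hz (hδD (by rw [mem_ball']; exact hzd))
end Back
end DP

/-- **Characterization of shielded indecomposable continua.** A shielded continuum
`X` in a closed surface `S` is indecomposable if and only if it has a sequence of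
complementary domains satisfying the double-pass condition. -/
theorem shielded_indecomposable_iff_doublePass
    {S : Type*} [MetricSpace S] [CompactSpace S] [ConnectedSpace S] [Nonempty S]
    (hS : LocallyEuclidean2 S)
    (X : Set S) (hX : IsContinuum X) (hsh : IsShielded X) :
    ¬ IsDecomposable X ↔
      ∃ U : ℕ → Set S, (∀ n, IsComplementaryDomain X (U n)) ∧
        DoublePassCondition X U := by
  have hc := DP.hasCharts_of hS
  constructor
  · exact fun hind => DP.forward hc hX.1.isClosed hX.2 hsh hind
  · rintro ⟨U, hU, hdp⟩
    exact DP.backward hc hX.1.isClosed hX.2 hsh hU hdp
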